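/- Let f: ℝⁿ → ℝᵐ be a Borel function with n ≥ m, satisfying: (a) ap-limsup_{y→x} |f(y)-f(x)|/|y-x| < ∞ for all x outside a countable set; (b) f is approximately differentiable of order 1 outside an H^m-null set; (c) for each i = 2,…,n-m, f is approximately differentiable of order i outside an (i+m-2)-sigmafinite set; (d) f has an approximate (n-m)-Taylor polynomial outside an (n-1)-sigmafinite set; and suppose all differential coefficients f_α, |α| ≤ n-m, are Borel functions. Then Lᵐ(f(C_f)) = 0, where C_f = {x : F₁(x) is defined and rank F₁(x) < m}. -/

import Mathlib

open MeasureTheory Metric Filter Set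

noncomputable section

/-- `ℝⁿ` as a Euclidean space. -/
abbrev Ec (n : ℕ) := EuclideanSpace ℝ (Fin n)

/-- The set `A` has vanishing Lebesgue density at `x`. -/
def apSmall {n : ℕ} (x : Ec n) (A : Set (Ec n)) : Prop :=
  Tendsto (fun r : ℝ => volume (A ∩ ball x r) / volume (ball x r))
    (nhdsWithin 0 (Ioi 0)) (nhds 0)

/-- `f` is approximately differentiable of order `k` at `x`, with Taylor polynomial
`y ↦ ∑_{j ≤ k} (p j) (y-x)^j = p.partialSum (k+1) (y-x)` (here the coefficient maps `p j`
already incorporate the factor `1/j!`): the approximate limit of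
`|f y - p_k(x;y)|/|y-x|^k` as `y → x` is `0`. -/
def IsApproxTaylor {n m : ℕ} (f : Ec n → Ec m) (k : ℕ) (x : Ec n)
    (p : FormalMultilinearSeries ℝ (Ec n) (Ec m)) : Prop :=
  ∀ ε > (0 : ℝ),
    apSmall x {y | y ≠ x ∧ ε * ‖y - x‖ ^ k ≤ ‖f y - p.partialSum (k + 1) (y - x)‖}
/-- The degree-`i` approximate Taylor polynomial of `f` at `x`, evaluated at `y`:
`f(x) + F₁(x)(y-x) + ⋯ + Fᵢ(x)(y-x)ⁱ/i!`, where the coefficient maps `p x j` already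
incorporate the factor `1/j!` (i.e. `p x j = F_j(x)/j!`). -/
def taylorPoly {n m : ℕ} (f : Ec n → Ec m)
    (p : Ec n → FormalMultilinearSeries ℝ (Ec n) (Ec m)) (i : ℕ) (x y : Ec n) : Ec m :=
  f x + ∑ j ∈ Finset.Icc 1 i, p x j (fun _ => y - x)

/-- A set is `s`-sigmafinite: a countable union of sets of finite `H^s`-measure. -/
def SigmaFinH {n : ℕ} (s : ℝ) (A : Set (Ec n)) : Prop :=
  ∃ T : ℕ → Set (Ec n), A = ⋃ j, T j ∧ ∀ j, μH[s] (T j) < ⊤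

/-- `F₁(x)` is defined at `x` (i.e. `f` is approximately differentiable of order 1 at `x`
with linear part `v ↦ (p x 1)(v)`). -/
def ApproxDiff1At {n m : ℕ} (f : Ec n → Ec m)
    (p : Ec n → FormalMultilinearSeries ℝ (Ec n) (Ec m)) (x : Ec n) : Prop :=
  ∀ ε > (0 : ℝ),
    apSmall x {y | y ≠ x ∧ ε * ‖y - x‖ ≤ ‖f y - taylorPoly f p 1 x y‖}

/-- The generalized critical set: points where the approximate derivative `F₁(x)` is
defined and does not have maximal rank. -/
def approxCrit {n m : ℕ} (f : Ec n → Ec m)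
    (p : Ec n → FormalMultilinearSeries ℝ (Ec n) (Ec m)) : Set (Ec n) :=
  {x | ApproxDiff1At f p x ∧ ¬ Function.Surjective fun v : Ec n => p x 1 (fun _ => v)}

namespace MorseSard

set_option linter.unusedSectionVars false

open scoped Topology ContDiff ENNReal
open Asymptotics

/-! ### The filter of pairs of close points -/

section NearFilter

variable {T : Type} [PseudoMetricSpace T]

/-- The filter of pairs of points of `X` at distance less than a positive gauge evaluated at both
points. The gauge is an arbitrary positive function on the space. -/
def near (X : Set T) : Filter (T × T) where
  sets := {s | ∃ δ : T → ℝ, (∀ x, 0 < δ x) ∧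
    ∀ x ∈ X, ∀ y ∈ X, dist x y < δ x → dist x y < δ y → (x, y) ∈ s}
  univ_sets := ⟨fun _ => 1, fun _ => one_pos, fun _ _ _ _ _ _ => mem_univ _⟩
  sets_of_superset := by
    rintro s t ⟨δ, hδ, h⟩ hst
    exact ⟨δ, hδ, fun x hx y hy h1 h2 => hst (h x hx y hy h1 h2)⟩
  inter_sets := by
    rintro s t ⟨δ, hδ, h⟩ ⟨δ', hδ', h'⟩
    refine ⟨fun x => min (δ x) (δ' x), fun x => lt_min (hδ x) (hδ' x), fun x hx y hy h1 h2 => ?_⟩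
    rw [lt_min_iff] at h1 h2
    exact ⟨h x hx y hy h1.1 h2.1, h' x hx y hy h1.2 h2.2⟩

lemma near_mono {S X : Set T} (h : S ⊆ X) : near S ≤ near X := by
  rintro s ⟨δ, hδ, hs⟩
  exact ⟨δ, hδ, fun x hx y hy => hs x (h hx) y (h hy)⟩

lemma eventually_near_mem (X : Set T) : ∀ᶠ p in near X, p.1 ∈ X ∧ p.2 ∈ X :=
  ⟨fun _ => 1, fun _ => one_pos, fun _ hx _ hy _ _ => ⟨hx, hy⟩⟩

lemma eventually_near_dist_lt (X : Set T) {c : ℝ} (hc : 0 < c) :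
    ∀ᶠ p in near X, dist p.1 p.2 < c :=
  ⟨fun _ => c, fun _ => hc, fun _ _ _ _ h _ => h⟩

/-- A property of points and small radii gives a property of close pairs. -/
lemma eventually_near_of_pointwise {X : Set T} {R : T → ℝ → Prop}
    (h : ∀ x ∈ X, ∃ δ > 0, ∀ d, 0 ≤ d → d < δ → R x d) :
    ∀ᶠ p in near X, R p.1 (dist p.1 p.2) ∧ R p.2 (dist p.1 p.2) := by
  classical
  choose! δ hδ using h
  refine ⟨fun x => if x ∈ X then δ x else 1, fun x => ?_, fun x hx y hy h1 h2 => ?_⟩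
  · by_cases hx : x ∈ X
    · simpa [hx] using (hδ x hx).1
    · simp [hx]
  · simp only [hx, hy, if_true] at h1 h2
    exact ⟨(hδ x hx).2 _ dist_nonneg h1, (hδ y hy).2 _ dist_nonneg h2⟩

lemma tendsto_swap_near (X : Set T) : Tendsto Prod.swap (near X) (near X) := by
  rintro s ⟨δ, hδ, hs⟩
  refine ⟨δ, hδ, fun x hx y hy h1 h2 => hs y hy x hx ?_ ?_⟩
  · rwa [dist_comm]
  · rwa [dist_comm]

lemma tendsto_dist_near (X : Set T) : Tendsto (fun p : T × T => dist p.1 p.2) (near X) (𝓝 0) := by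
  rw [Metric.tendsto_nhds]
  intro ε hε
  filter_upwards [eventually_near_dist_lt X hε] with p hp
  simpa [abs_of_nonneg dist_nonneg] using hp

variable {E : Type} [NormedAddCommGroup E]

/-- Triples `(x, y, z)` with `(x, y)` a close pair of points of `X`, and `z` in the ball with center
`a x` and radius `M * dist x y`. -/
def nearBall (X : Set T) (a : T → E) (M : ℝ) : Filter (T × T × E) :=
  comap (fun t => (t.1, t.2.1)) (near X) ⊓ 𝓟 {t | ‖t.2.2 - a t.1‖ ≤ M * dist t.1 t.2.1}

lemma eventually_nearBall {X : Set T} {a : T → E} {M : ℝ} {q : T × T × E → Prop} :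
    (∀ᶠ t in nearBall X a M, q t) ↔
      ∀ᶠ p in near X, ∀ z, ‖z - a p.1‖ ≤ M * dist p.1 p.2 → q (p.1, p.2, z) := by
  rw [nearBall, eventually_inf_principal, eventually_comap]
  constructor
  · intro h
    filter_upwards [h] with p hp z hz
    exact hp (p.1, p.2, z) rfl hz
  · intro h
    filter_upwards [h] with p hp
    rintro ⟨x, y, z⟩ rfl hz
    exact hp z hz

lemma nearBall_mono {S X : Set T} (h : S ⊆ X) (a : T → E) (M : ℝ) :
    nearBall S a M ≤ nearBall X a M :=
  inf_le_inf (comap_mono (near_mono h)) le_rfl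

lemma tendsto_nearBall_near (X : Set T) (a : T → E) (M : ℝ) :
    Tendsto (fun t : T × T × E => (t.1, t.2.1)) (nearBall X a M) (near X) :=
  tendsto_comap.mono_left inf_le_left

lemma eventually_nearBall_le (X : Set T) (a : T → E) (M : ℝ) :
    ∀ᶠ t in nearBall X a M, ‖t.2.2 - a t.1‖ ≤ M * dist t.1 t.2.1 :=
  mem_inf_of_right (mem_principal_self _)

lemma tendsto_dist_nearBall (X : Set T) (a : T → E) (M : ℝ) :
    Tendsto (fun t : T × T × E => dist t.1 t.2.1) (nearBall X a M) (𝓝 0) :=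
  (tendsto_dist_near X).comp (tendsto_nearBall_near X a M)

lemma isLittleO_dist_pow_succ {α : Type} {l : Filter α} {d : α → ℝ} (hd : Tendsto d l (𝓝 0))
    (k : ℕ) : (fun t => d t ^ (k + 1)) =o[l] fun t => d t ^ k := by
  have h1 : d =o[l] fun _ => (1 : ℝ) := (isLittleO_one_iff ℝ).2 hd
  simpa [pow_succ] using (isBigO_refl (fun t => d t ^ k) l).mul_isLittleO h1

end NearFilter

/-! ### Big O and little o at once -/

section Rel

variable {α β : Type} {l l' : Filter α} {f f' g g' : α → ℝ} {b : Bool}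

/-- `f = o(g)` if `b` is true, `f = O(g)` otherwise. -/
def Rel (b : Bool) (l : Filter α) (f g : α → ℝ) : Prop := if b then f =o[l] g else f =O[l] g

lemma Rel.isBigO (h : Rel b l f g) : f =O[l] g := by
  cases b
  · simpa [Rel] using h
  · exact IsLittleO.isBigO (by simpa [Rel] using h)

lemma rel_of_isLittleO (h : f =o[l] g) : Rel b l f g := by
  cases b
  · simpa [Rel] using h.isBigO
  · simpa [Rel] using h

lemma Rel.add (h : Rel b l f g) (h' : Rel b l f' g) : Rel b l (fun t => f t + f' t) g := by
  cases b <;> simp only [Rel, if_true, if_false, Bool.false_eq_true] at h h' ⊢ <;> exact h.add h'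

lemma Rel.sub (h : Rel b l f g) (h' : Rel b l f' g) : Rel b l (fun t => f t - f' t) g := by
  cases b <;> simp only [Rel, if_true, if_false, Bool.false_eq_true] at h h' ⊢ <;> exact h.sub h'

lemma Rel.of_isBigO_left (h : f =O[l] f') (h' : Rel b l f' g) : Rel b l f g := by
  cases b <;> simp only [Rel, if_true, if_false, Bool.false_eq_true] at h' ⊢
  · exact h.trans h'
  · exact h.trans_isLittleO h'

lemma Rel.trans_isBigO (h : Rel b l f g) (h' : g =O[l] g') : Rel b l f g' := by
  cases b <;> simp only [Rel, if_true, if_false, Bool.false_eq_true] at h ⊢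
  · exact h.trans h'
  · exact h.trans_isBigO h'

lemma Rel.mono (h : Rel b l f g) (hl : l' ≤ l) : Rel b l' f g := by
  cases b <;> simp only [Rel, if_true, if_false, Bool.false_eq_true] at h ⊢ <;> exact h.mono hl

lemma Rel.comp_tendsto (h : Rel b l f g) {k : β → α} {m : Filter β} (hk : Tendsto k m l) :
    Rel b m (fun t => f (k t)) (fun t => g (k t)) := by
  cases b <;> simp only [Rel, if_true, if_false, Bool.false_eq_true] at h ⊢ <;>
    exact h.comp_tendsto hk

lemma Rel.isBigO_mul (h' : f' =O[l] g') (h : Rel b l f g) :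
    Rel b l (fun t => f' t * f t) (fun t => g' t * g t) := by
  cases b <;> simp only [Rel, if_true, if_false, Bool.false_eq_true] at h ⊢
  · exact h'.mul h
  · exact h'.mul_isLittleO h

lemma rel_zero : Rel b l (fun _ => 0) g := rel_of_isLittleO (isLittleO_zero _ _)

lemma Rel.congr' (h : Rel b l f g) (hf : f =ᶠ[l] f') : Rel b l f' g :=
  Rel.of_isBigO_left (hf.symm.trans_isBigO (isBigO_refl _ _)) h

end Rel

/-! ### Countable covers -/

section Cov

variable {T : Type}

/-- `X` is covered by countably many subsets with the property `Q`. -/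
def Cov (X : Set T) (Q : Set T → Prop) : Prop :=
  ∃ (κ : Type) (_ : Countable κ) (S : κ → Set T), X ⊆ ⋃ i, S i ∧ ∀ i, S i ⊆ X ∧ Q (S i)

lemma Cov.of_self {X : Set T} {Q : Set T → Prop} (h : Q X) : Cov X Q :=
  ⟨Unit, inferInstance, fun _ => X, subset_iUnion (fun _ : Unit => X) (), fun _ => ⟨subset_rfl, h⟩⟩

lemma Cov.bind {X : Set T} {Q Q' : Set T → Prop} (h : Cov X Q)
    (h' : ∀ S ⊆ X, Q S → Cov S Q') : Cov X Q' := by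
  obtain ⟨κ, _, S, hX, hS⟩ := h
  choose κ' hκ' S' hX' hS' using fun i => h' (S i) (hS i).1 (hS i).2
  refine ⟨Σ i, κ' i, inferInstance, fun p => S' p.1 p.2, fun x hx => ?_,
    fun p => ⟨(hS' p.1 p.2).1.trans (hS p.1).1, (hS' p.1 p.2).2⟩⟩
  obtain ⟨i, hi⟩ := mem_iUnion.1 (hX hx)
  obtain ⟨j, hj⟩ := mem_iUnion.1 (hX' i hi)
  exact mem_iUnion.2 ⟨⟨i, j⟩, hj⟩

lemma Cov.mono {X : Set T} {Q Q' : Set T → Prop} (h : Cov X Q) (h' : ∀ S ⊆ X, Q S → Q' S) :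
    Cov X Q' := h.bind fun S hS hQ => .of_self (h' S hS hQ)

lemma Cov.subset {X Y : Set T} {Q : Set T → Prop} (h : Cov X Q) (hY : Y ⊆ X)
    (hQ : ∀ S S', S ⊆ S' → Q S' → Q S) : Cov Y Q := by
  obtain ⟨κ, _, S, hX, hS⟩ := h
  refine ⟨κ, inferInstance, fun i => S i ∩ Y, fun x hx => ?_, fun i => ⟨inter_subset_right,
    hQ _ _ inter_subset_left (hS i).2⟩⟩
  obtain ⟨i, hi⟩ := mem_iUnion.1 (hX (hY hx))
  exact mem_iUnion.2 ⟨i, hi, hx⟩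

lemma Cov.of_pointwise {κ : Type} [Countable κ] {X : Set T} {R : κ → T → Prop}
    (h : ∀ x ∈ X, ∃ c, R c x) : Cov X fun S => ∃ c, ∀ x ∈ S, R c x :=
  ⟨κ, inferInstance, fun c => {x ∈ X | R c x},
    fun x hx => mem_iUnion.2 ((h x hx).imp fun _ hc => ⟨hx, hc⟩),
    fun c => ⟨sep_subset _ _, c, fun _ hx => hx.2⟩⟩

lemma Cov.forall {ι : Type} [Finite ι] {X : Set T} {Q : ι → Set T → Prop}
    (hQ : ∀ i S S', S ⊆ S' → Q i S' → Q i S) (h : ∀ i, Cov X (Q i)) :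
    Cov X fun S => ∀ i, Q i S := by
  choose κ hκ S hX hS using h
  refine ⟨∀ i, κ i, inferInstance, fun c => {x ∈ X | ∀ i, x ∈ S i (c i)}, fun x hx => ?_,
    fun c => ⟨sep_subset _ _, fun i => hQ i _ _ (fun x hx => hx.2 i) (hS i (c i)).2⟩⟩
  choose c hc using fun i => mem_iUnion.1 (hX i hx)
  exact mem_iUnion.2 ⟨c, hx, hc⟩

/-- Every point of `X` has a positive gauge, so `X` is a countable union of sets on which the
gauge is bounded below. -/
lemma Cov.of_eventually_near [PseudoMetricSpace T] {X : Set T} {q : T × T → Prop}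
    (h : ∀ᶠ p in near X, q p) :
    Cov X fun S => ∃ r > 0, ∀ x ∈ S, ∀ y ∈ S, dist x y < r → q (x, y) := by
  obtain ⟨δ, hδ, h⟩ := h
  have : ∀ x ∈ X, ∃ N : ℕ, 1 / ((N : ℝ) + 1) < δ x := fun x _ => exists_nat_one_div_lt (hδ x)
  refine (Cov.of_pointwise this).mono ?_
  rintro S hS ⟨N, hN⟩
  refine ⟨1 / (N + 1), by positivity, fun x hx y hy hxy => ?_⟩
  exact h x (hS hx) y (hS hy) (hxy.trans (hN x hx)) (hxy.trans (hN y hy))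

end Cov

/-! ### Reading off the coefficients of a polynomial from its values -/

/-- The coefficients of a polynomial of degree at most `D` are fixed linear combinations of its
values at `ρ, 2 ρ, …, (D + 1) ρ`. -/
lemma exists_coeff_eq_sum_eval (D : ℕ) : ∃ c : ℕ → ℕ → ℝ, ∀ p : Polynomial ℝ, p.natDegree ≤ D →
    ∀ (ρ : ℝ) (i : ℕ), p.coeff i * ρ ^ i =
      ∑ l ∈ Finset.Icc 1 (D + 1), c i l * p.eval (l * ρ) := by
  let s := Finset.Icc 1 (D + 1)
  let v : ℕ → ℝ := fun l => l
  have hv : Set.InjOn v s := fun i _ j _ hij => Nat.cast_injective hij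
  refine ⟨fun i l => (Lagrange.basis s v l).coeff i, fun p hp ρ i => ?_⟩
  have hq : (p.comp (Polynomial.C ρ * Polynomial.X)).degree < s.card := by
    have h1 : (p.comp (Polynomial.C ρ * Polynomial.X)).natDegree ≤ D := by
      refine Polynomial.natDegree_comp_le.trans ?_
      have h2 : (Polynomial.C ρ * Polynomial.X).natDegree ≤ 1 := by
        simpa using Polynomial.natDegree_C_mul_X_pow_le ρ 1
      exact (Nat.mul_le_mul hp h2).trans_eq (mul_one D)
    refine (Polynomial.degree_le_of_natDegree_le h1).trans_lt ?_
    simp only [s, Nat.card_Icc]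
    exact_mod_cast Nat.lt_succ_self D
  have h := congrArg (fun q => q.coeff i) (Lagrange.eq_interpolate hv hq)
  simp only [Polynomial.comp_C_mul_X_coeff, Lagrange.interpolate_apply,
    Polynomial.finsetSum_coeff, Polynomial.coeff_C_mul] at h
  rw [h]
  refine Finset.sum_congr rfl fun l _ => ?_
  rw [Polynomial.eval_comp, Polynomial.eval_mul, Polynomial.eval_C, Polynomial.eval_X, mul_comm,
    mul_comm ρ]

/-- The coefficients of a polynomial of degree at most `D` are bounded by its values at
`ρ, 2 ρ, …, (D + 1) ρ`. -/
lemma exists_coeff_le (D : ℕ) : ∃ C > 0, ∀ p : Polynomial ℝ, p.natDegree ≤ D →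
    ∀ ρ η : ℝ, (∀ l ∈ Finset.Icc 1 (D + 1), |p.eval (l * ρ)| ≤ η) →
      ∀ i, |p.coeff i * ρ ^ i| ≤ C * η := by
  obtain ⟨c, hc⟩ := exists_coeff_eq_sum_eval D
  refine ⟨∑ i ∈ Finset.range (D + 1), ∑ l ∈ Finset.Icc 1 (D + 1), |c i l| + 1, by positivity,
    fun p hp ρ η h i => ?_⟩
  have hη : 0 ≤ η := (abs_nonneg _).trans (h 1 (by simp))
  by_cases hi : i ∈ Finset.range (D + 1)
  · rw [hc p hp]
    calc |∑ l ∈ Finset.Icc 1 (D + 1), c i l * p.eval (l * ρ)|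
        ≤ ∑ l ∈ Finset.Icc 1 (D + 1), |c i l| * η := by
          refine (Finset.abs_sum_le_sum_abs _ _).trans (Finset.sum_le_sum fun l hl => ?_)
          rw [abs_mul]
          exact mul_le_mul_of_nonneg_left (h l hl) (abs_nonneg _)
      _ = (∑ l ∈ Finset.Icc 1 (D + 1), |c i l|) * η := by rw [Finset.sum_mul]
      _ ≤ _ := by
          refine mul_le_mul_of_nonneg_right ?_ hη
          have := Finset.single_le_sum (f := fun i => ∑ l ∈ Finset.Icc 1 (D + 1), |c i l|)
            (fun j _ => Finset.sum_nonneg fun l _ => abs_nonneg _) hi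
          linarith
  · have : p.coeff i = 0 := Polynomial.coeff_eq_zero_of_natDegree_lt (by
      simp only [Finset.mem_range] at hi
      omega)
    rw [this, zero_mul, abs_zero]
    positivity

/-! ### Families of functions depending on a point with a given order of regularity -/

section Families

variable {T : Type} [MetricSpace T] {E : Type} [NormedAddCommGroup E]
  {X S : Set T} {a : T → E} {u u' : T → E → ℝ} {b : Bool} {k l : ℕ}

/-- The functions `u x` and `u y` differ by `O(dist x y ^ k)`, or `o(dist x y ^ k)`, at distance
`O(dist x y)` of the base point `a x`. -/
def Cls (b : Bool) (X : Set T) (a : T → E) (u : T → E → ℝ) (k : ℕ) : Prop :=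
  ∀ M : ℝ, Rel b (nearBall X a M) (fun t => u t.1 t.2.2 - u t.2.1 t.2.2)
    (fun t => dist t.1 t.2.1 ^ k)

/-- The base point is a pointwise Lipschitz function. -/
def LipPos (X : Set T) (a : T → E) : Prop :=
  (fun p : T × T => a p.1 - a p.2) =O[near X] fun p => dist p.1 p.2

/-- `g x` vanishes to order `l` at the base point, with a uniform constant. -/
def PtO (X : Set T) (a : T → E) (g : T → E → ℝ) (l : ℕ) : Prop :=
  ∃ C, ∀ x ∈ X, ∃ r > 0, ∀ z, ‖z - a x‖ < r → |g x z| ≤ C * ‖z - a x‖ ^ l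

lemma Cls.mono (h : Cls b X a u k) (hS : S ⊆ X) : Cls b S a u k :=
  fun M => (h M).mono (nearBall_mono hS a M)

lemma LipPos.mono (h : LipPos X a) (hS : S ⊆ X) : LipPos S a :=
  IsBigO.mono h (near_mono hS)

lemma PtO.mono (h : PtO X a u l) (hS : S ⊆ X) : PtO S a u l :=
  h.imp fun _ hC x hx => hC x (hS hx)

lemma isBigO_dist_pow {α : Type} {m : Filter α} {d : α → ℝ} (hd : Tendsto d m (𝓝 0))
    (h : l ≤ k) : (fun t => d t ^ k) =O[m] fun t => d t ^ l := by
  obtain ⟨j, rfl⟩ := Nat.exists_eq_add_of_le h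
  induction j with
  | zero => exact isBigO_refl _ _
  | succ j ih =>
    exact (isLittleO_dist_pow_succ hd (l + j)).isBigO.trans (ih (Nat.le_add_right _ _))

lemma tendsto_nearBall {α : Type} {m : Filter α} {φ : α → T × T × E}
    (h1 : Tendsto (fun t => ((φ t).1, (φ t).2.1)) m (near X))
    (h2 : (fun t => (φ t).2.2 - a (φ t).1) =O[m] fun t => dist (φ t).1 (φ t).2.1) :
    ∃ M, Tendsto φ m (nearBall X a M) := by
  obtain ⟨M, hM⟩ := h2.bound
  refine ⟨M, tendsto_inf.2 ⟨tendsto_comap_iff.2 h1, tendsto_principal.2 ?_⟩⟩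
  filter_upwards [hM] with t ht
  simpa [Real.norm_eq_abs, abs_of_nonneg dist_nonneg] using ht

lemma isBigO_nearBall (X : Set T) (a : T → E) (M : ℝ) :
    (fun t : T × T × E => t.2.2 - a t.1) =O[nearBall X a M] fun t => dist t.1 t.2.1 := by
  refine IsBigO.of_bound M ?_
  filter_upwards [eventually_nearBall_le X a M] with t ht
  simpa [Real.norm_eq_abs, abs_of_nonneg dist_nonneg] using ht

lemma LipPos.nearBall (h : LipPos X a) (M : ℝ) :
    (fun t : T × T × E => a t.1 - a t.2.1) =O[nearBall X a M] fun t => dist t.1 t.2.1 :=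
  IsBigO.comp_tendsto h (tendsto_nearBall_near X a M)

lemma LipPos.isBigO_nearBall_right (h : LipPos X a) (M : ℝ) :
    (fun t : T × T × E => t.2.2 - a t.2.1) =O[MorseSard.nearBall X a M]
      fun t => dist t.1 t.2.1 := by
  simpa using (isBigO_nearBall X a M).add (h.nearBall M)

lemma Cls.comp (h : Cls b X a u k) {α : Type} {m : Filter α} {φ : α → T × T × E}
    (h1 : Tendsto (fun t => ((φ t).1, (φ t).2.1)) m (near X))
    (h2 : (fun t => (φ t).2.2 - a (φ t).1) =O[m] fun t => dist (φ t).1 (φ t).2.1) :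
    Rel b m (fun t => u (φ t).1 (φ t).2.2 - u (φ t).2.1 (φ t).2.2)
      (fun t => dist (φ t).1 (φ t).2.1 ^ k) := by
  obtain ⟨M, hM⟩ := tendsto_nearBall h1 h2
  exact (h M).comp_tendsto hM

lemma PtO.comp (h : PtO X a u l) {α : Type} {m : Filter α} {φ : α → T × T × E}
    (h1 : Tendsto (fun t => ((φ t).1, (φ t).2.1)) m (near X))
    (h2 : (fun t => (φ t).2.2 - a (φ t).1) =O[m] fun t => dist (φ t).1 (φ t).2.1) :
    (fun t => u (φ t).1 (φ t).2.2) =O[m] fun t => dist (φ t).1 (φ t).2.1 ^ l := by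
  obtain ⟨C, hC⟩ := h
  obtain ⟨M, hM, h2M⟩ := h2.exists_pos
  have h3 : ∀ᶠ p in near X, ∀ z, ‖z - a p.1‖ ≤ M * dist p.1 p.2 →
      |u p.1 z| ≤ C * ‖z - a p.1‖ ^ l := by
    refine (eventually_near_of_pointwise (R := fun x d => ∀ z, ‖z - a x‖ ≤ M * d →
      |u x z| ≤ C * ‖z - a x‖ ^ l) fun x hx => ?_).mono fun p hp => hp.1
    obtain ⟨r, hr, h⟩ := hC x hx
    refine ⟨r / M, by positivity, fun d _ hd z hz => h z (hz.trans_lt ?_)⟩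
    rwa [lt_div_iff₀' hM] at hd
  have h4 : (fun t => ‖(φ t).2.2 - a (φ t).1‖ ^ l) =O[m] fun t => dist (φ t).1 (φ t).2.1 ^ l :=
    h2.norm_left.pow l
  refine IsBigO.trans (IsBigO.of_bound C ?_) h4
  filter_upwards [h1.eventually h3, h2M.bound] with t ht ht'
  simpa using ht _ (by simpa [Real.norm_eq_abs, abs_of_nonneg dist_nonneg] using ht')

lemma PtO.left (h : PtO X a u l) (M : ℝ) :
    (fun t : T × T × E => u t.1 t.2.2) =O[MorseSard.nearBall X a M]
      fun t => dist t.1 t.2.1 ^ l :=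
  h.comp (φ := id) (tendsto_nearBall_near X a M) (isBigO_nearBall X a M)

lemma PtO.right (h : PtO X a u l) (ha : LipPos X a) (M : ℝ) :
    (fun t : T × T × E => u t.2.1 t.2.2) =O[MorseSard.nearBall X a M]
      fun t => dist t.1 t.2.1 ^ l := by
  simpa only [dist_comm] using h.comp (m := MorseSard.nearBall X a M)
    (φ := fun t => (t.2.1, t.1, t.2.2))
    ((tendsto_swap_near X).comp (tendsto_nearBall_near X a M))
    (by simpa only [dist_comm] using ha.isBigO_nearBall_right M)

lemma cov_ptO (h : ∀ x ∈ X, u x =O[𝓝 (a x)] fun z => ‖z - a x‖ ^ l) :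
    Cov X fun S => PtO S a u l := by
  have : ∀ x ∈ X, ∃ N : ℕ, ∃ r > 0, ∀ z, ‖z - a x‖ < r → |u x z| ≤ N * ‖z - a x‖ ^ l := by
    intro x hx
    obtain ⟨C, hC⟩ := (h x hx).bound
    obtain ⟨N, hN⟩ := exists_nat_ge C
    obtain ⟨r, hr, hr'⟩ := Metric.eventually_nhds_iff.1 hC
    refine ⟨N, r, hr, fun z hz => ?_⟩
    have h1 := hr' (y := z) (by rwa [dist_eq_norm])
    simp only [Real.norm_eq_abs, abs_pow, abs_norm] at h1
    exact h1.trans (by gcongr)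
  exact (Cov.of_pointwise this).mono fun S _ ⟨N, hN⟩ => ⟨N, hN⟩

lemma Rel.sum {α κ : Type} {m : Filter α} {f : κ → α → ℝ} {g : α → ℝ} (s : Finset κ)
    (h : ∀ i ∈ s, Rel b m (f i) g) : Rel b m (fun t => ∑ i ∈ s, f i t) g := by
  classical
  induction s using Finset.induction_on with
  | empty => simpa using rel_zero
  | insert i s hi ih =>
    simp only [Finset.sum_insert hi]
    exact (h i (Finset.mem_insert_self _ _)).add
      (ih fun j hj => h j (Finset.mem_insert_of_mem hj))

lemma Rel.const_mul {α : Type} {m : Filter α} {f g : α → ℝ} (h : Rel b m f g) (c : ℝ) :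
    Rel b m (fun t => c * f t) g :=
  .of_isBigO_left (isBigO_const_mul_self c f m) h

end Families

/-! ### Derivatives of families -/

section Derivatives

variable {T : Type} [MetricSpace T] {E : Type} [NormedAddCommGroup E] [NormedSpace ℝ E]
  {X S : Set T} {a : T → E} {u : T → E → ℝ} {b : Bool} {k l : ℕ}

/-- The derivative of `g` in the direction `v`. -/
def dirD (v : E) (g : E → ℝ) : E → ℝ := fun z => fderiv ℝ g z v

/-- The iterated derivatives of `g` in the directions of the list `L`. -/
def iterD : List E → (E → ℝ) → E → ℝ
  | [], g => g
  | w :: L, g => iterD L (dirD w g)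

lemma contDiff_dirD {g : E → ℝ} (hg : ContDiff ℝ ∞ g) (v : E) : ContDiff ℝ ∞ (dirD v g) :=
  (hg.fderiv_right (by simp)).clm_apply contDiff_const

lemma contDiff_iterD (L : List E) {g : E → ℝ} (hg : ContDiff ℝ ∞ g) : ContDiff ℝ ∞ (iterD L g) := by
  induction L generalizing g with
  | nil => exact hg
  | cons w L ih => exact ih (contDiff_dirD hg w)

lemma iterD_concat (L : List E) (w : E) (g : E → ℝ) :
    iterD (L ++ [w]) g = dirD w (iterD L g) := by
  induction L generalizing g with
  | nil => rfl
  | cons w' L ih => exact ih _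

lemma hasFDerivAt_of_smooth {g : E → ℝ} (hg : ContDiff ℝ ∞ g) (z : E) :
    HasFDerivAt g (fderiv ℝ g z) z :=
  (hg.differentiable (by simp)).differentiableAt.hasFDerivAt

lemma hasDerivAt_line {g : E → ℝ} (hg : ContDiff ℝ ∞ g) (z v : E) (t : ℝ) :
    HasDerivAt (fun t : ℝ => g (z + t • v)) (dirD v g (z + t • v)) t := by
  have h1 : HasDerivAt (fun t : ℝ => z + t • v) v t := by
    simpa using ((hasDerivAt_id t).smul_const v).const_add z
  exact (hasFDerivAt_of_smooth hg _).comp_hasDerivAt t h1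

/-- Taylor's formula along lines with direction `v`, locally uniform in the base point. -/
lemma exists_taylor_line (v a : E) (D : ℕ) {g : E → ℝ} (hg : ContDiff ℝ ∞ g) :
    ∃ C, ∃ r > 0, ∀ z, ‖z - a‖ < r → ∀ t : ℝ, 0 ≤ t → t < r →
      |g (z + t • v) - ∑ i ∈ Finset.range D, (dirD v)^[i] g z / (i.factorial : ℝ) * t ^ i| ≤
        C * t ^ D := by
  induction D generalizing g with
  | zero =>
    have h : ContinuousAt (fun p : E × ℝ => |g (p.1 + p.2 • v)|) (a, 0) :=
      (hg.continuous.comp (by fun_prop)).abs.continuousAt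
    obtain ⟨r, hr, h'⟩ := Metric.eventually_nhds_iff.1
      (h.eventually_lt_const (lt_add_one |g (a + (0 : ℝ) • v)|))
    refine ⟨|g (a + (0 : ℝ) • v)| + 1, r, hr, fun z hz t ht0 ht => ?_⟩
    have := h' (y := (z, t)) (by
      rw [Prod.dist_eq, max_lt_iff, dist_eq_norm]
      exact ⟨hz, by simpa [abs_of_nonneg ht0] using ht⟩)
    simpa using this.le
  | succ D ih =>
    obtain ⟨C, r, hr, h⟩ := ih (contDiff_dirD hg v)
    refine ⟨C, r, hr, fun z hz t ht0 ht => ?_⟩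
    set φ : ℝ → ℝ := fun s =>
      g (z + s • v) - ∑ i ∈ Finset.range (D + 1), (dirD v)^[i] g z / (i.factorial : ℝ) * s ^ i
    have hφ : ∀ s, HasDerivAt φ (dirD v g (z + s • v) -
        ∑ i ∈ Finset.range D, (dirD v)^[i] (dirD v g) z / (i.factorial : ℝ) * s ^ i) s := by
      intro s
      refine (hasDerivAt_line hg z v s).sub ?_
      simp only [Finset.sum_range_succ', pow_zero, mul_one]
      refine HasDerivAt.add_const _ (HasDerivAt.fun_sum fun i _ => ?_)
      have h1 := (hasDerivAt_pow (i + 1) s).const_mul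
        ((dirD v)^[i + 1] g z / ((i + 1).factorial : ℝ))
      refine h1.congr_deriv ?_
      rw [Nat.factorial_succ, Function.iterate_succ_apply]
      have : (i.factorial : ℝ) ≠ 0 := by positivity
      push_cast
      field_simp
    have h1 := (convex_Icc (0 : ℝ) t).norm_image_sub_le_of_norm_hasDerivWithin_le
      (C := C * t ^ D) (fun s _ => (hφ s).hasDerivWithinAt) (fun s hs => ?_)
      (left_mem_Icc.2 ht0) (right_mem_Icc.2 ht0)
    · have h2 : φ 0 = 0 := by
        simp [φ, Finset.sum_range_succ']
      rw [h2, sub_zero, sub_zero, Real.norm_eq_abs, Real.norm_eq_abs, abs_of_nonneg ht0] at h1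
      rwa [pow_succ, ← mul_assoc]
    · refine (h z hz s hs.1 (hs.2.trans_lt ht)).trans ?_
      rcases eq_or_lt_of_le ht0 with rfl | ht0'
      · rw [le_antisymm hs.2 hs.1]
      have hC : 0 ≤ C := by
        have := (abs_nonneg _).trans (h z hz t ht0 ht)
        exact nonneg_of_mul_nonneg_left this (by positivity)
      have := hs.1
      gcongr
      exact hs.2

lemma LipPos.exists_le (ha : LipPos X a) (M : ℝ) :
    ∃ M' > 0, ∀ᶠ t in MorseSard.nearBall X a M,
      ‖t.2.2 - a t.1‖ ≤ M' * dist t.1 t.2.1 ∧ ‖t.2.2 - a t.2.1‖ ≤ M' * dist t.1 t.2.1 := by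
  obtain ⟨M', hM', h⟩ := (ha.isBigO_nearBall_right M).exists_pos
  refine ⟨max M M', lt_max_of_lt_right hM', ?_⟩
  filter_upwards [h.bound, eventually_nearBall_le X a M] with t h1 h2
  rw [Real.norm_eq_abs, abs_of_nonneg dist_nonneg] at h1
  exact ⟨h2.trans (by gcongr; exact le_max_left _ _), h1.trans (by gcongr; exact le_max_right _ _)⟩

/-- Taking directional derivatives decreases the order of a family by one, after splitting into
countably many pieces. -/
lemma Cls.cov_dirD (hu : ∀ x, ContDiff ℝ ∞ (u x)) (ha : LipPos X a) (h : Cls b X a u (k + 1))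
    (v : E) : Cov X fun S => Cls b S a (fun x => dirD v (u x)) k := by
  set rem : T → E → ℝ → ℝ := fun x z t => u x (z + t • v) -
    ∑ i ∈ Finset.range (k + 2), (dirD v)^[i] (u x) z / (i.factorial : ℝ) * t ^ i with hrem
  have key : ∀ x ∈ X, ∃ N : ℕ, ∃ r > 0, ∀ z, ‖z - a x‖ < r → ∀ t : ℝ, 0 ≤ t → t < r →
      |rem x z t| ≤ N * t ^ (k + 2) := by
    intro x _
    obtain ⟨C, r, hr, hC⟩ := exists_taylor_line v (a x) (k + 2) (hu x)
    obtain ⟨N, hN⟩ := exists_nat_ge C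
    exact ⟨N, r, hr, fun z hz t ht0 ht => (hC z hz t ht0 ht).trans (by gcongr)⟩
  refine (Cov.of_pointwise key).mono ?_
  rintro S hS ⟨N, hN⟩ M
  obtain ⟨c, hc⟩ := exists_coeff_eq_sum_eval (k + 1)
  obtain ⟨M', hM', hle⟩ := (ha.mono hS).exists_le M
  let q : T × T × E → Polynomial ℝ := fun t => ∑ i ∈ Finset.range (k + 2),
    Polynomial.C (((dirD v)^[i] (u t.1) t.2.2 - (dirD v)^[i] (u t.2.1) t.2.2) / (i.factorial : ℝ))
      * Polynomial.X ^ i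
  have hq : ∀ t, (q t).natDegree ≤ k + 1 := fun t =>
    Polynomial.natDegree_sum_le_of_forall_le _ _ fun i hi =>
      (Polynomial.natDegree_C_mul_X_pow_le _ _).trans (by
        have := Finset.mem_range.1 hi
        omega)
  have hq1 : ∀ t, (q t).coeff 1 = dirD v (u t.1) t.2.2 - dirD v (u t.2.1) t.2.2 := by
    intro t
    simp only [q, Polynomial.finsetSum_coeff, Polynomial.coeff_C_mul_X_pow]
    rw [Finset.sum_eq_single 1]
    · simp
    · intro i _ hi
      simp [hi.symm]
    · simp
  have heval : ∀ t s, (q t).eval s = (u t.1 (t.2.2 + s • v) - u t.2.1 (t.2.2 + s • v)) -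
      (rem t.1 t.2.2 s - rem t.2.1 t.2.2 s) := by
    intro t s
    simp only [q, hrem, Polynomial.eval_finsetSum, Polynomial.eval_mul, Polynomial.eval_C,
      Polynomial.eval_pow, Polynomial.eval_X, sub_div, sub_mul, Finset.sum_sub_distrib]
    ring
  have hR : ∀ l : ℕ, Rel b (MorseSard.nearBall S a M)
      (fun t => rem t.1 t.2.2 (l * dist t.1 t.2.1) - rem t.2.1 t.2.2 (l * dist t.1 t.2.1))
      (fun t => dist t.1 t.2.1 ^ (k + 1)) := by
    intro l
    have h1 : ∀ᶠ p in near S,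
        (∀ z, ‖z - a p.1‖ ≤ M' * dist p.1 p.2 →
          |rem p.1 z (l * dist p.1 p.2)| ≤ N * (l * dist p.1 p.2) ^ (k + 2)) ∧
        (∀ z, ‖z - a p.2‖ ≤ M' * dist p.1 p.2 →
          |rem p.2 z (l * dist p.1 p.2)| ≤ N * (l * dist p.1 p.2) ^ (k + 2)) := by
      refine eventually_near_of_pointwise (R := fun x d => ∀ z, ‖z - a x‖ ≤ M' * d →
        |rem x z (l * d)| ≤ N * (l * d) ^ (k + 2)) fun x hx => ?_
      obtain ⟨r, hr, h⟩ := hN x hx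
      refine ⟨min (r / M') (r / (l + 1)), lt_min (by positivity) (by positivity),
        fun d hd0 hd z hz => h z (hz.trans_lt ?_) _ (by positivity) ?_⟩
      · have := hd.trans_le (min_le_left _ _)
        rwa [lt_div_iff₀' hM'] at this
      · have := hd.trans_le (min_le_right _ _)
        rw [lt_div_iff₀' (by positivity)] at this
        nlinarith
    have h2 : (fun t : T × T × E => rem t.1 t.2.2 (l * dist t.1 t.2.1) -
        rem t.2.1 t.2.2 (l * dist t.1 t.2.1)) =O[MorseSard.nearBall S a M]
          fun t => dist t.1 t.2.1 ^ (k + 2) := by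
      refine IsBigO.of_bound (2 * (N * l ^ (k + 2))) ?_
      filter_upwards [hle, (tendsto_nearBall_near S a M).eventually h1] with t ht ht'
      have h3 := ht'.1 _ ht.1
      have h4 := ht'.2 _ ht.2
      rw [mul_pow] at h3 h4
      rw [Real.norm_eq_abs, Real.norm_eq_abs, abs_of_nonneg (a := dist _ _ ^ _) (by positivity)]
      refine (abs_sub _ _).trans ?_
      linarith
    exact rel_of_isLittleO (h2.trans_isLittleO
      (isLittleO_dist_pow_succ (tendsto_dist_nearBall S a M) (k + 1)))
  have hU : ∀ l : ℕ, Rel b (MorseSard.nearBall S a M)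
      (fun t => u t.1 (t.2.2 + ((l : ℝ) * dist t.1 t.2.1) • v) -
        u t.2.1 (t.2.2 + ((l : ℝ) * dist t.1 t.2.1) • v))
      (fun t => dist t.1 t.2.1 ^ (k + 1)) := by
    intro l
    refine (h.mono hS).comp (φ := fun t : T × T × E => (t.1, t.2.1, t.2.2 + ((l : ℝ) * dist t.1 t.2.1) • v))
      (tendsto_nearBall_near S a M) ?_
    have h1 : (fun t : T × T × E => ((l : ℝ) * dist t.1 t.2.1) • v) =O[MorseSard.nearBall S a M]
        fun t => dist t.1 t.2.1 := by
      refine IsBigO.of_bound (l * ‖v‖) (Eventually.of_forall fun t => ?_)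
      rw [norm_smul, norm_mul, Real.norm_natCast]
      exact le_of_eq (by ring)
    exact ((isBigO_nearBall S a M).add h1).congr_left fun t => sub_add_eq_add_sub _ _ _
  have hsum : Rel b (MorseSard.nearBall S a M)
      (fun t => (dirD v (u t.1) t.2.2 - dirD v (u t.2.1) t.2.2) * dist t.1 t.2.1)
      (fun t => dist t.1 t.2.1 ^ (k + 1)) := by
    have : ∀ t : T × T × E, ∑ l ∈ Finset.Icc 1 (k + 1 + 1), c 1 l *
        ((u t.1 (t.2.2 + ((l : ℝ) * dist t.1 t.2.1) • v) -
        u t.2.1 (t.2.2 + ((l : ℝ) * dist t.1 t.2.1) • v)) -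
        (rem t.1 t.2.2 (l * dist t.1 t.2.1) - rem t.2.1 t.2.2 (l * dist t.1 t.2.1))) =
        (dirD v (u t.1) t.2.2 - dirD v (u t.2.1) t.2.2) * dist t.1 t.2.1 := by
      intro t
      have := hc (q t) (hq t) (dist t.1 t.2.1) 1
      rw [hq1, pow_one] at this
      rw [this]
      simp only [heval]
    simp only [← this]
    exact Rel.sum _ fun l _ => ((hU l).sub (hR l)).const_mul _
  have h3 := Rel.isBigO_mul (isBigO_refl (fun t : T × T × E => (dist t.1 t.2.1)⁻¹) _) hsum
  refine (h3.congr' (Eventually.of_forall fun t => ?_)).trans_isBigO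
    (IsBigO.of_bound 1 (Eventually.of_forall fun t => ?_))
  · by_cases hd : dist t.1 t.2.1 = 0
    · simp [dist_eq_zero.1 hd]
    · field_simp
  · by_cases hd : dist t.1 t.2.1 = 0
    · simp [hd]
    · rw [pow_succ']
      field_simp
      rfl

lemma Cls.cov_iterD (hu : ∀ x, ContDiff ℝ ∞ (u x)) (ha : LipPos X a) (L : List E)
    (h : Cls b X a u (k + L.length)) : Cov X fun S => Cls b S a (fun x => iterD L (u x)) k := by
  induction L generalizing u X with
  | nil => exact .of_self h
  | cons w L ih =>
    refine (Cls.cov_dirD hu ha (k := k + L.length) h w).bind fun S hS hQ => ?_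
    exact ih (fun x => contDiff_dirD (hu x) w) (ha.mono hS) hQ

/-- A smooth function whose derivatives of order less than `l` vanish at a point vanishes to order
`l` there. -/
lemma isBigO_of_iterD_eq_zero {κ : Type} [Finite κ] (B : Module.Basis κ ℝ E) (a : E) (l : ℕ)
    {g : E → ℝ} (hg : ContDiff ℝ ∞ g)
    (h : ∀ L : List κ, L.length < l → iterD (L.map B) g a = 0) :
    g =O[𝓝 a] fun z => ‖z - a‖ ^ l := by
  have := Fintype.ofFinite κ
  induction l generalizing g with
  | zero => simpa using hg.continuous.continuousAt.norm.isBoundedUnder_le.isBigO_one ℝ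
  | succ l ih =>
    have h1 : ∀ i, dirD (B i) g =O[𝓝 a] fun z => ‖z - a‖ ^ l := fun i =>
      ih (contDiff_dirD hg _) fun L hL => h (i :: L) (by simpa using hL)
    obtain ⟨C, hC, hB⟩ := B.exists_opNorm_le (F := ℝ)
    have h2 : ∃ C', ∀ᶠ z in 𝓝 a, ∀ i, ‖dirD (B i) g z‖ ≤ C' * ‖z - a‖ ^ l := by
      choose c hc using fun i => (h1 i).bound
      refine ⟨∑ i, |c i|, eventually_all.2 fun i => ?_⟩
      filter_upwards [hc i] with z hz
      refine hz.trans ?_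
      rw [norm_pow, norm_norm]
      gcongr
      exact (le_abs_self _).trans (Finset.single_le_sum (f := fun i => |c i|)
        (fun _ _ => abs_nonneg _) (Finset.mem_univ i))
    obtain ⟨C', hC'⟩ := h2
    obtain ⟨r, hr, hr'⟩ := Metric.eventually_nhds_iff_ball.1 hC'
    refine IsBigO.of_bound (C * |C'|) ?_
    filter_upwards [ball_mem_nhds a hr] with z hz
    have hz' : ‖z - a‖ < r := by simpa [dist_eq_norm] using hz
    have h3 := (convex_closedBall a ‖z - a‖).norm_image_sub_le_of_norm_fderiv_le (𝕜 := ℝ) (f := g)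
      (C := C * (|C'| * ‖z - a‖ ^ l)) (x := a) (y := z)
      (fun w _ => (hg.differentiable (by simp)).differentiableAt) (fun w hw => ?_)
      (mem_closedBall_self (norm_nonneg _)) (by simp [dist_eq_norm])
    · have h0 : g a = 0 := h [] (by simp)
      rw [h0, sub_zero] at h3
      rw [norm_pow, norm_norm, pow_succ]
      linarith
    · have hw' : ‖w - a‖ ≤ ‖z - a‖ := by simpa [dist_eq_norm] using hw
      refine hB (by positivity) fun i => (hr' w ?_ i).trans ?_
      · simpa [dist_eq_norm] using hw'.trans_lt hz'
      · gcongr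
        exact le_abs_self _

end Derivatives

/-! ### Straightening a hypersurface by Newton iteration -/

section Newton

variable {T : Type} [MetricSpace T] {E : Type} [NormedAddCommGroup E] [NormedSpace ℝ E]
  {X S : Set T} {a : T → E} {u : T → E → ℝ} {b : Bool} {k l : ℕ}

lemma abs_sub_sub_mul_le {g : E → ℝ} (hg : ContDiff ℝ ∞ g) {e p w : E} {r c C τ : ℝ}
    (h : ∀ z, ‖z - p‖ ≤ r → |dirD e g z - c| ≤ C) (h0 : ‖w - p‖ ≤ r) (h1 : ‖w + τ • e - p‖ ≤ r) :
    |g (w + τ • e) - g w - τ * c| ≤ C * |τ| := by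
  have hc : Convex ℝ ((fun s : ℝ => w + s • e) ⁻¹' closedBall p r) := by
    have h2 : (fun s : ℝ => w + s • e) = (AffineMap.lineMap w (w + e) : ℝ →ᵃ[ℝ] E) := by
      ext s
      simp [AffineMap.lineMap_apply, add_comm]
    rw [h2]
    exact (convex_closedBall p r).affine_preimage _
  have hd : ∀ s, HasDerivAt (fun s : ℝ => g (w + s • e) - s * c) (dirD e g (w + s • e) - c) s := by
    intro s
    exact ((hasDerivAt_line hg w e s).sub ((hasDerivAt_id s).mul_const c)).congr_deriv (by simp)
  have := hc.norm_image_sub_le_of_norm_hasDerivWithin_le (C := C) (x := 0) (y := τ)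
    (fun s _ => (hd s).hasDerivWithinAt)
    (fun s hs => h _ (by simpa [dist_eq_norm] using hs))
    (by simpa [dist_eq_norm] using h0) (by simpa [dist_eq_norm] using h1)
  simp only [zero_smul, add_zero, zero_mul, sub_zero, Real.norm_eq_abs] at this
  convert this using 2
  ring

/-- Newton's iteration in the direction `e` for the equation `h = 0` near `p`, starting from the
projection along `e`. -/
def newton (h : E → ℝ) (c : ℝ) (e : E) (es : E →L[ℝ] ℝ) (p : E) : ℕ → E → E
  | 0, z => z - es (z - p) • e
  | i + 1, z => newton h c e es p i z - (h (newton h c e es p i z) / c) • e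

variable {h : E → ℝ} {c : ℝ} {e : E} {es : E →L[ℝ] ℝ} {p : E}

lemma contDiff_newton (hh : ContDiff ℝ ∞ h) (i : ℕ) : ContDiff ℝ ∞ (newton h c e es p i) := by
  induction i with
  | zero =>
    exact contDiff_id.sub ((es.contDiff.comp (contDiff_id.sub contDiff_const)).smul contDiff_const)
  | succ i ih => exact ih.sub (((hh.comp ih).div_const c).smul contDiff_const)

lemma newton_self (hp : h p = 0) (i : ℕ) : newton h c e es p i p = p := by
  induction i with
  | zero => simp [newton]
  | succ i ih => simp [newton, ih, hp]

lemma newton_add_smul (he : es e = 1) (i : ℕ) (z : E) (s : ℝ) :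
    newton h c e es p i (z + s • e) = newton h c e es p i z := by
  induction i with
  | zero =>
    simp only [newton, map_sub, map_add, map_smul, he, smul_eq_mul, mul_one]
    module
  | succ i ih => simp [newton, ih]

lemma newton_add {v : E} (hv : es v = 0) (hh : ∀ z, h (z + v) = h z) (i : ℕ) (z : E) :
    newton h c e es p i (z + v) = newton h c e es p i z + v := by
  induction i with
  | zero =>
    simp only [newton, map_sub, map_add, hv]
    module
  | succ i ih =>
    simp only [newton, ih, hh]
    abel

lemma apply_newton {L : E →L[ℝ] ℝ} (hL : L e = 0) (i : ℕ) (z : E) :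
    L (newton h c e es p i z) = L z := by
  induction i with
  | zero => simp [newton, hL]
  | succ i ih => simp [newton, ih, hL]

lemma exists_newton_eq (i : ℕ) (z : E) : ∃ s : ℝ, newton h c e es p i z = z + s • e := by
  induction i with
  | zero => exact ⟨-es (z - p), by simp only [newton]; module⟩
  | succ i ih =>
    obtain ⟨s, hs⟩ := ih
    refine ⟨s - h (newton h c e es p i z) / c, ?_⟩
    simp only [newton, hs]
    module

lemma isBigO_sub_of_contDiff {F : Type} [NormedAddCommGroup F] [NormedSpace ℝ F] {g : E → F}
    (hg : ContDiff ℝ ∞ g) (p : E) : (fun z => g z - g p) =O[𝓝 p] fun z => z - p :=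
  (hg.differentiable (by simp)).differentiableAt.isBigO_sub

lemma isBigO_newton (hh : ContDiff ℝ ∞ h) (hp : h p = 0) (hc : dirD e h p = c) (hc0 : c ≠ 0)
    (i : ℕ) : (fun z => h (newton h c e es p i z)) =O[𝓝 p] fun z => ‖z - p‖ ^ (i + 1) := by
  have hΨ : ∀ i, (fun z => newton h c e es p i z - p) =O[𝓝 p] fun z => ‖z - p‖ := by
    intro i
    simpa [newton_self hp] using
      (isBigO_sub_of_contDiff (contDiff_newton (c := c) (e := e) (es := es) (p := p) hh i)
        p).norm_right
  induction i with
  | zero =>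
    have := isBigO_sub_of_contDiff (hh.comp (contDiff_newton (c := c) (e := e) (es := es) (p := p)
      hh 0)) p
    simpa [newton_self hp, hp] using this.norm_right
  | succ i ih =>
    obtain ⟨L, hL, hLb⟩ := (isBigO_sub_of_contDiff (contDiff_dirD hh e) p).exists_pos
    obtain ⟨r, hr, hLr⟩ := Metric.eventually_nhds_iff.1 hLb.bound
    have hcont : ∀ i, Tendsto (newton h c e es p i) (𝓝 p) (𝓝 p) := fun i => by
      have := (contDiff_newton (c := c) (e := e) (es := es) (p := p) hh i).continuous.tendsto p
      rwa [newton_self hp] at this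
    have hmax : (fun z => ‖newton h c e es p i z - p‖ + ‖newton h c e es p (i + 1) z - p‖)
        =O[𝓝 p] fun z => ‖z - p‖ := (hΨ i).norm_left.add (hΨ (i + 1)).norm_left
    have key : (fun z => h (newton h c e es p (i + 1) z)) =O[𝓝 p] fun z =>
        (‖newton h c e es p i z - p‖ + ‖newton h c e es p (i + 1) z - p‖) *
          h (newton h c e es p i z) := by
      refine IsBigO.of_bound (L / |c|) ?_
      have h2 : Tendsto (fun z => ‖newton h c e es p i z - p‖ + ‖newton h c e es p (i + 1) z - p‖)
          (𝓝 p) (𝓝 0) := by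
        simpa using ((hcont i).sub_const p).norm.add ((hcont (i + 1)).sub_const p).norm
      filter_upwards [h2.eventually_lt_const hr] with z hz
      set w := newton h c e es p i z
      set ρ := ‖w - p‖ + ‖newton h c e es p (i + 1) z - p‖ with hρ
      have hw : newton h c e es p (i + 1) z = w + (-(h w / c)) • e := by
        simp only [newton, neg_smul, w]
        abel
      have h3 := abs_sub_sub_mul_le hh (e := e) (p := p) (w := w) (r := ρ) (c := c) (C := L * ρ)
        (τ := -(h w / c)) (fun y hy => ?_) (by simp [hρ]) (by rw [← hw]; simp [hρ])
      · rw [← hw, neg_mul, div_mul_cancel₀ _ hc0, sub_neg_eq_add, sub_add_cancel, abs_neg,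
          abs_div] at h3
        rw [Real.norm_eq_abs, norm_mul, Real.norm_eq_abs, Real.norm_eq_abs,
          abs_of_nonneg (a := ρ) (by positivity)]
        exact h3.trans_eq (by ring)
      · have h4 := hLr (y := y) (by rw [dist_eq_norm]; exact hy.trans_lt hz)
        rw [hc, Real.norm_eq_abs] at h4
        exact h4.trans (by gcongr)
    refine key.trans ?_
    simpa only [pow_succ' _ (i + 1)] using hmax.mul ih

lemma eventually_near_ball {Q : T → E → Prop} (h : ∀ x ∈ X, ∀ᶠ z in 𝓝 (a x), Q x z) (M : ℝ) :
    ∀ᶠ p in near X, ∀ z, ‖z - a p.1‖ ≤ M * dist p.1 p.2 → Q p.1 z := by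
  refine (eventually_near_of_pointwise (R := fun x d => ∀ z, ‖z - a x‖ ≤ M * d → Q x z)
    fun x hx => ?_).mono fun p hp => hp.1
  obtain ⟨r, hr, h⟩ := Metric.eventually_nhds_iff.1 (h x hx)
  refine ⟨r / (|M| + 1), by positivity, fun d hd0 hd z hz => h ?_⟩
  rw [lt_div_iff₀' (by positivity)] at hd
  rw [dist_eq_norm]
  refine hz.trans_lt (lt_of_le_of_lt ?_ hd)
  gcongr
  linarith [le_abs_self M]

/-- Precomposing a family with the straightening of the hypersurfaces `h x = 0` along the direction
`e` keeps its order of regularity, even if `h` is less regular, provided that the derivatives of the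
family in the direction `e` vanish to a suitable order. -/
lemma exists_straightening {κ : Type} [Finite κ] {P : T → E → κ → ℝ} {h : T → E → ℝ} {K j : ℕ}
    {e : E} {es : E →L[ℝ] ℝ} (he : es e = 1) (ha : LipPos X a)
    (hh : ∀ x, ContDiff ℝ ∞ (h x)) (hhK : Cls b X a h K) (h0 : ∀ x ∈ X, h x (a x) = 0)
    (h1 : ∀ x ∈ X, dirD e (h x) (a x) ≠ 0) (hP : ∀ x i, ContDiff ℝ ∞ fun z => P x z i)
    (hPk : ∀ i, Cls b X a (fun x z => P x z i) (K + j))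
    (hPe : ∀ x ∈ X, ∀ i, dirD e (fun z => P x z i) =O[𝓝 (a x)] fun z => ‖z - a x‖ ^ j) :
    ∃ Ψ : T → E → E, (∀ x, ContDiff ℝ ∞ (Ψ x)) ∧ (∀ x ∈ X, Ψ x (a x) = a x) ∧
      (∀ x z (s : ℝ), Ψ x (z + s • e) = Ψ x z) ∧
      (∀ x v, es v = 0 → (∀ z, h x (z + v) = h x z) → ∀ z, Ψ x (z + v) = Ψ x z + v) ∧
      (∀ L : E →L[ℝ] ℝ, L e = 0 → ∀ x z, L (Ψ x z) = L z) ∧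
      (∀ x ∈ X, (fun z => h x (Ψ x z)) =O[𝓝 (a x)] fun z => ‖z - a x‖ ^ (K + 1)) ∧
      Cov X fun S => ∀ i, Cls b S a (fun x z => P x (Ψ x z) i) (K + j) := by
  set c : T → ℝ := fun x => dirD e (h x) (a x) with hc
  set Ψ : T → E → E := fun x => newton (h x) (c x) e es (a x) K with hΨdef
  have hΨs : ∀ x, ContDiff ℝ ∞ (Ψ x) := fun x => contDiff_newton (hh x) K
  have hΨa : ∀ x ∈ X, Ψ x (a x) = a x := fun x hx => newton_self (h0 x hx) K
  have hhΨ : ∀ x ∈ X, (fun z => h x (Ψ x z)) =O[𝓝 (a x)] fun z => ‖z - a x‖ ^ (K + 1) :=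
    fun x hx => isBigO_newton (hh x) (h0 x hx) rfl (h1 x hx) K
  refine ⟨Ψ, hΨs, hΨa, fun x z s => newton_add_smul he K z s,
    fun x v hv hv' z => newton_add hv hv' K z, fun L hL x z => apply_newton hL K z, hhΨ, ?_⟩
  have c1 : Cov X fun S => PtO S a (fun x z => ‖Ψ x z - a x‖) 1 := cov_ptO fun x hx => by
    have := isBigO_sub_of_contDiff (hΨs x) (a x)
    rw [hΨa x hx] at this
    simpa using this.norm_norm
  have c2 : Cov X fun S => PtO S a (fun x z => h x (Ψ x z)) (K + 1) := cov_ptO hhΨ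
  have c3 : Cov X fun S => ∀ i, PtO S a (fun x => dirD e fun z => P x z i) j :=
    Cov.forall (fun i S S' hS h => h.mono hS) fun i => cov_ptO fun x hx => hPe x hx i
  have c4 : Cov X fun S => ∃ N : ℕ, ∀ x ∈ S, 1 / ((N : ℝ) + 1) < |c x| :=
    Cov.of_pointwise fun x hx => exists_nat_one_div_lt (abs_pos.2 (h1 x hx))
  refine c1.bind fun S₁ hS₁ q1 => (c2.subset hS₁ fun _ _ hS h => h.mono hS).bind
    fun S₂ hS₂ q2 => (c3.subset (hS₂.trans hS₁) fun _ _ hS h i => (h i).mono hS).bind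
    fun S₃ hS₃ q3 => (c4.subset (hS₃.trans (hS₂.trans hS₁))
      fun _ _ hS h => h.imp fun N hN x hx => hN x (hS hx)).mono fun S hS ⟨N, hN⟩ => ?_
  have hSX : S ⊆ X := hS.trans (hS₃.trans (hS₂.trans hS₁))
  replace q1 := q1.mono (hS.trans (hS₃.trans hS₂))
  replace q2 := q2.mono (hS.trans hS₃)
  replace q3 := fun i => (q3 i).mono hS
  replace ha := ha.mono hSX
  intro i M
  set m := MorseSard.nearBall S a M with hm
  have e1 : (fun t : T × T × E => Ψ t.1 t.2.2 - a t.1) =O[m] fun t => dist t.1 t.2.1 := by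
    simpa using (q1.left M).of_norm_left
  have e2 : (fun t : T × T × E => Ψ t.2.1 t.2.2 - a t.1) =O[m] fun t => dist t.1 t.2.1 := by
    have : (fun t : T × T × E => Ψ t.2.1 t.2.2 - a t.2.1) =O[m] fun t => dist t.1 t.2.1 := by
      simpa using (q1.right ha M).of_norm_left
    simpa using this.sub (ha.nearBall M)
  set τ : T × T × E → ℝ := fun t => es (Ψ t.1 t.2.2 - Ψ t.2.1 t.2.2) with hτ
  have hΨτ : ∀ t, Ψ t.1 t.2.2 = Ψ t.2.1 t.2.2 + τ t • e := by
    intro t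
    obtain ⟨s, hs⟩ := exists_newton_eq (h := h t.1) (c := c t.1) (e := e) (es := es) (p := a t.1)
      K t.2.2
    obtain ⟨s', hs'⟩ := exists_newton_eq (h := h t.2.1) (c := c t.2.1) (e := e) (es := es)
      (p := a t.2.1) K t.2.2
    have : Ψ t.1 t.2.2 - Ψ t.2.1 t.2.2 = (s - s') • e := by
      simp only [hΨdef, hs, hs']
      module
    simp only [hτ, this, map_smul, he, smul_eq_mul, mul_one]
    rw [← this]
    abel
  obtain ⟨M', hM'⟩ : ∃ M', ∀ᶠ t in m, ‖Ψ t.1 t.2.2 - a t.1‖ ≤ M' * dist t.1 t.2.1 ∧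
      ‖Ψ t.2.1 t.2.2 - a t.1‖ ≤ M' * dist t.1 t.2.1 := by
    obtain ⟨M₁, h₁⟩ := e1.bound
    obtain ⟨M₂, h₂⟩ := e2.bound
    refine ⟨max M₁ M₂, ?_⟩
    filter_upwards [h₁, h₂] with t ht ht'
    rw [Real.norm_eq_abs, abs_of_nonneg dist_nonneg] at ht ht'
    exact ⟨ht.trans (by gcongr; exact le_max_left _ _), ht'.trans (by gcongr; exact le_max_right _ _)⟩
  have hnear : Tendsto (fun t : T × T × E => (t.1, t.2.1)) m (near S) :=
    tendsto_nearBall_near S a M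
  have hτO : τ =O[m] fun t => h t.1 (Ψ t.1 t.2.2) - h t.1 (Ψ t.2.1 t.2.2) := by
    refine IsBigO.of_bound (2 * ((N : ℝ) + 1)) ?_
    have h2 := hnear.eventually (eventually_near_ball (X := S) (a := a)
      (Q := fun x z => |dirD e (h x) z - c x| ≤ |c x| / 2) (fun x hx => ?_) M')
    · filter_upwards [h2, hM', hnear.eventually (eventually_near_mem S)] with t ht htM htS
      have h3 := abs_sub_sub_mul_le (hh t.1) (e := e) (p := a t.1) (w := Ψ t.2.1 t.2.2) (τ := τ t)
        ht htM.2 (by rw [← hΨτ]; exact htM.1)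
      rw [← hΨτ] at h3
      have h4 := hN t.1 htS.1
      have h5 : |τ t| * |c t.1| ≤ |h t.1 (Ψ t.1 t.2.2) - h t.1 (Ψ t.2.1 t.2.2)| +
          |c t.1| / 2 * |τ t| := by
        rw [← abs_mul]
        refine le_trans ?_ (add_le_add_right h3 _)
        rw [abs_sub_comm _ (τ t * c t.1)]
        have := abs_add_le (h t.1 (Ψ t.1 t.2.2) - h t.1 (Ψ t.2.1 t.2.2))
          (τ t * c t.1 - (h t.1 (Ψ t.1 t.2.2) - h t.1 (Ψ t.2.1 t.2.2)))
        simpa using this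
      rw [Real.norm_eq_abs, Real.norm_eq_abs]
      have h6 : 1 ≤ ((N : ℝ) + 1) * |c t.1| := by
        rw [div_lt_iff₀ (by positivity)] at h4
        linarith
      have h7 := abs_nonneg (τ t)
      nlinarith [mul_le_mul_of_nonneg_right h6 h7]
    · have h3 := (contDiff_dirD (hh x) e).continuous.continuousAt (x := a x)
      have h4 := Metric.continuousAt_iff'.1 h3 (|c x| / 2) (half_pos (abs_pos.2 (h1 x (hSX hx))))
      filter_upwards [h4] with z hz
      exact hz.le
  have hD : Rel b m (fun t => h t.1 (Ψ t.1 t.2.2) - h t.1 (Ψ t.2.1 t.2.2))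
      (fun t => dist t.1 t.2.1 ^ K) := by
    have r1 : Rel b m (fun t => h t.1 (Ψ t.1 t.2.2)) (fun t => dist t.1 t.2.1 ^ K) :=
      rel_of_isLittleO ((q2.left M).trans_isLittleO
        (isLittleO_dist_pow_succ (tendsto_dist_nearBall S a M) K))
    have r2 : Rel b m (fun t => h t.2.1 (Ψ t.2.1 t.2.2)) (fun t => dist t.1 t.2.1 ^ K) :=
      rel_of_isLittleO ((q2.right ha M).trans_isLittleO
        (isLittleO_dist_pow_succ (tendsto_dist_nearBall S a M) K))
    have r3 := (hhK.mono hSX).comp (m := m)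
      (φ := fun t : T × T × E => (t.1, t.2.1, Ψ t.2.1 t.2.2)) hnear e2
    refine ((r1.sub r2).sub r3).congr' (Eventually.of_forall fun t => ?_)
    simp only
    ring
  have hP1 : (fun t : T × T × E => P t.1 (Ψ t.1 t.2.2) i - P t.1 (Ψ t.2.1 t.2.2) i) =O[m]
      fun t => dist t.1 t.2.1 ^ j * τ t := by
    obtain ⟨C, hC⟩ := q3 i
    refine IsBigO.of_bound (|C| * |M'| ^ j) ?_
    have h2 := hnear.eventually (eventually_near_ball (X := S) (a := a)
      (Q := fun x z => |dirD e (fun z => P x z i) z| ≤ C * ‖z - a x‖ ^ j) (fun x hx => ?_) M')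
    · filter_upwards [h2, hM'] with t ht htM
      have h3 := abs_sub_sub_mul_le (hP t.1 i) (e := e) (p := a t.1) (w := Ψ t.2.1 t.2.2)
        (τ := τ t) (c := 0) (C := |C| * (|M'| * dist t.1 t.2.1) ^ j) (r := M' * dist t.1 t.2.1)
        (fun z hz => ?_) htM.2 (by rw [← hΨτ]; exact htM.1)
      · rw [← hΨτ, mul_zero, sub_zero] at h3
        rw [Real.norm_eq_abs, norm_mul, Real.norm_eq_abs, Real.norm_eq_abs,
          abs_of_nonneg (a := dist _ _ ^ j) (by positivity)]
        refine h3.trans_eq ?_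
        rw [mul_pow]
        ring
      · rw [sub_zero]
        refine (ht z hz).trans ?_
        gcongr
        · exact le_abs_self C
        · exact hz.trans (by gcongr; exact le_abs_self M')
    · obtain ⟨r, hr, h⟩ := hC x hx
      filter_upwards [ball_mem_nhds (a x) hr] with z hz
      exact h z (by simpa [dist_eq_norm] using hz)
  have r1 : Rel b m (fun t => P t.1 (Ψ t.1 t.2.2) i - P t.1 (Ψ t.2.1 t.2.2) i)
      (fun t => dist t.1 t.2.1 ^ (K + j)) := by
    refine Rel.of_isBigO_left hP1 ?_
    have := Rel.isBigO_mul (isBigO_refl (fun t : T × T × E => dist t.1 t.2.1 ^ j) m)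
      (Rel.of_isBigO_left hτO hD)
    simpa only [← pow_add, add_comm j K] using this
  have r2 := ((hPk i).mono hSX).comp (m := m)
    (φ := fun t : T × T × E => (t.1, t.2.1, Ψ t.2.1 t.2.2)) hnear e2
  refine (r1.add r2).congr' (Eventually.of_forall fun t => ?_)
  simp only
  ring

end Newton

/-! ### Sets with small images -/

section SmallImages

/-- `p ε` for all positive `ε` if `b` is true, for some positive `ε` otherwise. -/
def Quant (b : Bool) (p : ℝ → Prop) : Prop := if b then ∀ ε > 0, p ε else ∃ ε > 0, p ε

lemma Quant.map {b : Bool} {p p' : ℝ → Prop} (h : Quant b p) {C : ℝ} {q : ℕ} (hC : 0 < C)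
    (hq : q ≠ 0) (hp : ∀ ε > 0, p ε → p' (C * ε ^ q)) : Quant b p' := by
  cases b
  · obtain ⟨ε, hε, h⟩ : ∃ ε > 0, p ε := by simpa [Quant] using h
    have : ∃ ε > 0, p' ε := ⟨_, by positivity, hp ε hε h⟩
    simpa [Quant] using this
  · replace h : ∀ ε > 0, p ε := by simpa [Quant] using h
    have : ∀ ε > 0, p' ε := by
      intro ε hε
      have h1 := hp ((ε / C) ^ ((q : ℝ)⁻¹)) (by positivity) (h _ (by positivity))
      rwa [Real.rpow_inv_natCast_pow (by positivity) hq, mul_div_cancel₀ _ hC.ne'] at h1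
    simpa [Quant] using this

lemma Rel.quant {α : Type} {l : Filter α} {f g : α → ℝ} {b : Bool} (h : Rel b l f g) :
    Quant b fun ε => ∀ᶠ t in l, |f t| ≤ ε * |g t| := by
  cases b
  · have h' : f =O[l] g := by simpa [Rel] using h
    obtain ⟨c, hc, h⟩ := h'.exists_pos
    simpa [Quant] using ⟨c, hc, h.bound⟩
  · have h' : f =o[l] g := by simpa [Rel] using h
    simpa [Quant] using fun ε (hε : 0 < ε) => h'.bound hε

lemma Quant.forall {κ : Type} [Finite κ] {b : Bool} {p : κ → ℝ → Prop}
    (hp : ∀ i ε ε', ε ≤ ε' → p i ε → p i ε') (h : ∀ i, Quant b (p i)) :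
    Quant b fun ε => ∀ i, p i ε := by
  have := Fintype.ofFinite κ
  cases b
  · have h' : ∀ i, ∃ ε > 0, p i ε := fun i => by simpa [Quant] using h i
    choose ε hε hpε using h'
    have : ∃ ε > 0, ∀ i, p i ε := by
      refine ⟨∑ i, ε i + 1, ?_, fun i => hp i _ _ ?_ (hpε i)⟩
      · have : 0 ≤ ∑ i, ε i := Finset.sum_nonneg fun i _ => (hε i).le
        linarith
      · have := Finset.single_le_sum (f := ε) (fun i _ => (hε i).le) (Finset.mem_univ i)
        linarith
    simpa [Quant] using this
  · have h' : ∀ i, ∀ ε > 0, p i ε := fun i => by simpa [Quant] using h i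
    simpa [Quant] using fun ε (hε : 0 < ε) i => h' i ε hε

variable {T : Type} [MetricSpace T] {ι : Type} [Fintype ι]

/-- Small subsets of `S` with diameter at most `ρ` have an image of volume at most `ε * ρ ^ s`. -/
def SmallAt (F : T → ι → ℝ) (s : ℕ) (S : Set T) (ε : ℝ) : Prop :=
  ∃ δ : T → ℝ, (∀ x, 0 < δ x) ∧ ∀ ρ > 0, ∀ B ⊆ S, (∀ x ∈ B, ρ < δ x) →
    (∀ x ∈ B, ∀ y ∈ B, dist x y ≤ ρ) → volume (F '' B) ≤ ENNReal.ofReal (ε * ρ ^ s)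

/-- `X` is a countable union of sets whose small subsets have small images. -/
def Good (b : Bool) (F : T → ι → ℝ) (s : ℕ) (X : Set T) : Prop :=
  Cov X fun S => Quant b (SmallAt F s S)

lemma SmallAt.congr {F F' : T → ι → ℝ} {s : ℕ} {S : Set T} {ε : ℝ} (h : SmallAt F s S ε)
    (hF : EqOn F F' S) : SmallAt F' s S ε := by
  obtain ⟨δ, hδ, h⟩ := h
  refine ⟨δ, hδ, fun ρ hρ B hB h1 h2 => ?_⟩
  rw [← (hF.mono hB).image_eq]
  exact h ρ hρ B hB h1 h2

lemma Good.congr {b : Bool} {F F' : T → ι → ℝ} {s : ℕ} {X : Set T} (h : Good b F s X)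
    (hF : EqOn F F' X) : Good b F' s X :=
  Cov.mono h fun _ hS h => by
    simpa using h.map (q := 1) one_pos one_ne_zero fun ε _ h => by
      simpa using h.congr (hF.mono hS)

lemma SmallAt.of_near {F : T → ι → ℝ} {s : ℕ} {S : Set T} {ε : ℝ} {q : T × T → Prop}
    (hq : ∀ᶠ p in near S, q p)
    (h : ∃ δ : T → ℝ, (∀ x, 0 < δ x) ∧ ∀ ρ > 0, ρ ≤ 1 → ∀ B ⊆ S, B.Nonempty → (∀ x ∈ B, ρ < δ x) →
      (∀ x ∈ B, ∀ y ∈ B, dist x y ≤ ρ) → (∀ x ∈ B, ∀ y ∈ B, q (x, y)) →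
        volume (F '' B) ≤ ENNReal.ofReal (ε * ρ ^ s)) : SmallAt F s S ε := by
  obtain ⟨δ, hδ, hq⟩ := hq
  obtain ⟨δ', hδ', h⟩ := h
  refine ⟨fun x => min (min (δ x) 1) (δ' x), fun x => lt_min (lt_min (hδ x) one_pos) (hδ' x),
    fun ρ hρ B hB h1 h2 => ?_⟩
  rcases B.eq_empty_or_nonempty with rfl | hne
  · simp
  simp only [lt_min_iff] at h1
  obtain ⟨x, hx⟩ := hne
  refine h ρ hρ (h1 x hx).1.2.le B hB ⟨x, hx⟩ (fun x hx => (h1 x hx).2) h2 fun x hx y hy => ?_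
  exact hq x (hB hx) y (hB hy) ((h2 x hx y hy).trans_lt (h1 x hx).1.1)
    ((h2 x hx y hy).trans_lt (h1 y hy).1.1)

/-- Volume of a thin neighborhood of a graph. -/
lemma volume_le_of_graph (I : Finset ι) (W : Set (ι → ℝ)) (T₀ : Set (I → ℝ))
    (G : (I → ℝ) → ι → ℝ) (hG : ∀ i, Continuous fun u => G u i) {η : ℝ} (hη : 0 ≤ η)
    (hW : ∀ w ∈ W, (fun i : I => w i) ∈ T₀ ∧ ∀ i ∉ I, |w i - G (fun i : I => w i) i| ≤ η) :
    volume W ≤ volume T₀ * ENNReal.ofReal ((2 * η) ^ (Fintype.card ι - I.card)) := by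
  classical
  let e := MeasurableEquiv.piEquivPiSubtypeProd (fun _ : ι => ℝ) (fun i => i ∈ I)
  have he : MeasurePreserving e volume volume :=
    (by
      convert volume_preserving_piEquivPiSubtypeProd (fun _ : ι => ℝ) (fun i => i ∈ I) <;> rfl)
  let V : Set (({i // i ∈ I} → ℝ) × ({i // i ∉ I} → ℝ)) :=
    Prod.fst ⁻¹' toMeasurable volume T₀ ∩ {p | ∀ i, |p.2 i - G p.1 i| ≤ η}
  have hV : MeasurableSet V := by
    refine (measurable_fst (measurableSet_toMeasurable _ _)).inter (IsClosed.measurableSet ?_)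
    rw [ofPred_forall]
    refine isClosed_iInter fun i => isClosed_le ?_ continuous_const
    exact (((continuous_apply i).comp continuous_snd).sub ((hG i).comp continuous_fst)).abs
  have hWV : W ⊆ e ⁻¹' V := fun w hw =>
    ⟨subset_toMeasurable _ _ (hW w hw).1, fun i => (hW w hw).2 i i.2⟩
  have hcard : Fintype.card {i // i ∉ I} = Fintype.card ι - I.card := by
    rw [Fintype.card_subtype_compl, Fintype.card_coe]
  calc volume W ≤ volume (e ⁻¹' V) := measure_mono hWV
    _ = volume V := he.measure_preimage hV.nullMeasurableSet
    _ = ∫⁻ u, volume (Prod.mk u ⁻¹' V) := Measure.prod_apply hV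
    _ ≤ ∫⁻ u, (toMeasurable volume T₀).indicator
        (fun _ => ENNReal.ofReal ((2 * η) ^ (Fintype.card ι - I.card))) u := by
      refine lintegral_mono fun u => ?_
      by_cases hu : u ∈ toMeasurable volume T₀
      · rw [indicator_of_mem hu]
        have hsub : Prod.mk u ⁻¹' V ⊆ closedBall (fun i : {i // i ∉ I} => G u i) η := by
          rintro v ⟨_, hv⟩
          rw [mem_closedBall, dist_pi_le_iff hη]
          exact fun i => hv i
        refine (measure_mono hsub).trans_eq ?_
        rw [Real.volume_pi_closedBall _ hη, hcard]
      · rw [indicator_of_notMem hu]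
        have : Prod.mk u ⁻¹' V = ∅ := by
          ext v
          simp [V, hu]
        rw [this, measure_empty]
    _ = volume T₀ * ENNReal.ofReal ((2 * η) ^ (Fintype.card ι - I.card)) := by
      rw [lintegral_indicator_const (measurableSet_toMeasurable _ _), measure_toMeasurable,
        mul_comm]

end SmallImages

/-! ### Families with prescribed linear components -/

section Straight

variable {T : Type} [MetricSpace T] {E : Type} [NormedAddCommGroup E] [NormedSpace ℝ E]
  {X S : Set T} {a : T → E} {b : Bool} {k : ℕ} {ι : Type} {I : Finset ι}
  {P : T → E → ι → ℝ} {ℓ : ι → E →L[ℝ] ℝ} {e : ι → E}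

/-- The projection to the common kernel of the linear forms `ℓ i`, `i ∈ I`, with respect to the
dual vectors `e i`. -/
def kerProj (I : Finset ι) (ℓ : ι → E →L[ℝ] ℝ) (e : ι → E) : E →L[ℝ] E :=
  ContinuousLinearMap.id ℝ E - ∑ i ∈ I, (ℓ i).smulRight (e i)

lemma kerProj_apply (w : E) : kerProj I ℓ e w = w - ∑ i ∈ I, ℓ i w • e i := by
  simp [kerProj]

open Classical in
/-- A family of maps to `ι → ℝ`, regular of order `k`, whose coordinates in `I` are linearly
independent linear forms `ℓ i`, and whose derivative at the base point vanishes on the common kernel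
of these linear forms. -/
structure Straight (b : Bool) (k : ℕ) (X : Set T) (a : T → E) (I : Finset ι) (P : T → E → ι → ℝ)
    (ℓ : ι → E →L[ℝ] ℝ) (e : ι → E) : Prop where
  smooth : ∀ x i, ContDiff ℝ ∞ fun z => P x z i
  cls : ∀ i, Cls b X a (fun x z => P x z i) k
  eq : ∀ x z, ∀ i ∈ I, P x z i = ℓ i z
  dual : ∀ i ∈ I, ∀ l ∈ I, ℓ i (e l) = if i = l then 1 else 0
  crit : ∀ x ∈ X, ∀ v, (∀ i ∈ I, ℓ i v = 0) → ∀ i, dirD v (fun z => P x z i) (a x) = 0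

lemma Straight.mono (H : Straight b k X a I P ℓ e) (hS : S ⊆ X) : Straight b k S a I P ℓ e :=
  ⟨H.smooth, fun i => (H.cls i).mono hS, H.eq, H.dual, fun x hx => H.crit x (hS hx)⟩

lemma Straight.apply_kerProj (H : Straight b k X a I P ℓ e) {i : ι} (hi : i ∈ I) (w : E) :
    ℓ i (kerProj I ℓ e w) = 0 := by
  rw [kerProj_apply, map_sub, map_sum, sub_eq_zero, Finset.sum_eq_single i]
  · simp [H.dual i hi i hi]
  · intro l hl hli
    simp [H.dual i hi l hl, hli.symm]
  · exact fun h => absurd hi h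

/-- If the derivatives of the family along the common kernel of the linear forms vanish to order
`l`, then the image points lie close to a graph over the coordinates in `I`. -/
lemma Straight.graph (H : Straight b k X a I P ℓ e) (ha : LipPos X a) {κ : Type} [Fintype κ]
    (B : Module.Basis κ ℝ E) {l : ℕ} (i : ι)
    (hl : ∀ j, PtO X a (fun x => dirD (kerProj I ℓ e (B j)) fun z => P x z i) l) :
    ∃ R₁ R₂ : T × T → ℝ, Rel b (near X) R₁ (fun p => dist p.1 p.2 ^ k) ∧
      R₂ =O[near X] (fun p => dist p.1 p.2 ^ (l + 1)) ∧
      ∀ p, P p.2 (a p.2) i =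
        P p.1 (a p.1 + ∑ i ∈ I, (ℓ i (a p.2) - ℓ i (a p.1)) • e i) i + R₁ p + R₂ p := by
  have ha' : (fun p : T × T => a p.2 - a p.1) =O[near X] fun p => dist p.1 p.2 :=
    (IsBigO.neg_left ha).congr_left fun p => by simp
  refine ⟨fun p => P p.2 (a p.2) i - P p.1 (a p.2) i, fun p => P p.1 (a p.2) i -
    P p.1 (a p.1 + ∑ i ∈ I, (ℓ i (a p.2) - ℓ i (a p.1)) • e i) i, ?_, ?_, fun p => by ring⟩
  · have := (H.cls i).comp (m := near X) (φ := fun p : T × T => (p.1, p.2, a p.2)) tendsto_id ha'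
    have h2 := this.const_mul (-1)
    refine h2.congr' (Eventually.of_forall fun p => ?_)
    simp only
    ring
  have : FiniteDimensional ℝ E := B.finiteDimensional_of_finite
  obtain ⟨A, hA, hAb⟩ := ha'.exists_pos
  choose C hC using hl
  have hcoord : ∀ j, ∃ c, ∀ w : E, |B.repr w j| ≤ c * ‖w‖ := fun j =>
    ⟨‖(B.coord j).toContinuousLinearMap‖, fun w =>
      (B.coord j).toContinuousLinearMap.le_opNorm w⟩
  choose c hc using hcoord
  set π := kerProj I ℓ e with hπ
  set M := A + ‖π‖ * A with hM
  have h1 : ∀ᶠ p in near X, ∀ j, ∀ z, ‖z - a p.1‖ ≤ M * dist p.1 p.2 →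
      |dirD (π (B j)) (fun z => P p.1 z i) z| ≤ C j * ‖z - a p.1‖ ^ l := by
    refine eventually_all.2 fun j => eventually_near_ball (X := X) (a := a)
      (Q := fun x z => |dirD (π (B j)) (fun z => P x z i) z| ≤ C j * ‖z - a x‖ ^ l)
      (fun x hx => ?_) M
    obtain ⟨r, hr, h⟩ := hC j x hx
    filter_upwards [ball_mem_nhds (a x) hr] with z hz
    exact h z (by simpa [dist_eq_norm] using hz)
  refine IsBigO.of_bound ((∑ j, |c j| * A * (|C j| * M ^ l))) ?_
  have hM0 : 0 ≤ M := by positivity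
  filter_upwards [h1, hAb.bound] with p hp hap
  obtain ⟨x, y⟩ := p
  simp only [Real.norm_eq_abs, abs_of_nonneg dist_nonneg] at hap hp ⊢
  set w := a y - a x with hw
  have hz : a x + ∑ i ∈ I, (ℓ i (a y) - ℓ i (a x)) • e i = a y + (-1 : ℝ) • π w := by
    rw [hπ, kerProj_apply, hw]
    simp only [map_sub]
    module
  have hlin : ∀ z, dirD (π w) (fun z => P x z i) z =
      ∑ j, B.repr w j * dirD (π (B j)) (fun z => P x z i) z := by
    intro z
    conv_lhs => rw [← B.sum_repr w]
    simp only [dirD, map_sum, map_smul, smul_eq_mul]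
  have h2 := abs_sub_sub_mul_le (H.smooth x i) (e := π w) (p := a x) (w := a y) (τ := -1) (c := 0)
    (r := M * dist x y) (C := ∑ j, |c j| * A * (|C j| * M ^ l) * dist x y ^ (l + 1))
    (fun z hz => ?_) ?_ ?_
  · rw [← hz, mul_zero, sub_zero, abs_neg, abs_one, mul_one, ← Finset.sum_mul] at h2
    rw [abs_sub_comm, abs_of_nonneg (a := dist x y ^ (l + 1)) (by positivity)]
    exact h2
  · rw [sub_zero, hlin]
    refine (Finset.abs_sum_le_sum_abs _ _).trans (Finset.sum_le_sum fun j _ => ?_)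
    rw [abs_mul]
    calc |B.repr w j| * |dirD (π (B j)) (fun z => P x z i) z|
        ≤ (|c j| * (A * dist x y)) * (|C j| * (M * dist x y) ^ l) := by
          refine mul_le_mul ((hc j w).trans ?_) ((hp j z hz).trans ?_) (abs_nonneg _)
            (by positivity)
          · gcongr
            exact le_abs_self _
          · gcongr
            exact le_abs_self _
      _ = _ := by
          rw [mul_pow, pow_succ]
          ring
  · refine hap.trans ?_
    gcongr
    rw [hM]
    have : 0 ≤ ‖π‖ * A := by positivity
    linarith
  · have h3 : ‖a y + (-1 : ℝ) • π w - a x‖ ≤ ‖w‖ + ‖π w‖ := by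
      rw [show a y + (-1 : ℝ) • π w - a x = w - π w by rw [hw]; module]
      exact norm_sub_le _ _
    refine h3.trans ?_
    have h4 := π.le_opNorm w
    have h5 : ‖π‖ * ‖w‖ ≤ ‖π‖ * (A * dist x y) := by gcongr
    rw [hM]
    linarith

end Straight

section StraightVolume

variable {T : Type} [MetricSpace T] {E : Type} [NormedAddCommGroup E] [NormedSpace ℝ E]
  {X S : Set T} {a : T → E} {b : Bool} {k l : ℕ} {ι : Type} [Fintype ι] {I : Finset ι}
  {P : T → E → ι → ℝ} {ℓ : ι → E →L[ℝ] ℝ} {e : ι → E}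

lemma Straight.volume_le (H : Straight b k X a I P ℓ e) {B : Set T} {x₀ : T} {η : ℝ} (hη : 0 ≤ η)
    (hB : ∀ y ∈ B, ∀ i, |P y (a y) i -
      P x₀ (a x₀ + ∑ i ∈ I, (ℓ i (a y) - ℓ i (a x₀)) • e i) i| ≤ η) :
    volume ((fun x => P x (a x)) '' B) ≤ volume ((fun x (i : I) => ℓ i (a x)) '' B) *
      ENNReal.ofReal ((2 * η) ^ (Fintype.card ι - I.card)) := by
  refine volume_le_of_graph I _ _
    (fun u i => P x₀ (a x₀ + ∑ i : I, (u i - ℓ i (a x₀)) • e i) i) (fun i => ?_) hη ?_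
  · exact (H.smooth x₀ i).continuous.comp (by fun_prop)
  · rintro _ ⟨y, hy, rfl⟩
    have h1 : (fun i : I => P y (a y) i) = fun i : I => ℓ i (a y) := by
      ext i
      exact H.eq y (a y) i i.2
    refine ⟨⟨y, hy, h1.symm⟩, fun i _ => ?_⟩
    have h2 : ∑ i : I, (P y (a y) i - ℓ i (a x₀)) • e i =
        ∑ i ∈ I, (ℓ i (a y) - ℓ i (a x₀)) • e i := by
      rw [← Finset.sum_coe_sort I]
      exact Finset.sum_congr rfl fun i _ => by rw [H.eq y (a y) i i.2]
    simp only
    rw [h2]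
    exact hB y hy i

/-- The case where the derivatives of the family along the common kernel of the linear components
vanish to the maximal order. -/
lemma Straight.quant_of_maximal (H : Straight b k X a I P ℓ e) (ha : LipPos X a) (hk : k ≠ 0)
    (hI : I ≠ Finset.univ) {κ : Type} [Fintype κ] (B : Module.Basis κ ℝ E)
    (hl : ∀ i j, PtO X a (fun x => dirD (kerProj I ℓ e (B j)) fun z => P x z i) k) :
    Quant b (SmallAt (fun x => P x (a x)) (k + Fintype.card ι - 1) X) := by
  have hIc : I.card < Fintype.card ι := (Finset.card_lt_iff_ne_univ I).2 hI
  set r := I.card with hr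
  set q := Fintype.card ι - r with hq
  have key : ∀ i, Quant b fun ε => ∀ᶠ p in near X, |P p.2 (a p.2) i -
      P p.1 (a p.1 + ∑ i ∈ I, (ℓ i (a p.2) - ℓ i (a p.1)) • e i) i| ≤ ε * dist p.1 p.2 ^ k := by
    intro i
    obtain ⟨R₁, R₂, h1, h2, h3⟩ := H.graph ha B i (hl i)
    have h4 := (h1.add (rel_of_isLittleO (b := b) (h2.trans_isLittleO
      (isLittleO_dist_pow_succ (tendsto_dist_near X) k)))).quant
    refine h4.map one_pos one_ne_zero fun ε _ h => ?_
    filter_upwards [h] with p hp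
    rw [h3, pow_one, one_mul]
    rw [abs_of_nonneg (a := dist _ _ ^ k) (by positivity)] at hp
    convert hp using 2
    ring
  obtain ⟨A, hA, hAb⟩ := ha.exists_pos
  set C := (∑ i, ‖ℓ i‖ + 1) * A with hC
  have hsum : 0 ≤ ∑ i, ‖ℓ i‖ := Finset.sum_nonneg fun _ _ => norm_nonneg _
  have hC0 : 0 < C := by positivity
  refine (Quant.forall (fun i ε ε' hε h => ?_) key).map (C := (2 * C) ^ r * 2 ^ q) (q := q)
    (by positivity) (by omega) fun ε hε h => ?_
  · filter_upwards [h] with p hp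
    exact hp.trans (by gcongr)
  refine SmallAt.of_near ((eventually_all.2 h).and hAb.bound) ⟨fun _ => 1, fun _ => one_pos,
    fun ρ hρ hρ1 B hB ⟨x₀, hx₀⟩ _ hdist hB' => ?_⟩
  have v1 := H.volume_le (x₀ := x₀) (B := B) (η := ε * ρ ^ k) (by positivity) fun y hy i =>
    ((hB' x₀ hx₀ y hy).1 i).trans (by gcongr; exact hdist x₀ hx₀ y hy)
  have v2 : volume ((fun x (i : I) => ℓ i (a x)) '' B) ≤ ENNReal.ofReal ((2 * (C * ρ)) ^ r) := by
    have : (fun x (i : I) => ℓ i (a x)) '' B ⊆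
        closedBall (fun i : I => ℓ i (a x₀)) (C * ρ) := by
      rintro _ ⟨y, hy, rfl⟩
      rw [mem_closedBall, dist_pi_le_iff (by positivity)]
      intro i
      have h5 := (hB' y hy x₀ hx₀).2
      simp only [Real.norm_eq_abs, abs_of_nonneg dist_nonneg] at h5
      rw [Real.dist_eq, ← map_sub]
      calc |ℓ i (a y - a x₀)| ≤ ‖ℓ i‖ * ‖a y - a x₀‖ := (ℓ i).le_opNorm _
        _ ≤ (∑ i, ‖ℓ i‖ + 1) * (A * ρ) := by
          gcongr
          · have := Finset.single_le_sum (f := fun i => ‖ℓ i‖) (fun _ _ => norm_nonneg _)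
              (Finset.mem_univ (i : ι))
            linarith
          · exact h5.trans (by gcongr; exact hdist y hy x₀ hx₀)
        _ = C * ρ := by rw [hC]; ring
    refine (measure_mono this).trans_eq ?_
    rw [Real.volume_pi_closedBall _ (by positivity), Fintype.card_coe]
  refine v1.trans ((mul_le_mul_left v2 _).trans ?_)
  rw [← ENNReal.ofReal_mul (by positivity)]
  refine ENNReal.ofReal_le_ofReal ?_
  have h6 : (2 * (C * ρ)) ^ r * (2 * (ε * ρ ^ k)) ^ q =
      (2 * C) ^ r * 2 ^ q * ε ^ q * ρ ^ (r + k * q) := by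
    rw [← mul_assoc 2 C, mul_pow _ ρ, ← mul_assoc 2 ε, mul_pow _ (ρ ^ k), mul_pow 2 ε, ← pow_mul,
      pow_add]
    ring
  rw [h6]
  refine mul_le_mul_of_nonneg_left (pow_le_pow_of_le_one hρ.le hρ1 ?_) (by positivity)
  obtain ⟨k', rfl⟩ := Nat.exists_eq_succ_of_ne_zero hk
  obtain ⟨q', hq'⟩ : ∃ q', q = q' + 1 := ⟨q - 1, by omega⟩
  have : Fintype.card ι = r + q' + 1 := by omega
  rw [this, hq']
  have : (k' + 1) * (q' + 1) = k' * q' + k' + q' + 1 := by ring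
  simp only [Nat.succ_eq_add_one]
  omega

/-- The image is small if the image under the linear components is small. -/
lemma Straight.quant_of_linear (H : Straight b k X a I P ℓ e) (ha : LipPos X a) (hl0 : l ≠ 0)
    (hlk : l < k) (hI : I ≠ Finset.univ) (hI0 : I.Nonempty)
    {κ : Type} [Fintype κ] (B : Module.Basis κ ℝ E)
    (hl : ∀ i j, PtO X a (fun x => dirD (kerProj I ℓ e (B j)) fun z => P x z i) l)
    (hlin : Quant b (SmallAt (fun x (i : I) => ℓ i (a x)) (k - l + I.card - 1) X)) :
    Quant b (SmallAt (fun x => P x (a x)) (k + Fintype.card ι - 1) X) := by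
  have hIc : I.card < Fintype.card ι := (Finset.card_lt_iff_ne_univ I).2 hI
  have hr0 : 0 < I.card := hI0.card_pos
  set r := I.card with hr
  set q := Fintype.card ι - r with hq
  have key : ∀ i, ∃ C > 0, ∀ᶠ p in near X, |P p.2 (a p.2) i -
      P p.1 (a p.1 + ∑ i ∈ I, (ℓ i (a p.2) - ℓ i (a p.1)) • e i) i| ≤
        C * dist p.1 p.2 ^ (l + 1) := by
    intro i
    obtain ⟨R₁, R₂, h1, h2, h3⟩ := H.graph ha B i (hl i)
    obtain ⟨C, hC, h4⟩ := ((h1.isBigO.trans (isBigO_dist_pow (tendsto_dist_near X) hlk)).add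
      h2).exists_pos
    refine ⟨C, hC, ?_⟩
    filter_upwards [h4.bound] with p hp
    rw [h3]
    rw [Real.norm_eq_abs, Real.norm_eq_abs, abs_of_nonneg (a := dist _ _ ^ (l + 1))
      (by positivity)] at hp
    convert hp using 2
    ring
  choose C hC key using key
  set C' := ∑ i, C i + 1 with hC'
  have hsum : 0 ≤ ∑ i, C i := Finset.sum_nonneg fun _ _ => (hC _).le
  have hC0 : 0 < C' := by positivity
  refine hlin.map (C := (2 * C') ^ q) (q := 1) (by positivity) one_ne_zero fun ε hε h => ?_
  obtain ⟨δ, hδ, h⟩ := h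
  refine SmallAt.of_near (eventually_all.2 key) ⟨δ, hδ,
    fun ρ hρ hρ1 B hB ⟨x₀, hx₀⟩ hρδ hdist hB' => ?_⟩
  have v1 := H.volume_le (x₀ := x₀) (B := B) (η := C' * ρ ^ (l + 1)) (by positivity) fun y hy i =>
    (hB' x₀ hx₀ y hy i).trans (by
      have := Finset.single_le_sum (f := C) (fun i _ => (hC i).le) (Finset.mem_univ i)
      gcongr
      · linarith
      · exact hdist x₀ hx₀ y hy)
  refine v1.trans ((mul_le_mul_left (h ρ hρ B hB hρδ hdist) _).trans ?_)
  rw [← ENNReal.ofReal_mul (by positivity)]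
  refine ENNReal.ofReal_le_ofReal ?_
  have h6 : ε * ρ ^ (k - l + r - 1) * (2 * (C' * ρ ^ (l + 1))) ^ q =
      (2 * C') ^ q * ε ^ 1 * ρ ^ (k - l + r - 1 + (l + 1) * q) := by
    rw [← mul_assoc 2 C', mul_pow _ (ρ ^ (l + 1)), ← pow_mul, pow_add]
    ring
  rw [h6]
  refine mul_le_mul_of_nonneg_left (pow_le_pow_of_le_one hρ.le hρ1 ?_) (by positivity)
  obtain ⟨l', rfl⟩ := Nat.exists_eq_succ_of_ne_zero hl0
  obtain ⟨q', hq'⟩ : ∃ q', q = q' + 1 := ⟨q - 1, by omega⟩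
  have : Fintype.card ι = r + q' + 1 := by omega
  rw [this, hq']
  have : (l'.succ + 1) * (q' + 1) = l' * q' + l' + 2 * q' + 2 := by
    rw [Nat.succ_eq_add_one]
    ring
  omega

end StraightVolume

/-! ### Families with prescribed linear components have small images -/

section StraightGood

variable {T : Type} [MetricSpace T] {E : Type} [NormedAddCommGroup E] [NormedSpace ℝ E]
  {X S : Set T} {a : T → E} {b : Bool} {k l K N : ℕ} {ι : Type} [Fintype ι] {I : Finset ι}
  {P : T → E → ι → ℝ} {ℓ : ι → E →L[ℝ] ℝ} {e : ι → E}

lemma Cov.empty {Q : Set T → Prop} : Cov (∅ : Set T) Q :=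
  ⟨Empty, inferInstance, fun i => i.elim, empty_subset _, fun i => i.elim⟩

lemma dirD_add (v w : E) (g : E → ℝ) (z : E) : dirD (v + w) g z = dirD v g z + dirD w g z := by
  simp [dirD]

lemma dirD_smul (c : ℝ) (v : E) (g : E → ℝ) (z : E) : dirD (c • v) g z = c * dirD v g z := by
  simp [dirD]

lemma dirD_comp {E' : Type} [NormedAddCommGroup E'] [NormedSpace ℝ E'] {g : E' → ℝ}
    {Ψ : E → E'} (hg : ContDiff ℝ ∞ g) (hΨ : ContDiff ℝ ∞ Ψ) (v z : E) :
    dirD v (fun z => g (Ψ z)) z = dirD (fderiv ℝ Ψ z v) g (Ψ z) := by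
  have h1 := (hg.differentiable (by simp)).differentiableAt (x := Ψ z)
  have h2 := (hΨ.differentiable (by simp)).differentiableAt (x := z)
  have h3 : fderiv ℝ (g ∘ Ψ) z = _ := fderiv_comp z h1 h2
  change fderiv ℝ (g ∘ Ψ) z v = _
  rw [h3]
  rfl

lemma dirD_clm (v : E) (L : E →L[ℝ] ℝ) (z : E) : dirD v (fun z => L z) z = L v := by
  simp [dirD]

lemma iterD_add_right (L : List E) {g : E → ℝ} {v : E} (h : ∀ z, g (z + v) = g z) (z : E) :
    iterD L g (z + v) = iterD L g z := by
  induction L generalizing g with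
  | nil => exact h z
  | cons w L ih =>
    refine ih fun z => ?_
    have h1 : (fun z => g (z + v)) = g := funext h
    have h2 := fderiv_comp_add_right (𝕜 := ℝ) (f := g) (x := z) v
    rw [h1] at h2
    rw [dirD, dirD, h2]

variable [FiniteDimensional ℝ E]

variable (b k N a) in
/-- Critical families with prescribed linear components, invariant under a subspace of codimension
less than `N`, have small images. -/
def StraightGood : Prop :=
  ∀ (ι : Type) [Fintype ι] (X : Set T) (I : Finset ι) (P : T → E → ι → ℝ) (ℓ : ι → E →L[ℝ] ℝ)
    (e : ι → E) (V : Submodule ℝ E), I ≠ Finset.univ →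
    Module.finrank ℝ E < N + Module.finrank ℝ V → (∀ v ∈ V, ∀ x z, P x (z + v) = P x z) →
    Straight b k X a I P ℓ e → LipPos X a → Good b (fun x => P x (a x)) (k + Fintype.card ι - 1) X

lemma Straight.good_of_ker (H : Straight b (K + l) X a I P ℓ e) (ha : LipPos X a)
    (hI : I ≠ Finset.univ) {V : Submodule ℝ E}
    (hN : Module.finrank ℝ E < N + 1 + Module.finrank ℝ V)
    (hV : ∀ v ∈ V, ∀ x z, P x (z + v) = P x z) {h : T → E → ℝ} {w : E}
    (hh : ∀ x, ContDiff ℝ ∞ (h x)) (hhK : Cls b X a h K)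
    (h0 : ∀ x ∈ X, h x (a x) = 0) (h1 : ∀ x ∈ X, dirD w (h x) (a x) ≠ 0)
    (hhV : ∀ v ∈ V, ∀ x z, h x (z + v) = h x z) (hw : ∀ i ∈ I, ℓ i w = 0)
    (hPe : ∀ x ∈ X, ∀ i, dirD w (fun z => P x z i) =O[𝓝 (a x)] fun z => ‖z - a x‖ ^ l)
    (ih : StraightGood a b (K + l) N) : Good b (fun x => P x (a x)) (K + l + Fintype.card ι - 1) X := by
  rcases X.eq_empty_or_nonempty with rfl | ⟨x₀, hx₀⟩
  · exact Cov.empty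
  have hwV : w ∉ V := by
    intro hwV
    refine h1 x₀ hx₀ ?_
    have h2 : ∀ t : ℝ, h x₀ (a x₀ + t • w) = h x₀ (a x₀) := fun t =>
      hhV _ (V.smul_mem t hwV) x₀ _
    have h3 : HasDerivAt (fun t : ℝ => h x₀ (a x₀ + t • w)) (dirD w (h x₀) (a x₀)) 0 := by
      simpa using hasDerivAt_line (hh x₀) (a x₀) w 0
    simp only [h2] at h3
    exact h3.unique (hasDerivAt_const _ _)
  obtain ⟨φ, hφw, hφV⟩ := Submodule.exists_le_ker_of_notMem hwV
  set es : E →L[ℝ] ℝ := (φ w)⁻¹ • φ.toContinuousLinearMap with hes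
  have hes1 : es w = 1 := by simp [hes, hφw]
  have hesV : ∀ v ∈ V, es v = 0 := fun v hv => by
    have : φ v = 0 := hφV hv
    simp [hes, this]
  obtain ⟨Ψ, hΨ, hΨa, hΨw, hΨV, hΨL, -, hcov⟩ :=
    exists_straightening hes1 ha hh hhK h0 h1 H.smooth H.cls hPe
  refine hcov.bind fun S hS hcls => ?_
  have hgood : Good b (fun x => P x (Ψ x (a x))) (K + l + Fintype.card ι - 1) S := by
    refine ih ι S I (fun x z => P x (Ψ x z)) ℓ e (V ⊔ Submodule.span ℝ {w}) hI ?_ ?_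
      ⟨fun x i => (H.smooth x i).comp (hΨ x), hcls, ?_, H.dual, ?_⟩ (ha.mono hS)
    · have : V < V ⊔ Submodule.span ℝ {w} := by
        refine lt_of_le_of_ne le_sup_left fun h => hwV ?_
        rw [h]
        exact Submodule.mem_sup_right (Submodule.mem_span_singleton_self w)
      have := Submodule.finrank_lt_finrank_of_lt this
      omega
    · intro v hv x z
      obtain ⟨v₀, hv₀, v₁, hv₁, rfl⟩ := Submodule.mem_sup.1 hv
      obtain ⟨s, rfl⟩ := Submodule.mem_span_singleton.1 hv₁
      rw [← add_assoc, hΨw, hΨV x v₀ (hesV v₀ hv₀) (hhV v₀ hv₀ x), hV v₀ hv₀]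
    · intro x z i hi
      rw [H.eq x _ i hi, hΨL _ (hw i hi)]
    · intro x hx v hv i
      rw [dirD_comp (H.smooth x i) (hΨ x), hΨa x (hS hx)]
      refine H.crit x (hS hx) _ (fun i hi => ?_) i
      have h2 : (fun z => ℓ i (Ψ x z)) = fun z => ℓ i z := funext (hΨL _ (hw i hi) x)
      have h3 := dirD_comp (ℓ i).contDiff (hΨ x) v (a x)
      rw [h2, dirD_clm, dirD_clm, hv i hi] at h3
      exact h3.symm
  exact hgood.congr fun x hx => by simp only [hΨa x (hS hx)]

lemma Straight.good_of_dual (H : Straight b (K + l) X a I P ℓ e) (ha : LipPos X a)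
    (hI : I ≠ Finset.univ) (hK : K ≠ 0) (hl0 : l ≠ 0) {h : T → E → ℝ}
    (hh : ∀ x, ContDiff ℝ ∞ (h x)) (hhK : Cls b X a h K) {i₀ : ι} (hi₀ : i₀ ∈ I)
    (h0 : ∀ x ∈ X, h x (a x) = 0) (h1 : ∀ x ∈ X, dirD (e i₀) (h x) (a x) ≠ 0)
    {κ : Type} [Fintype κ] (B : Module.Basis κ ℝ E)
    (h2 : ∀ x ∈ X, ∀ j, dirD (kerProj I ℓ e (B j)) (h x) (a x) = 0)
    (hl : ∀ i j, PtO X a (fun x => dirD (kerProj I ℓ e (B j)) fun z => P x z i) l)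
    (ih : ∀ N, StraightGood a b K N) : Good b (fun x => P x (a x)) (K + l + Fintype.card ι - 1) X := by
  classical
  have hdual : ℓ i₀ (e i₀) = 1 := by simp [H.dual i₀ hi₀ i₀ hi₀]
  obtain ⟨Ψ, hΨ, hΨa, -, -, hΨL, hhΨ, hcov⟩ := exists_straightening (j := 0)
    (P := fun _ z (i : I) => ℓ i z) hdual ha hh hhK h0 h1 (fun x i => (ℓ i).contDiff)
    (fun i M => rel_zero.congr' (Eventually.of_forall fun t => (sub_self _).symm))
    (fun x hx i => by
      simp only [pow_zero]
      exact ((contDiff_dirD (ℓ i).contDiff (e i₀)).continuous.tendsto (a x)).isBigO_one ℝ)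
  refine hcov.bind fun S hS hcls => ?_
  have hgood : Good b (fun x (i : I) => ℓ i (Ψ x (a x))) (K + Fintype.card I - 1) S := by
    refine ih (Module.finrank ℝ E + 1) I S (Finset.univ.erase ⟨i₀, hi₀⟩) (fun x z i => ℓ i (Ψ x z))
      (fun i => ℓ i) (fun i => e i) ⊥ ?_ (by omega) ?_
      ⟨fun x i => (ℓ i).contDiff.comp (hΨ x), hcls, ?_, ?_, ?_⟩ (ha.mono hS)
    · intro h
      exact Finset.notMem_erase _ _ (h.symm ▸ Finset.mem_univ (⟨i₀, hi₀⟩ : I))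
    · intro v hv x z
      rw [(Submodule.mem_bot ℝ).1 hv, add_zero]
    · intro x z i hi
      have hne : (i : ι) ≠ i₀ := fun h => (Finset.mem_erase.1 hi).1 (Subtype.ext h)
      exact hΨL _ (by simp [H.dual i i.2 i₀ hi₀, hne]) x z
    · intro i hi l hl
      simp only [H.dual i i.2 l l.2, Subtype.ext_iff]
    · intro x hx v hv i
      set w := fderiv ℝ (Ψ x) (a x) v with hw
      have hcomp : ∀ i, dirD v (fun z => ℓ i (Ψ x z)) (a x) = ℓ i w := fun i => by
        rw [dirD_comp (ℓ i).contDiff (hΨ x), dirD_clm]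
      have hne : ∀ i ∈ I, i ≠ i₀ → ℓ i w = 0 := by
        intro i hi hii
        rw [← hcomp, show (fun z => ℓ i (Ψ x z)) = fun z => ℓ i z from
          funext (hΨL _ (by simp [H.dual i hi i₀ hi₀, hii]) x), dirD_clm]
        exact hv ⟨i, hi⟩ (by simpa [Subtype.ext_iff] using hii)
      rw [hcomp]
      by_cases hii : (i : ι) = i₀
      · have h3 : dirD w (h x) (a x) = 0 := by
          have h4 := ((hhΨ x (hS hx)).hasFDerivAt (𝕜 := ℝ) (by omega)).fderiv
          have h5 := dirD_comp (hh x) (hΨ x) v (a x)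
          rw [dirD, h4, hΨa x (hS hx)] at h5
          simpa using h5.symm
        have h4 : w = kerProj I ℓ e w + ℓ i₀ w • e i₀ := by
          rw [kerProj_apply, Finset.sum_eq_single i₀]
          · module
          · intro i hi hii
            rw [hne i hi hii, zero_smul]
          · exact fun h => absurd hi₀ h
        have h5 : dirD (kerProj I ℓ e w) (h x) (a x) = 0 := by
          rw [← B.sum_repr w]
          simp only [dirD, map_sum, map_smul]
          exact Finset.sum_eq_zero fun j _ => by
            have := h2 x (hS hx) j
            rw [dirD] at this
            rw [this, smul_zero]
        rw [h4, dirD_add, h5, dirD_smul, zero_add] at h3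
        rw [hii]
        exact (mul_eq_zero.1 h3).resolve_right (h1 x (hS hx))
      · exact hne i i.2 hii
  have hgood' : Good b (fun x (i : I) => ℓ i (a x)) (K + Fintype.card I - 1) S :=
    hgood.congr fun x hx => by simp only [hΨa x (hS hx)]
  refine Cov.mono hgood' fun S' hS' hq => ?_
  have hS'' := hS'.trans hS
  refine (H.mono hS'').quant_of_linear (ha.mono hS'') hl0 (by omega) hI ⟨i₀, hi₀⟩ B
    (fun i j => (hl i j).mono hS'') ?_
  convert hq using 2
  simp

lemma straightGood (hk : k ≠ 0) (N : ℕ) : StraightGood a b k N := by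
  induction k using Nat.strong_induction_on generalizing N with
  | _ k ihk =>
  induction N with
  | zero =>
    intro ι _ X I P ℓ e V hI hN
    exact absurd hN (by have := V.finrank_le; omega)
  | succ N ihN =>
  intro ι _ X I P ℓ e V hI hN hV H ha
  obtain ⟨κ, _, ⟨B⟩⟩ : ∃ (κ : Type) (_ : Fintype κ), Nonempty (Module.Basis κ ℝ E) :=
    ⟨_, inferInstance, ⟨Module.finBasis ℝ E⟩⟩
  set π := kerProj I ℓ e with hπ
  let g : List κ → ι → κ → T → E → ℝ := fun L i j x =>
    iterD (L.map B) (dirD (π (B j)) fun z => P x z i)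
  have hgs : ∀ L i j x, ContDiff ℝ ∞ (g L i j x) := fun L i j x =>
    contDiff_iterD _ (contDiff_dirD (H.smooth x i) _)
  have hg0 : ∀ i j, ∀ x ∈ X, g [] i j x (a x) = 0 := fun i j x hx =>
    H.crit x hx _ (fun i hi => H.apply_kerProj hi _) i
  let R : Option (List κ × ι × κ × (κ ⊕ ι)) → T → Prop
    | none, x => ∀ L : List κ, L.length < k → ∀ i j, g L i j x (a x) = 0
    | some (β, i, j, c), x => β.length + 1 < k ∧
        (∀ L : List κ, L.length ≤ β.length → ∀ i j, g L i j x (a x) = 0) ∧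
        match c with
        | .inl j' => dirD (π (B j')) (g β i j x) (a x) ≠ 0
        | .inr i₀ => i₀ ∈ I ∧ dirD (e i₀) (g β i j x) (a x) ≠ 0 ∧
            ∀ j', dirD (π (B j')) (g β i j x) (a x) = 0
  have hR : ∀ x ∈ X, ∃ c, R c x := by
    classical
    intro x hx
    by_cases hnone : R none x
    · exact ⟨none, hnone⟩
    have hex : ∃ n, n < k ∧ ∃ L : List κ, L.length = n ∧ ∃ i j, g L i j x (a x) ≠ 0 := by
      by_contra! h
      exact hnone fun L hL i j => h L.length hL L rfl i j
    obtain ⟨hn, L, hL, i, j, hne⟩ := Nat.find_spec hex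
    have hmin : ∀ L : List κ, L.length < Nat.find hex → ∀ i j, g L i j x (a x) = 0 := by
      intro L' hL' i j
      by_contra h
      exact Nat.find_min hex hL' ⟨hL'.trans hn, L', rfl, i, j, h⟩
    rcases List.eq_nil_or_concat' L with rfl | ⟨β, b₀, rfl⟩
    · exact absurd (hg0 i j x hx) hne
    rw [List.length_append, List.length_singleton] at hL
    have hmin' : ∀ L : List κ, L.length ≤ β.length → ∀ i j, g L i j x (a x) = 0 :=
      fun L hL => hmin L (by omega)
    have hne' : dirD (B b₀) (g β i j x) (a x) ≠ 0 := by
      have : g (β ++ [b₀]) i j x = dirD (B b₀) (g β i j x) := by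
        simp only [g, List.map_append, List.map_cons, List.map_nil]
        exact iterD_concat _ _ _
      rwa [this] at hne
    by_cases hj : ∃ j', dirD (π (B j')) (g β i j x) (a x) ≠ 0
    · obtain ⟨j', hj'⟩ := hj
      exact ⟨some (β, i, j, .inl j'), by omega, hmin', hj'⟩
    push Not at hj
    have h1 : ∃ i₀ ∈ I, dirD (e i₀) (g β i j x) (a x) ≠ 0 := by
      by_contra! h
      refine hne' ?_
      have h2 : B b₀ = π (B b₀) + ∑ i ∈ I, ℓ i (B b₀) • e i := by
        rw [hπ, kerProj_apply]
        module
      rw [h2, dirD_add, hj, zero_add]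
      simp only [dirD, map_sum, map_smul]
      exact Finset.sum_eq_zero fun i hi => by
        have := h i hi
        rw [dirD] at this
        rw [this, smul_zero]
    obtain ⟨i₀, hi₀, h2⟩ := h1
    exact ⟨some (β, i, j, .inr i₀), by omega, hmin', hi₀, h2, hj⟩
  refine (Cov.of_pointwise hR).bind fun S hS => ?_
  replace H := H.mono hS
  replace ha := ha.mono hS
  rintro ⟨_ | ⟨β, i, j, c⟩, hc⟩
  · have h1 : Cov S fun S' => ∀ i j, PtO S' a (fun x => dirD (π (B j)) fun z => P x z i) k := by
      refine Cov.forall (fun i S S' hS h j => (h j).mono hS) fun i =>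
        Cov.forall (fun j S S' hS h => h.mono hS) fun j => cov_ptO fun x hx => ?_
      exact isBigO_of_iterD_eq_zero B (a x) k (contDiff_dirD (H.smooth x i) _) fun L hL =>
        hc x hx L hL i j
    exact Cov.mono h1 fun S' hS' h => (H.mono hS').quant_of_maximal (ha.mono hS') hk hI B h
  have hX : ∀ i j, ∀ x ∈ S, dirD (π (B j)) (fun z => P x z i) =O[𝓝 (a x)]
      fun z => ‖z - a x‖ ^ (β.length + 1) := fun i j x hx =>
    isBigO_of_iterD_eq_zero B (a x) _ (contDiff_dirD (H.smooth x i) _) fun L hL =>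
      (hc x hx).2.1 L (by omega) i j
  rcases S.eq_empty_or_nonempty with rfl | ⟨x₀, hx₀⟩
  · exact Cov.empty
  obtain ⟨K, rfl⟩ : ∃ K, k = K + (β.length + 1) := ⟨k - (β.length + 1), by
    have := (hc x₀ hx₀).1
    omega⟩
  have hK : K ≠ 0 := by
    have := (hc x₀ hx₀).1
    omega
  have h0 : ∀ x ∈ S, g β i j x (a x) = 0 := fun x hx => (hc x hx).2.1 β le_rfl i j
  have hcls : Cov S fun S' => Cls b S' a (g β i j) K := by
    have h1 : Cov S fun S' => Cls b S' a (fun x => dirD (π (B j)) fun z => P x z i)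
        (K + β.length) := Cls.cov_dirD (fun x => H.smooth x i) ha (H.cls i) _
    refine h1.bind fun S' hS' h => ?_
    exact Cls.cov_iterD (fun x => contDiff_dirD (H.smooth x i) _) (ha.mono hS') (β.map B)
      (by simpa using h)
  refine hcls.bind fun S' hS' hcls => ?_
  replace H := H.mono hS'
  replace ha := ha.mono hS'
  rcases c with j' | i₀
  · refine H.good_of_ker ha hI hN hV (hgs β i j) hcls (fun x hx => h0 x (hS' hx))
      (fun x hx => (hc x (hS' hx)).2.2) (fun v hv x z => ?_)
      (fun i hi => H.apply_kerProj hi _) (fun x hx i => hX i j' x (hS' hx)) ihN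
    refine iterD_add_right _ (fun z => ?_) z
    exact iterD_add_right [π (B j)] (fun z => by rw [hV v hv]) z
  · have h1 : Cov S' fun S' => ∀ i j, PtO S' a (fun x => dirD (π (B j)) fun z => P x z i)
        (β.length + 1) :=
      Cov.forall (fun i S S' hS h j => (h j).mono hS) fun i =>
        Cov.forall (fun j S S' hS h => h.mono hS) fun j => cov_ptO fun x hx => hX i j x (hS' hx)
    refine h1.bind fun S'' hS'' hPtO => ?_
    rcases S''.eq_empty_or_nonempty with rfl | ⟨x₁, hx₁⟩
    · exact Cov.empty
    have hc' := fun x hx => hc x (hS' (hS'' hx))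
    exact (H.mono hS'').good_of_dual (ha.mono hS'') hI hK (by omega) (hgs β i j)
      (hcls.mono hS'') (hc' x₁ hx₁).2.2.1 (fun x hx => h0 x (hS' (hS'' hx)))
      (fun x hx => (hc' x hx).2.2.2.1) B (fun x hx => (hc' x hx).2.2.2.2) hPtO
      (ihk K (by omega) hK)

end StraightGood

/-! ### Critical families have small images -/

section CritGood

variable {T : Type} [MetricSpace T] {E : Type} [NormedAddCommGroup E] [NormedSpace ℝ E]
  {X S : Set T} {a : T → E} {b : Bool} {k : ℕ} {ι : Type} [Fintype ι] {I : Finset ι}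
  {P : T → E → ι → ℝ} {ℓ : ι → E →L[ℝ] ℝ} {e : ι → E} {u : T → E → ℝ}

open Classical in
/-- A family of maps to `ι → ℝ`, regular of order `k`, whose coordinates in `I` are linearly
independent linear forms `ℓ i`, and whose derivative at the base point is not surjective. -/
structure Critical (b : Bool) (k : ℕ) (X : Set T) (a : T → E) (I : Finset ι) (P : T → E → ι → ℝ)
    (ℓ : ι → E →L[ℝ] ℝ) (e : ι → E) : Prop where
  smooth : ∀ x i, ContDiff ℝ ∞ fun z => P x z i
  cls : ∀ i, Cls b X a (fun x z => P x z i) k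
  eq : ∀ x z, ∀ i ∈ I, P x z i = ℓ i z
  dual : ∀ i ∈ I, ∀ l ∈ I, ℓ i (e l) = if i = l then 1 else 0
  crit : ∀ x ∈ X, ¬ Function.Surjective fun v i => dirD v (fun z => P x z i) (a x)

lemma Critical.mono (H : Critical b k X a I P ℓ e) (hS : S ⊆ X) : Critical b k S a I P ℓ e :=
  ⟨H.smooth, fun i => (H.cls i).mono hS, H.eq, H.dual, fun x hx => H.crit x (hS hx)⟩

lemma Critical.ne_univ (H : Critical b k X a I P ℓ e) (hX : X.Nonempty) : I ≠ Finset.univ := by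
  rintro rfl
  obtain ⟨x, hx⟩ := hX
  refine H.crit x hx fun t => ⟨∑ l, t l • e l, funext fun i => ?_⟩
  have : (fun z => P x z i) = fun z => ℓ i z := funext fun z => H.eq x z i (Finset.mem_univ i)
  simp only [this, dirD_clm, map_sum, map_smul, H.dual i (Finset.mem_univ i) _ (Finset.mem_univ _)]
  rw [Finset.sum_eq_single i] <;> simp +contextual [eq_comm]

lemma Cls.prod (h : Cls b X a u k) (t : T → ℝ) :
    Cls b X (fun x => (t x, a x)) (fun x z => u x z.2) k := by
  intro M
  refine h.comp (φ := fun t : T × T × ℝ × E => (t.1, t.2.1, t.2.2.2))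
    (tendsto_nearBall_near _ _ M) (IsBigO.trans (IsBigO.of_bound 1 ?_) (isBigO_nearBall X _ M))
  refine Eventually.of_forall fun t => ?_
  rw [one_mul]
  exact norm_snd_le (t.2.2 - (_, a t.1))

lemma LipPos.cov_prod (ha : LipPos X a) (hk : k ≠ 0) (hu : ∀ x, ContDiff ℝ ∞ (u x))
    (h : Cls b X a u k) : Cov X fun S => LipPos S fun x => (u x (a x), a x) := by
  have h1 : Cov X fun S => PtO S a (fun x z => u x z - u x (a x)) 1 := cov_ptO fun x _ => by
    simpa using (((hu x).differentiable (by simp)).differentiableAt (x := a x)).isBigO_sub.norm_right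
  refine Cov.mono h1 fun S hS hP => ?_
  replace ha := ha.mono hS
  have hsymm : (fun p : T × T => a p.2 - a p.1) =O[near S] fun p => dist p.1 p.2 :=
    (IsBigO.neg_left ha).congr_left fun p => by simp
  have h2 := hP.comp (m := near S) (φ := fun p : T × T => (p.1, p.2, a p.2)) tendsto_id hsymm
  have h3 := ((h.mono hS).comp (m := near S) (φ := fun p : T × T => (p.1, p.2, a p.2))
    tendsto_id hsymm).isBigO.trans
      (isBigO_dist_pow (tendsto_dist_near S) (Nat.one_le_iff_ne_zero.2 hk))
  refine IsBigO.prod_left ?_ ha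
  simpa using h3.sub h2

lemma Critical.good_of_mem {X : Set T} [FiniteDimensional ℝ E] (H : Critical b k X a I P ℓ e)
    (ha : LipPos X a) (hk : k ≠ 0)
    {i₀ : ι} {w : E} (hw : ∀ i ∈ I, ℓ i w = 0)
    (h1 : ∀ x ∈ X, dirD w (fun z => P x z i₀) (a x) ≠ 0)
    (ih : i₀ ∉ I → ∀ (X : Set T) (a : T → ℝ × E) (I' : Finset ι) (P : T → ℝ × E → ι → ℝ)
      (ℓ : ι → ℝ × E →L[ℝ] ℝ) (e : ι → ℝ × E), I'.card = I.card + 1 → Critical b k X a I' P ℓ e →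
      LipPos X a → Good b (fun x => P x (a x)) (k + Fintype.card ι - 1) X) :
    Good b (fun x => P x (a x)) (k + Fintype.card ι - 1) X := by
  classical
  rcases X.eq_empty_or_nonempty with rfl | ⟨x₀, hx₀⟩
  · exact Cov.empty
  have hi₀ : i₀ ∉ I := by
    intro hi
    refine h1 x₀ hx₀ ?_
    have : (fun z => P x₀ z i₀) = fun z => ℓ i₀ z := funext fun z => H.eq x₀ z i₀ hi
    rw [this, dirD_clm, hw i₀ hi]
  have hw0 : w ∉ (⊥ : Submodule ℝ E) := by
    intro hw0
    rw [Submodule.mem_bot] at hw0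
    exact h1 x₀ hx₀ (by simp [dirD, hw0])
  obtain ⟨φ, hφw, -⟩ := Submodule.exists_le_ker_of_notMem hw0
  set es : ℝ × E →L[ℝ] ℝ :=
    ((φ w)⁻¹ • φ.toContinuousLinearMap).comp (ContinuousLinearMap.snd ℝ ℝ E) with hes
  have hes1 : es (0, w) = 1 := by simp [hes, hφw]
  refine (ha.cov_prod hk (fun x => H.smooth x i₀) (H.cls i₀)).bind fun S hS ha' => ?_
  replace H := H.mono hS
  replace h1 := fun x hx => h1 x (hS hx)
  set a' : T → ℝ × E := fun x => (P x (a x) i₀, a x) with ha'def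
  set Q : T → ℝ × E → ι → ℝ := fun x z i => if i = i₀ then z.1 else P x z.2 i with hQ
  have hQ0 : ∀ x, (fun z => Q x z i₀) = fun z => ContinuousLinearMap.fst ℝ ℝ E z := fun x => by
    ext z
    simp [hQ]
  have hQi : ∀ x, ∀ i ≠ i₀, (fun z => Q x z i) = fun z => P x z.2 i := fun x i hi => by
    ext z
    simp [hQ, hi]
  have hPs : ∀ x i, ContDiff ℝ ∞ fun z : ℝ × E => P x z.2 i := fun x i =>
    (H.smooth x i).comp contDiff_snd
  have hQs : ∀ x i, ContDiff ℝ ∞ fun z => Q x z i := fun x i => by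
    by_cases hi : i = i₀
    · rw [hi, hQ0]
      exact ContinuousLinearMap.contDiff _
    · rw [hQi x i hi]
      exact hPs x i
  have hQcls : ∀ i, Cls b S a' (fun x z => Q x z i) k := fun i => by
    by_cases hi : i = i₀
    · intro M
      refine rel_zero.congr' (Eventually.of_forall fun t => ?_)
      simp [hQ, hi]
    · have := (H.cls i).prod fun x => P x (a x) i₀
      convert this using 3
      simp [hQ, hi]
  have hPd : ∀ x i (v z : ℝ × E), dirD v (fun z : ℝ × E => P x z.2 i) z =
      dirD v.2 (fun z => P x z i) z.2 := fun x i v z => by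
    rw [dirD_comp (H.smooth x i) contDiff_snd, fderiv_snd]
    rfl
  set h : T → ℝ × E → ℝ := fun x z => P x z.2 i₀ - z.1 with hh
  have hhs : ∀ x, ContDiff ℝ ∞ (h x) := fun x => (hPs x i₀).sub contDiff_fst
  have hhd : ∀ x (v z : ℝ × E), dirD v (h x) z = dirD v.2 (fun z => P x z i₀) z.2 - v.1 := by
    intro x v z
    rw [← hPd x i₀ v z, dirD, dirD, hh, fderiv_fun_sub
      ((hPs x i₀).differentiable (by simp)).differentiableAt differentiableAt_fst, fderiv_fst]
    rfl
  have hhcls : Cls b S a' h k := fun M => by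
    refine ((H.cls i₀).prod (fun x => P x (a x) i₀) M).congr' (Eventually.of_forall fun t => ?_)
    simp only [hh]
    ring
  obtain ⟨Ψ, hΨ, hΨa, -, -, hΨL, hhΨ, hcov⟩ := exists_straightening (j := 0) hes1 ha' hhs hhcls
    (fun x _ => sub_self _) (fun x hx => by simpa [hhd] using h1 x hx) hQs hQcls
    (fun x hx i => by
      simp only [pow_zero]
      exact ((contDiff_dirD (hQs x i) (0, w)).continuous.tendsto (a' x)).isBigO_one ℝ)
  refine hcov.bind fun S' hS' hcls => ?_
  have hgood : Good b (fun x => Q x (Ψ x (a' x))) (k + Fintype.card ι - 1) S' := by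
    refine ih hi₀ S' a' (insert i₀ I) (fun x z => Q x (Ψ x z))
      (fun i => if i = i₀ then .fst ℝ ℝ E else (ℓ i).comp (.snd ℝ ℝ E))
      (fun i => if i = i₀ then (1, 0) else (0, e i)) (Finset.card_insert_of_notMem hi₀)
      ⟨fun x i => (hQs x i).comp (hΨ x), hcls, ?_, ?_, ?_⟩ (ha'.mono hS')
    · intro x z i hi
      by_cases hii : i = i₀
      · simp only [hQ, hii, if_true]
        exact hΨL (.fst ℝ ℝ E) rfl x z
      · have hiI : i ∈ I := (Finset.mem_insert.1 hi).resolve_left hii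
        simp only [hQ, hii, if_false]
        rw [H.eq x _ i hiI]
        exact hΨL ((ℓ i).comp (.snd ℝ ℝ E)) (hw i hiI) x z
    · intro i hi l hl
      rw [Finset.mem_insert] at hi hl
      by_cases hii : i = i₀ <;> by_cases hll : l = i₀
      · simp [hii, hll]
      · simp [hii, hll, Ne.symm hll]
      · simp [hii, hll]
      · simp [hii, hll, H.dual i (hi.resolve_left hii) l (hl.resolve_left hll)]
    · intro x hx hsurj
      refine H.crit x (hS' hx) fun t => ?_
      obtain ⟨v, hv⟩ := hsurj t
      set v' := fderiv ℝ (Ψ x) (a' x) v with hv'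
      have hd : ∀ i, dirD v' (fun z => Q x z i) (a' x) = t i := fun i => by
        rw [← hv]
        simp only
        rw [dirD_comp (hQs x i) (hΨ x), hΨa x (hS' hx)]
      have h3 : dirD v' (h x) (a' x) = 0 := by
        have h4 := ((hhΨ x (hS' hx)).hasFDerivAt (𝕜 := ℝ) (by omega)).fderiv
        have h5 := dirD_comp (hhs x) (hΨ x) v (a' x)
        rw [dirD, h4, hΨa x (hS' hx)] at h5
        simpa using h5.symm
      refine ⟨v'.2, funext fun i => ?_⟩
      rw [← hd i]
      by_cases hii : i = i₀
      · rw [hii, hQ0, dirD_clm]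
        rw [hhd, sub_eq_zero] at h3
        exact h3
      · rw [hQi x i hii, hPd]
  exact hgood.congr fun x hx => by
    ext i
    simp only [hΨa x (hS' hx)]
    by_cases hi : i = i₀ <;> simp [hQ, ha'def, hi]

theorem Critical.good_of_card {ι : Type} [Fintype ι] (hk : k ≠ 0) (N : ℕ) :
    ∀ (E : Type) [NormedAddCommGroup E] [NormedSpace ℝ E] [FiniteDimensional ℝ E] (X : Set T)
      (a : T → E) (I : Finset ι) (P : T → E → ι → ℝ) (ℓ : ι → E →L[ℝ] ℝ) (e : ι → E),
      Fintype.card ι ≤ I.card + N → Critical b k X a I P ℓ e → LipPos X a →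
        Good b (fun x => P x (a x)) (k + Fintype.card ι - 1) X := by
  induction N with
  | zero =>
    intro E _ _ _ X a I P ℓ e hN H ha
    rcases X.eq_empty_or_nonempty with rfl | hX
    · exact Cov.empty
    · exact absurd (Finset.card_eq_iff_eq_univ I |>.1 (le_antisymm (Finset.card_le_univ I) hN))
        (H.ne_univ hX)
  | succ N ih =>
  intro E _ _ _ X a I P ℓ e hN H ha
  obtain ⟨κ, _, ⟨B⟩⟩ : ∃ (κ : Type) (_ : Fintype κ), Nonempty (Module.Basis κ ℝ E) :=
    ⟨_, inferInstance, ⟨Module.finBasis ℝ E⟩⟩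
  have hker : ∀ w, ∀ i ∈ I, ℓ i (kerProj I ℓ e w) = 0 := fun w i hi => by
    rw [kerProj_apply, map_sub, map_sum, sub_eq_zero, Finset.sum_eq_single i]
    · simp [H.dual i hi i hi]
    · intro l hl hli
      simp [H.dual i hi l hl, hli.symm]
    · exact fun h => absurd hi h
  let R : Option (ι × κ) → T → Prop
    | none, x => ∀ i j, dirD (kerProj I ℓ e (B j)) (fun z => P x z i) (a x) = 0
    | some (i, j), x => dirD (kerProj I ℓ e (B j)) (fun z => P x z i) (a x) ≠ 0
  have hR : ∀ x ∈ X, ∃ c, R c x := by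
    intro x _
    by_cases h : ∀ i j, dirD (kerProj I ℓ e (B j)) (fun z => P x z i) (a x) = 0
    · exact ⟨none, h⟩
    · push Not at h
      obtain ⟨i, j, h⟩ := h
      exact ⟨some (i, j), h⟩
  refine (Cov.of_pointwise hR).bind fun S hS => ?_
  replace H := H.mono hS
  replace ha := ha.mono hS
  rintro ⟨_ | ⟨i, j⟩, hc⟩
  · rcases S.eq_empty_or_nonempty with rfl | hne
    · exact Cov.empty
    refine straightGood hk (Module.finrank ℝ E + 1) ι S I P ℓ e ⊥ (H.ne_univ hne) (by omega) ?_
      ⟨H.smooth, H.cls, H.eq, H.dual, fun x hx v hv i => ?_⟩ ha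
    · intro v hv x z
      rw [(Submodule.mem_bot ℝ).1 hv, add_zero]
    · have h1 : kerProj I ℓ e v = v := by
        rw [kerProj_apply, Finset.sum_eq_zero fun i hi => by rw [hv i hi, zero_smul], sub_zero]
      rw [← h1, ← B.sum_repr v]
      simp only [dirD, map_sum, map_smul]
      exact Finset.sum_eq_zero fun j _ => by
        have := hc x hx i j
        rw [dirD] at this
        rw [this, smul_zero]
  · exact H.good_of_mem ha hk (hker (B j)) hc fun hi X a I' P ℓ e hI' =>
      ih (ℝ × E) X a I' P ℓ e (by omega)

/-- A family of maps, regular of order `k`, with non-surjective derivatives at the base points, has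
small images. -/
theorem good_of_not_surjective [FiniteDimensional ℝ E] (hk : k ≠ 0)
    (hs : ∀ x i, ContDiff ℝ ∞ fun z => P x z i) (hP : ∀ i, Cls b X a (fun x z => P x z i) k)
    (hcrit : ∀ x ∈ X, ¬ Function.Surjective fun v i => dirD v (fun z => P x z i) (a x))
    (ha : LipPos X a) : Good b (fun x => P x (a x)) (k + Fintype.card ι - 1) X :=
  Critical.good_of_card hk (Fintype.card ι) E X a ∅ P 0 0 (by simp)
    ⟨hs, hP, by simp, by simp, hcrit⟩ ha

end CritGood

/-! ### Hausdorff measure and sets with small images -/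

section Covering

variable {T : Type} [MetricSpace T] [MeasurableSpace T] [BorelSpace T] {ι : Type} [Fintype ι]
  {F : T → ι → ℝ} {s : ℕ} {S X : Set T}

lemma SmallAt.mono {A : Set T} {c : ℝ} (h : SmallAt F s S c) (hA : A ⊆ S) : SmallAt F s A c := by
  obtain ⟨δ, hδ, h⟩ := h
  exact ⟨δ, hδ, fun ρ hρ B hB => h ρ hρ B (hB.trans hA)⟩

lemma SmallAt.volume_image_le [Nonempty ι] {c : ℝ} (h : SmallAt F s S c) (hc : 0 < c) :
    volume (F '' S) ≤ μH[s] S * ENNReal.ofReal c := by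
  obtain ⟨δ, hδ, h⟩ := h
  set A : ℕ → Set T := fun N => {x ∈ S | 1 / ((N : ℝ) + 1) < δ x} with hA
  have hmono : Monotone A := by
    intro N N' hN x hx
    refine ⟨hx.1, lt_of_le_of_lt ?_ hx.2⟩
    gcongr
  have hunion : F '' S = ⋃ N, F '' A N := by
    rw [← image_iUnion]
    congr 1
    refine subset_antisymm (fun x hx => mem_iUnion.2 ?_) (iUnion_subset fun N => sep_subset _ _)
    obtain ⟨N, hN⟩ := exists_nat_one_div_lt (hδ x)
    exact ⟨N, hx, hN⟩
  rw [hunion, Monotone.measure_iUnion fun N N' hN => image_mono (hmono hN)]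
  refine iSup_le fun N => ?_
  rw [← ENNReal.div_le_iff (by simpa using hc) ENNReal.ofReal_ne_top]
  refine le_of_forall_gt fun η hη => ?_
  set r : ENNReal := ENNReal.ofReal (1 / ((N : ℝ) + 1)) with hr
  have hr0 : 0 < r := ENNReal.ofReal_pos.2 (by positivity)
  rw [Measure.hausdorffMeasure_apply] at hη
  replace hη := (le_iSup₂ (f := fun r (_ : 0 < r) => _) r hr0).trans_lt hη
  simp only [iInf_lt_iff] at hη
  obtain ⟨t, hcov, hdiam, hsum⟩ := hη
  refine lt_of_le_of_lt ?_ hsum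
  rw [ENNReal.div_le_iff (by simpa using hc) ENNReal.ofReal_ne_top, ← ENNReal.tsum_mul_right]
  have hsub : F '' A N ⊆ ⋃ n, F '' (t n ∩ A N) := by
    rw [← image_iUnion, ← iUnion_inter]
    exact image_mono fun x hx => ⟨hcov hx.1, hx⟩
  refine (measure_mono hsub).trans ((measure_iUnion_le _).trans (ENNReal.tsum_le_tsum fun n => ?_))
  rcases eq_or_ne (ediam (t n)) 0 with h0 | h0
  · have : (F '' (t n ∩ A N)).Subsingleton :=
      ((ediam_eq_zero_iff.1 h0).anti inter_subset_left).image F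
    rw [this.measure_zero]
    exact zero_le
  have hne : (t n).Nonempty := by
    rw [nonempty_iff_ne_empty]
    rintro he
    exact h0 (by simp [he])
  have htop : ediam (t n) ≠ ⊤ := ((hdiam n).trans_lt ENNReal.ofReal_lt_top).ne
  have hd0 : 0 < diam (t n) := ENNReal.toReal_pos h0 htop
  have h1 := h (diam (t n)) hd0 (t n ∩ A N) (fun x hx => hx.2.1) (fun x hx => ?_)
    fun x hx y hy => dist_le_diam_of_mem' htop hx.1 hy.1
  · refine h1.trans_eq ?_
    rw [iSup_pos hne, mul_comm c, ENNReal.ofReal_mul (by positivity),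
      ENNReal.ofReal_pow hd0.le, diam, ENNReal.ofReal_toReal htop, ENNReal.rpow_natCast]
  · refine lt_of_le_of_lt ?_ hx.2.2
    exact ENNReal.toReal_le_of_le_ofReal (by positivity) (hdiam n)

lemma volume_image_eq_zero_of_cov {Q : Set T → Prop} (h : Cov X Q)
    (hQ : ∀ S ⊆ X, Q S → volume (F '' S) = 0) : volume (F '' X) = 0 := by
  obtain ⟨κ, _, S, hX, hS⟩ := h
  refine measure_mono_null (image_mono hX) ?_
  rw [image_iUnion, measure_iUnion_null_iff]
  exact fun i => hQ _ (hS i).1 (hS i).2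

lemma Good.volume_eq_zero_of_null [Nonempty ι] {b : Bool} (h : Good b F s X)
    (hX : μH[s] X = 0) : volume (F '' X) = 0 := by
  refine volume_image_eq_zero_of_cov h fun S hS hq => ?_
  obtain ⟨c, hc, h⟩ : ∃ c > 0, SmallAt F s S c := by
    cases b
    · simpa [Quant] using hq
    · exact ⟨1, one_pos, (show ∀ ε > 0, SmallAt F s S ε by simpa [Quant] using hq) 1 one_pos⟩
  simpa [measure_mono_null hS hX] using h.volume_image_le hc

lemma Good.volume_eq_zero_of_sigmaFinite [Nonempty ι] (h : Good true F s X)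
    {κ : Type} [Countable κ] {A : κ → Set T} (hX : X ⊆ ⋃ j, A j) (hA : ∀ j, μH[s] (A j) < ⊤) :
    volume (F '' X) = 0 := by
  refine volume_image_eq_zero_of_cov h fun S hS hq => ?_
  replace hq : ∀ ε > 0, SmallAt F s S ε := by simpa [Quant] using hq
  have hunion : F '' S ⊆ ⋃ j, F '' (S ∩ A j) := by
    rw [← image_iUnion, ← inter_iUnion]
    exact image_mono fun x hx => ⟨hx, hX (hS hx)⟩
  refine measure_mono_null hunion (measure_iUnion_null_iff.2 fun j => ?_)
  have htop : μH[s] (S ∩ A j) ≠ ⊤ := ((measure_mono inter_subset_right).trans_lt (hA j)).ne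
  refine le_antisymm (ENNReal.le_of_forall_pos_le_add fun ε hε _ => ?_) zero_le
  rw [zero_add]
  have hc : (0 : ℝ) < ε / ((μH[s] (S ∩ A j)).toReal + 1) := by positivity
  refine (((hq _ hc).mono inter_subset_left).volume_image_le hc).trans ?_
  rw [← ENNReal.ofReal_toReal htop, ← ENNReal.ofReal_mul ENNReal.toReal_nonneg,
    ← ENNReal.ofReal_coe_nnreal]
  refine ENNReal.ofReal_le_ofReal ?_
  rw [ENNReal.toReal_ofReal ENNReal.toReal_nonneg, mul_div_assoc', div_le_iff₀ (by positivity)]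
  nlinarith [ENNReal.toReal_nonneg (a := μH[s] (S ∩ A j)), ε.2, NNReal.coe_pos.2 hε]

end Covering

/-! ### Approximate differentiability and regular families -/

section Approx

variable {n m : ℕ} {x y z : Ec n} {A A' : Set (Ec n)}

lemma volume_ball_eq (x : Ec n) {r : ℝ} (hr : 0 < r) {R : ℝ} (hR : 0 < R) :
    volume (ball x (R * r)) = ENNReal.ofReal (R ^ n) * volume (ball (0 : Ec n) r) := by
  rw [Measure.addHaar_ball_of_pos _ _ (by positivity), Measure.addHaar_ball_of_pos _ _ hr,
    mul_pow, ENNReal.ofReal_mul (by positivity), mul_assoc]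
  simp

lemma apSmall_mono (h : apSmall x A') (hA : A ⊆ A') : apSmall x A :=
  tendsto_of_tendsto_of_tendsto_of_le_of_le tendsto_const_nhds h (fun _ => zero_le) fun r => by
    gcongr

lemma apSmall_union (h : apSmall x A) (h' : apSmall x A') : apSmall x (A ∪ A') := by
  refine tendsto_of_tendsto_of_tendsto_of_le_of_le tendsto_const_nhds
    (by simpa using Tendsto.add h h') (fun _ => zero_le) fun r => ?_
  rw [← ENNReal.add_div, union_inter_distrib_right]
  gcongr
  exact measure_union_le _ _

lemma apSmall_of_null (h : volume A = 0) : apSmall x A :=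
  tendsto_nhds_of_eventually_eq (Eventually.of_forall fun r => by
    rw [measure_mono_null inter_subset_left h, ENNReal.zero_div])

lemma exists_measure_le_of_apSmall (h : apSmall x A) {η : ℝ} (hη : 0 < η) :
    ∃ δ > 0, ∀ r, 0 < r → r < δ →
      volume (A ∩ ball x r) ≤ ENNReal.ofReal η * volume (ball x r) := by
  have h1 : ∀ᶠ r in 𝓝[>] (0 : ℝ), volume (A ∩ ball x r) / volume (ball x r) < ENNReal.ofReal η :=
    (tendsto_order.1 h).2 _ (ENNReal.ofReal_pos.2 hη)
  rw [eventually_nhdsWithin_iff, Metric.eventually_nhds_iff] at h1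
  obtain ⟨δ, hδ, h1⟩ := h1
  refine ⟨δ, hδ, fun r hr hrδ => ?_⟩
  have h2 := (h1 (by simpa [abs_of_pos hr] using hrδ) hr).le
  rwa [ENNReal.div_le_iff (measure_ball_pos volume x hr).ne' measure_ball_lt_top.ne] at h2

lemma volume_preimage_line_le (z : Ec n) {l : ℕ} (hl : l ≠ 0) (A : Set (Ec n)) :
    volume ((fun w : Ec n => z + (l : ℝ) • w) ⁻¹' A) ≤ volume A := by
  have h1 : (fun w : Ec n => z + (l : ℝ) • w) ⁻¹' A =
      (fun w : Ec n => (l : ℝ) • w) ⁻¹' ((fun w => z + w) ⁻¹' A) := rfl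
  rw [h1, Measure.addHaar_preimage_smul _ (by exact_mod_cast hl), measure_preimage_add]
  refine (mul_le_mul_left (ENNReal.ofReal_le_one.2 ?_) _).trans_eq (one_mul _)
  rw [abs_of_nonneg (by positivity)]
  exact inv_le_one_of_one_le₀ (one_le_pow₀ (by exact_mod_cast Nat.one_le_iff_ne_zero.2 hl))

lemma exists_forall_notMem_line {D : ℕ} {d R η : ℝ} (hd : 0 < d) (hR : 0 < R) (hη : 0 < η)
    (hη1 : 2 * (D + 1) * (η * R ^ n) < 1)
    (hA : volume (A ∩ ball x (R * d)) ≤ ENNReal.ofReal η * volume (ball x (R * d)))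
    (hA' : volume (A' ∩ ball y (R * d)) ≤ ENNReal.ofReal η * volume (ball y (R * d)))
    (hx : ‖z - x‖ + (D + 1) * d ≤ R * d) (hy : ‖z - y‖ + (D + 1) * d ≤ R * d) :
    ∃ w : Ec n, ‖w‖ < d ∧ ∀ l ∈ Finset.Icc 1 (D + 1), z + (l : ℝ) • w ∉ A ∧
      z + (l : ℝ) • w ∉ A' := by
  set φ : ℕ → Ec n → Ec n := fun l w => z + (l : ℝ) • w with hφ
  by_contra! hcon
  have hsub : ball (0 : Ec n) d ⊆ ⋃ l ∈ Finset.Icc 1 (D + 1),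
      (φ l ⁻¹' (A ∩ ball x (R * d)) ∪ φ l ⁻¹' (A' ∩ ball y (R * d))) := by
    intro w hw
    rw [mem_ball_zero_iff] at hw
    obtain ⟨l, hl, h⟩ := hcon w hw
    have hlD : (l : ℝ) ≤ D + 1 := by exact_mod_cast (Finset.mem_Icc.1 hl).2
    have hball : ∀ u, ‖z - u‖ + (D + 1) * d ≤ R * d → φ l w ∈ ball u (R * d) := by
      intro u hu
      rw [mem_ball_iff_norm]
      have h1 : (l : ℝ) * ‖w‖ < (D + 1) * d :=
        (mul_le_mul_of_nonneg_right hlD (norm_nonneg w)).trans_lt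
          (mul_lt_mul_of_pos_left hw (by positivity))
      calc ‖φ l w - u‖ = ‖(z - u) + (l : ℝ) • w‖ := by
            congr 1
            simp only [hφ]
            abel
        _ ≤ ‖z - u‖ + l * ‖w‖ := by
            refine (norm_add_le _ _).trans_eq ?_
            rw [norm_smul, Real.norm_natCast]
        _ < R * d := by linarith
    refine mem_iUnion₂.2 ⟨l, hl, ?_⟩
    by_cases hAl : φ l w ∈ A
    · exact Or.inl ⟨hAl, hball x hx⟩
    · exact Or.inr ⟨h hAl, hball y hy⟩
  have hpos : volume (ball (0 : Ec n) d) ≠ 0 := (measure_ball_pos volume _ hd).ne'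
  have hfin : volume (ball (0 : Ec n) d) ≠ ⊤ := measure_ball_lt_top.ne
  have hle : volume (ball (0 : Ec n) d) ≤
      ENNReal.ofReal (2 * (D + 1) * (η * R ^ n)) * volume (ball (0 : Ec n) d) := by
    refine (measure_mono hsub).trans ((measure_biUnion_finset_le _ _).trans ?_)
    have hterm : ∀ l ∈ Finset.Icc 1 (D + 1),
        volume (φ l ⁻¹' (A ∩ ball x (R * d)) ∪ φ l ⁻¹' (A' ∩ ball y (R * d))) ≤
          ENNReal.ofReal (2 * (η * R ^ n)) * volume (ball (0 : Ec n) d) := by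
      intro l hl
      have hl0 : l ≠ 0 := by
        have := (Finset.mem_Icc.1 hl).1
        omega
      have h1 := (volume_preimage_line_le z hl0 _).trans hA
      have h2 := (volume_preimage_line_le z hl0 _).trans hA'
      rw [volume_ball_eq _ hd hR, ← mul_assoc, ← ENNReal.ofReal_mul hη.le] at h1 h2
      refine (measure_union_le _ _).trans ((add_le_add h1 h2).trans_eq ?_)
      rw [two_mul, ENNReal.ofReal_add (by positivity) (by positivity), add_mul]
    refine (Finset.sum_le_sum hterm).trans_eq ?_
    rw [Finset.sum_const, Nat.card_Icc, nsmul_eq_mul, ← mul_assoc]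
    congr 1
    rw [show 2 * ((D : ℝ) + 1) * (η * R ^ n) = ((D + 1 : ℕ) : ℝ) * (2 * (η * R ^ n)) by
        push_cast; ring, ENNReal.ofReal_mul (p := ((D + 1 : ℕ) : ℝ)) (by positivity),
      ENNReal.ofReal_natCast]
    simp
  refine absurd hle (not_le.2 ?_)
  calc _ < 1 * volume (ball (0 : Ec n) d) :=
        ENNReal.mul_lt_mul_left hpos hfin (by simpa using hη1)
    _ = _ := one_mul _

/-- The set where `f` differs from `G` by at least `ε * ‖y - x‖ ^ k`. -/
def badSet (f : Ec n → Ec m) (G : Ec n → Ec m) (k : ℕ) (x : Ec n) (ε : ℝ) : Set (Ec n) :=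
  {y | y ≠ x ∧ ε * ‖y - x‖ ^ k ≤ ‖f y - G y‖}

lemma badSet_anti {f G : Ec n → Ec m} {k : ℕ} {ε ε' : ℝ} (h : ε ≤ ε') :
    badSet f G k x ε' ⊆ badSet f G k x ε := fun y hy =>
  ⟨hy.1, (mul_le_mul_of_nonneg_right h (by positivity)).trans hy.2⟩

/-- The restriction of `G` to every line is a polynomial of degree at most `D` in every
coordinate. -/
def LinePoly (D : ℕ) (G : Ec n → Ec m) : Prop :=
  ∀ z w : Ec n, ∀ c, ∃ p : Polynomial ℝ, p.natDegree ≤ D ∧ ∀ t : ℝ, G (z + t • w) c = p.eval t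

lemma exists_near_sub_le (hn : 0 < n) (f : Ec n → Ec m) {G : Ec n → Ec n → Ec m} {D : ℕ}
    (hG : ∀ x, LinePoly D (G x)) (k : ℕ) (M : ℝ) :
    ∃ C > 0, ∀ (S : Set (Ec n)) (ε : ℝ), 0 < ε → (∀ x ∈ S, apSmall x (badSet f (G x) k x ε)) →
      ∀ᶠ t in nearBall S id M, ∀ c, |G t.1 t.2.2 c - G t.2.1 t.2.2 c| ≤
        C * ε * dist t.1 t.2.1 ^ k := by
  classical
  have : Nonempty (Fin n) := ⟨⟨0, hn⟩⟩
  obtain ⟨C, hC, hCp⟩ := exists_coeff_le D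
  set R : ℝ := |M| + D + 2 with hR
  have hR0 : 0 < R := by positivity
  obtain ⟨η, hη, hη1⟩ : ∃ η : ℝ, 0 < η ∧ 2 * ((D : ℝ) + 1) * (η * R ^ n) < 1 := by
    refine ⟨1 / (4 * (D + 1) * R ^ n), by positivity, ?_⟩
    have : 2 * ((D : ℝ) + 1) * (1 / (4 * (D + 1) * R ^ n) * R ^ n) = 1 / 2 := by
      field_simp
      norm_num
    rw [this]
    norm_num
  refine ⟨C * (2 * R ^ k), by positivity, fun S ε hε hS => ?_⟩
  rw [eventually_nearBall]
  have h1 : ∀ x ∈ S, ∃ δ > 0, ∀ r, 0 < r → r < δ →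
      volume ((badSet f (G x) k x ε ∪ {x}) ∩ ball x r) ≤ ENNReal.ofReal η * volume (ball x r) :=
    fun x hx => exists_measure_le_of_apSmall
      (apSmall_union (hS x hx) (apSmall_of_null (measure_singleton x))) hη
  choose! δ hδ hδS using h1
  refine ⟨fun x => if x ∈ S then δ x / R else 1, fun x => ?_, fun x hx y hy hx1 hy1 z hz c => ?_⟩
  · dsimp only
    split_ifs with h
    · exact div_pos (hδ x h) hR0
    · exact one_pos
  simp only [hx, hy, if_true, lt_div_iff₀ hR0, id] at hx1 hy1 hz
  rcases eq_or_ne x y with rfl | hxy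
  · rw [sub_self, abs_zero]
    positivity
  set d := dist x y with hd
  have hd0 : 0 < d := dist_pos.2 hxy
  rw [mul_comm] at hx1 hy1
  have hz' : ‖z - x‖ ≤ |M| * d := hz.trans (by gcongr; exact le_abs_self M)
  have hzy : ‖z - y‖ ≤ |M| * d + d := by
    calc ‖z - y‖ = ‖(z - x) + (x - y)‖ := by rw [sub_add_sub_cancel]
      _ ≤ ‖z - x‖ + ‖x - y‖ := norm_add_le _ _
      _ ≤ _ := by
        rw [← dist_eq_norm x y]
        exact add_le_add_left hz' _
  have hRd : R * d = |M| * d + d + (D + 1) * d := by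
    rw [hR]
    ring
  obtain ⟨w, hw, hl⟩ := exists_forall_notMem_line hd0 hR0 hη hη1
    (hδS x hx _ (by positivity) hx1) (hδS y hy _ (by positivity) hy1)
    (z := z) (by rw [hRd]; linarith) (by rw [hRd]; linarith)
  obtain ⟨p, hp, hpt⟩ := hG x z w c
  obtain ⟨q, hq, hqt⟩ := hG y z w c
  have key := hCp (p - q) ((Polynomial.natDegree_sub_le _ _).trans (max_le hp hq)) 1
    (2 * (ε * (R * d) ^ k)) (fun l hl' => ?_) 0
  · rw [pow_zero, mul_one, Polynomial.coeff_zero_eq_eval_zero, Polynomial.eval_sub, ← hpt, ← hqt,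
      zero_smul, add_zero] at key
    refine key.trans_eq ?_
    rw [mul_pow]
    ring
  · have hlD : (l : ℝ) ≤ D + 1 := by exact_mod_cast (Finset.mem_Icc.1 hl').2
    have hball : ∀ u, ‖z - u‖ + (D + 1) * d ≤ R * d → ‖z + (l : ℝ) • w - u‖ ≤ R * d := by
      intro u hu
      calc ‖z + (l : ℝ) • w - u‖ = ‖(z - u) + (l : ℝ) • w‖ := by
            congr 1
            abel
        _ ≤ ‖z - u‖ + l * ‖w‖ := by
            refine (norm_add_le _ _).trans_eq ?_
            rw [norm_smul, Real.norm_natCast]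
        _ ≤ ‖z - u‖ + (D + 1) * d := by gcongr
        _ ≤ R * d := hu
    have hbad : ∀ u, z + (l : ℝ) • w ∉ badSet f (G u) k u ε ∪ {u} →
        ‖z - u‖ + (D + 1) * d ≤ R * d →
          |f (z + (l : ℝ) • w) c - G u (z + (l : ℝ) • w) c| ≤ ε * (R * d) ^ k := by
      intro u hu hu'
      simp only [badSet, mem_union, mem_singleton_iff, not_or] at hu
      have h2 : ‖f (z + (l : ℝ) • w) - G u (z + (l : ℝ) • w)‖ <
          ε * ‖z + (l : ℝ) • w - u‖ ^ k := by
        by_contra! h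
        exact hu.1 ⟨hu.2, h⟩
      refine (PiLp.norm_apply_le (f (z + (l : ℝ) • w) - G u (z + (l : ℝ) • w)) c).trans
        (h2.le.trans ?_)
      gcongr
      exact hball u hu'
    rw [mul_one, Polynomial.eval_sub, ← hpt, ← hqt]
    have h3 := hbad x (hl l hl').1 (by rw [hRd]; linarith)
    have h4 := hbad y (hl l hl').2 (by rw [hRd]; linarith)
    rw [abs_le] at h3 h4 ⊢
    constructor <;> linarith [h3.1, h3.2, h4.1, h4.2]

/-- Approximating polynomials form a regular family. -/
lemma cov_cls_of_apSmall (hn : 0 < n) (f : Ec n → Ec m) {G : Ec n → Ec n → Ec m} {D : ℕ}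
    (hG : ∀ x, LinePoly D (G x)) (k : ℕ) {b : Bool} {X : Set (Ec n)}
    (hX : ∀ x ∈ X, Quant b fun ε => apSmall x (badSet f (G x) k x ε)) :
    Cov X fun S => ∀ c, Cls b S id (fun x z => G x z c) k := by
  cases b
  · have h1 : ∀ x ∈ X, ∃ N : ℕ, apSmall x (badSet f (G x) k x (N + 1)) := by
      intro x hx
      obtain ⟨ε, -, h⟩ : ∃ ε > 0, apSmall x (badSet f (G x) k x ε) := by simpa [Quant] using hX x hx
      obtain ⟨N, hN⟩ := exists_nat_ge ε
      exact ⟨N, apSmall_mono h (badSet_anti (by linarith))⟩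
    refine Cov.mono (Cov.of_pointwise h1) fun S _ ⟨N, hS⟩ c M => ?_
    obtain ⟨C, hC, h⟩ := exists_near_sub_le hn f hG k M
    have : (fun t : Ec n × Ec n × Ec n => G t.1 t.2.2 c - G t.2.1 t.2.2 c) =O[nearBall S id M]
        fun t => dist t.1 t.2.1 ^ k := by
      refine IsBigO.of_bound (C * (N + 1)) ?_
      filter_upwards [h S (N + 1) (by positivity) hS] with t ht
      rw [Real.norm_eq_abs, Real.norm_of_nonneg (by positivity)]
      exact ht c
    simpa [Rel] using this
  · refine .of_self fun c M => ?_
    obtain ⟨C, hC, h⟩ := exists_near_sub_le hn f hG k M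
    have : (fun t : Ec n × Ec n × Ec n => G t.1 t.2.2 c - G t.2.1 t.2.2 c) =o[nearBall X id M]
        fun t => dist t.1 t.2.1 ^ k := by
      refine isLittleO_iff.2 fun ε hε => ?_
      filter_upwards [h X (ε / C) (by positivity) fun x hx =>
        (show ∀ ε > 0, apSmall x (badSet f (G x) k x ε) by simpa [Quant] using hX x hx) _
          (by positivity)] with t ht
      rw [Real.norm_eq_abs, Real.norm_of_nonneg (by positivity)]
      have := ht c
      rwa [mul_div_cancel₀ _ hC.ne'] at this
    simpa [Rel] using this

end Approx

/-! ### Taylor polynomials -/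

section Taylor

section Diagonal

variable {E : Type} [NormedAddCommGroup E] [NormedSpace ℝ E] {j : ℕ}

lemma diag_smul (q : ContinuousMultilinearMap ℝ (fun _ : Fin j => E) ℝ) (t : ℝ) (w : E) :
    q (fun _ => t • w) = t ^ j * q fun _ => w := by
  rw [q.map_smul_univ (fun _ => t) fun _ => w]
  simp

lemma contDiff_diag (q : ContinuousMultilinearMap ℝ (fun _ : Fin j => E) ℝ) (x : E) :
    ContDiff ℝ ∞ fun z => q fun _ => z - x :=
  q.contDiff.comp (contDiff_pi.2 fun _ => contDiff_id.sub contDiff_const)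

lemma exists_poly_diag (q : ContinuousMultilinearMap ℝ (fun _ : Fin j => E) ℝ) (a w : E) :
    ∃ P : Polynomial ℝ, P.natDegree ≤ j ∧ P.coeff j = q (fun _ => w) ∧
      ∀ t : ℝ, q (fun _ => a + t • w) = P.eval t := by
  refine ⟨∑ s : Finset (Fin j), Polynomial.C (q (s.piecewise (fun _ => w) fun _ => a)) *
    Polynomial.X ^ s.card, ?_, ?_, fun t => ?_⟩
  · refine Polynomial.natDegree_sum_le_of_forall_le _ _ fun s _ => ?_
    exact (Polynomial.natDegree_C_mul_X_pow_le _ _).trans (card_finset_fin_le s)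
  · rw [Polynomial.finsetSum_coeff, Finset.sum_eq_single Finset.univ]
    · simp
    · intro s _ hs
      have : s.card ≠ j := fun h => hs ((Finset.card_eq_iff_eq_univ s).1 (by simpa using h))
      rw [Polynomial.coeff_C_mul_X_pow, if_neg this.symm]
    · simp
  · have h1 : (fun _ : Fin j => a + t • w) = (fun _ => t • w) + fun _ => a := by
      ext
      simp [add_comm]
    rw [h1, q.map_add_univ, Polynomial.eval_finsetSum]
    refine Finset.sum_congr rfl fun s _ => ?_
    have h2 := q.map_piecewise_smul (fun _ => t) (s.piecewise (fun _ => w) fun _ => a) s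
    have h3 : s.piecewise (fun i => t • s.piecewise (fun _ => w) (fun _ => a) i)
        (s.piecewise (fun _ => w) fun _ => a) = s.piecewise (fun _ => t • w) fun _ => a := by
      ext i
      by_cases hi : i ∈ s <;> simp [hi]
    rw [h3] at h2
    rw [h2, Finset.prod_const, smul_eq_mul, Polynomial.eval_mul, Polynomial.eval_C,
      Polynomial.eval_pow, Polynomial.eval_X, mul_comm]

end Diagonal

variable {n m : ℕ} {f : Ec n → Ec m} {p : Ec n → FormalMultilinearSeries ℝ (Ec n) (Ec m)}

/-- A coordinate of the homogeneous terms of a Taylor series. -/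
def coord (p : Ec n → FormalMultilinearSeries ℝ (Ec n) (Ec m)) (c : Fin m) (x : Ec n) (j : ℕ) :
    ContinuousMultilinearMap ℝ (fun _ : Fin j => Ec n) ℝ :=
  (EuclideanSpace.proj c : Ec m →L[ℝ] ℝ).compContinuousMultilinearMap (p x j)

lemma taylorPoly_apply (i : ℕ) (x z : Ec n) (c : Fin m) : taylorPoly f p i x z c =
    f x c + ∑ j ∈ Finset.Icc 1 i, coord p c x j fun _ => z - x := by
  simp [taylorPoly, coord]

lemma taylorPoly_self (i : ℕ) (x : Ec n) : taylorPoly f p i x x = f x := by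
  ext c
  rw [taylorPoly_apply, Finset.sum_eq_zero, add_zero]
  intro j hj
  rw [sub_self, ← zero_smul ℝ (0 : Ec n), diag_smul,
    zero_pow (Nat.one_le_iff_ne_zero.1 (Finset.mem_Icc.1 hj).1), zero_mul]

lemma contDiff_taylorPoly (i : ℕ) (x : Ec n) (c : Fin m) :
    ContDiff ℝ ∞ fun z => taylorPoly f p i x z c := by
  simp only [taylorPoly_apply]
  exact contDiff_const.add (ContDiff.sum fun j _ => contDiff_diag _ x)

lemma exists_poly_taylorPoly (i : ℕ) (x z w : Ec n) (c : Fin m) :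
    ∃ P : Polynomial ℝ, P.natDegree ≤ i ∧ (i ≠ 0 → P.coeff i = coord p c x i fun _ => w) ∧
      ∀ t : ℝ, taylorPoly f p i x (z + t • w) c = P.eval t := by
  choose P hP hPc hPe using fun j => exists_poly_diag (coord p c x j) (z - x) w
  refine ⟨Polynomial.C (f x c) + ∑ j ∈ Finset.Icc 1 i, P j, ?_, fun hi => ?_, fun t => ?_⟩
  · refine (Polynomial.natDegree_add_le _ _).trans (max_le (by simp) ?_)
    exact Polynomial.natDegree_sum_le_of_forall_le _ _ fun j hj =>
      (hP j).trans (Finset.mem_Icc.1 hj).2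
  · rw [Polynomial.coeff_add, Polynomial.coeff_C_of_ne_zero hi, zero_add, Polynomial.finsetSum_coeff,
      Finset.sum_eq_single i, hPc]
    · intro j hj hji
      refine Polynomial.coeff_eq_zero_of_natDegree_lt ((hP j).trans_lt ?_)
      exact lt_of_le_of_ne (Finset.mem_Icc.1 hj).2 hji
    · intro h
      exact absurd (Finset.mem_Icc.2 ⟨Nat.one_le_iff_ne_zero.2 hi, le_rfl⟩) h
  · rw [taylorPoly_apply, Polynomial.eval_add, Polynomial.eval_C, Polynomial.eval_finsetSum]
    congr 1
    refine Finset.sum_congr rfl fun j _ => ?_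
    rw [← hPe j t]
    congr 1
    ext1
    abel

lemma linePoly_taylorPoly (i : ℕ) (x : Ec n) : LinePoly i (taylorPoly f p i x) := fun z w c =>
  (exists_poly_taylorPoly i x z w c).imp fun _ h => ⟨h.1, h.2.2⟩

lemma dirD_taylorPoly {i : ℕ} (hi : i ≠ 0) (x v : Ec n) (c : Fin m) :
    dirD v (fun z => taylorPoly f p i x z c) x = p x 1 (fun _ => v) c := by
  have h1 := hasDerivAt_line (contDiff_taylorPoly (f := f) (p := p) i x c) x v 0
  rw [zero_smul, add_zero] at h1
  have h2 : (fun t : ℝ => taylorPoly f p i x (x + t • v) c) =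
      fun t => f x c + ∑ j ∈ Finset.Icc 1 i, t ^ j * coord p c x j fun _ => v := by
    ext t
    rw [taylorPoly_apply]
    simp only [add_sub_cancel_left, diag_smul]
  rw [h2] at h1
  have h3 : HasDerivAt (fun t : ℝ => f x c + ∑ j ∈ Finset.Icc 1 i, t ^ j * coord p c x j fun _ => v)
      (∑ j ∈ Finset.Icc 1 i, (j : ℝ) * 0 ^ (j - 1) * coord p c x j fun _ => v) 0 :=
    (HasDerivAt.fun_sum fun j _ => (hasDerivAt_pow j (0 : ℝ)).mul_const _).const_add _
  rw [h1.unique h3, Finset.sum_eq_single 1]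
  · simp [coord]
  · intro j hj hj1
    have := (Finset.mem_Icc.1 hj).1
    rw [zero_pow (by omega), mul_zero, zero_mul]
  · intro h
    exact absurd (Finset.mem_Icc.2 ⟨le_rfl, Nat.one_le_iff_ne_zero.2 hi⟩) h

/-- Critical points with approximating polynomials have small images. -/
lemma good_of_apSmall (hn : 0 < n) {G : Ec n → Ec n → Ec m} {D k : ℕ} (hk : k ≠ 0)
    (hG : ∀ x, LinePoly D (G x)) (hs : ∀ x c, ContDiff ℝ ∞ fun z => G x z c) {b : Bool}
    {X : Set (Ec n)} (hX : ∀ x ∈ X, Quant b fun ε => apSmall x (badSet f (G x) k x ε))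
    (h0 : ∀ x ∈ X, G x x = f x)
    (hcrit : ∀ x ∈ X, ¬ Function.Surjective fun v c => dirD v (fun z => G x z c) x) :
    Good b (fun x c => f x c) (k + m - 1) X := by
  refine Cov.bind (cov_cls_of_apSmall hn f hG k hX) fun S hS h => ?_
  have h1 := good_of_not_surjective (P := fun x z c => G x z c) (a := id) hk hs h
    (fun x hx => hcrit x (hS hx)) (isBigO_of_le _ fun t => by simp [dist_eq_norm])
  rw [Fintype.card_fin] at h1
  exact h1.congr fun x hx => funext fun c => by simp [h0 x (hS hx)]

lemma not_surjective_dirD {x : Ec n} (hx : x ∈ approxCrit f p) {g : Ec n → Ec m}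
    (hg : ∀ v c, dirD v (fun z => g z c) x = p x 1 (fun _ => v) c) :
    ¬ Function.Surjective fun v c => dirD v (fun z => g z c) x := by
  refine fun h => hx.2 fun y => ?_
  obtain ⟨v, hv⟩ := h fun c => y c
  refine ⟨v, PiLp.ext fun c => ?_⟩
  rw [← hg, ← congrFun hv c]

end Taylor

/-! ### Families of polynomials whose leading part is differentiable -/

section Chain

lemma mul_pow_mul_sub_le {a b : ℝ} (hb : 0 ≤ b) (hab : b ≤ a) (D : ℕ) :
    (D + 1) * b ^ D * (a - b) ≤ a ^ (D + 1) - b ^ (D + 1) := by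
  induction D with
  | zero => simp
  | succ D ih =>
    have h1 : 0 ≤ (D + 1) * b ^ D * (a - b) := by
      have := sub_nonneg.2 hab
      positivity
    have h2 : b * ((D + 1) * b ^ D * (a - b)) ≤ a * (a ^ (D + 1) - b ^ (D + 1)) :=
      mul_le_mul hab ih h1 (hb.trans hab)
    push_cast
    calc ((D : ℝ) + 1 + 1) * b ^ (D + 1) * (a - b)
        = b * ((D + 1) * b ^ D * (a - b)) + b ^ (D + 1) * (a - b) := by ring
      _ ≤ a * (a ^ (D + 1) - b ^ (D + 1)) + b ^ (D + 1) * (a - b) := by linarith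
      _ = _ := by ring

lemma sub_le_mul_pow_mul {a b : ℝ} (hb : 0 ≤ b) (hab : b ≤ a) (D : ℕ) :
    a ^ (D + 1) - b ^ (D + 1) ≤ (D + 1) * a ^ D * (a - b) := by
  induction D with
  | zero => simp
  | succ D ih =>
    have h1 : b ^ (D + 1) * (a - b) ≤ a ^ (D + 1) * (a - b) :=
      mul_le_mul_of_nonneg_right (pow_le_pow_left₀ hb hab _) (sub_nonneg.2 hab)
    have h2 := mul_le_mul_of_nonneg_left ih (hb.trans hab)
    push_cast
    calc a ^ (D + 1 + 1) - b ^ (D + 1 + 1)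
        = a * (a ^ (D + 1) - b ^ (D + 1)) + b ^ (D + 1) * (a - b) := by ring
      _ ≤ a * ((D + 1) * a ^ D * (a - b)) + a ^ (D + 1) * (a - b) := by linarith
      _ = _ := by ring

/-- Riemann sums of a power. -/
lemma abs_riemann_sum_sub_le {D N : ℕ} (hD : D ≠ 0) {t : ℝ} (ht : 0 ≤ t) (hN : N * t = 1) :
    |∑ l ∈ Finset.range N, t * (1 - l * t) ^ D - 1 / (D + 1)| ≤ t := by
  set b : ℕ → ℝ := fun l => 1 - l * t with hb
  have hb0 : b 0 = 1 := by simp [hb]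
  have hbN : b N = 0 := by simp [hb, hN]
  have hsub : ∀ l, b l - b (l + 1) = t := fun l => by
    simp only [hb]
    push_cast
    ring
  have hpos : ∀ l ≤ N, 0 ≤ b l := fun l hl => by
    have : (l : ℝ) * t ≤ N * t := by gcongr
    simp only [hb]
    linarith
  have htel : ∑ l ∈ Finset.range N, (b l ^ (D + 1) - b (l + 1) ^ (D + 1)) = 1 := by
    rw [Finset.sum_range_sub', hb0, hbN]
    simp
  have hshift : ∑ l ∈ Finset.range N, t * b (l + 1) ^ D = ∑ l ∈ Finset.range N, t * b l ^ D - t := by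
    have h1 := Finset.sum_range_succ (fun l => t * b l ^ D) N
    have h2 := Finset.sum_range_succ' (fun l => t * b l ^ D) N
    rw [hbN, zero_pow hD, mul_zero, add_zero] at h1
    rw [hb0, one_pow, mul_one] at h2
    linarith
  have hle : (1 : ℝ) ≤ (D + 1) * ∑ l ∈ Finset.range N, t * b l ^ D := by
    refine htel.ge.trans ?_
    rw [Finset.mul_sum]
    refine Finset.sum_le_sum fun l hl => ?_
    have hl' := Finset.mem_range.1 hl
    have := sub_le_mul_pow_mul (a := b l) (hpos (l + 1) hl') (by linarith [hsub l]) D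
    rw [hsub] at this
    linarith
  have hge : (D + 1) * (∑ l ∈ Finset.range N, t * b l ^ D - t) ≤ 1 := by
    refine le_trans ?_ htel.le
    rw [← hshift, Finset.mul_sum]
    refine Finset.sum_le_sum fun l hl => ?_
    have hl' := Finset.mem_range.1 hl
    have := mul_pow_mul_sub_le (a := b l) (hpos (l + 1) hl') (by linarith [hsub l]) D
    rw [hsub] at this
    linarith
  have hD0 : (0 : ℝ) < D + 1 := by positivity
  have h1 : 1 / ((D : ℝ) + 1) ≤ ∑ l ∈ Finset.range N, t * b l ^ D := by
    rw [div_le_iff₀ hD0]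
    linarith
  have h2 : ∑ l ∈ Finset.range N, t * b l ^ D - t ≤ 1 / ((D : ℝ) + 1) := by
    rw [le_div_iff₀ hD0]
    linarith
  rw [abs_le]
  constructor <;> linarith

variable {E : Type} [NormedAddCommGroup E] [NormedSpace ℝ E] {S : Set E} {D : ℕ}
  {u Q : E → E → ℝ}

/-- The lower order terms of a regular family of polynomials vary slowly. -/
lemma exists_leading_bound {C r : ℝ} (hD : D ≠ 0)
    (hu : ∀ x z w, ∃ P : Polynomial ℝ, P.natDegree ≤ D ∧ P.coeff D = Q x w ∧
      ∀ t : ℝ, u x (z + t • w) = P.eval t)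
    (h : ∀ s ∈ S, ∀ s' ∈ S, dist s s' < r → ∀ z, ‖z - s‖ ≤ (D + 1) * dist s s' →
      |u s z - u s' z| ≤ C * dist s s' ^ (D + 1)) :
    ∃ K, 0 ≤ K ∧ ∀ s ∈ S, ∀ s' ∈ S, dist s s' < r → ∀ R > 0, ∀ w, ‖w‖ ≤ R →
      |Q s w - Q s' w| ≤ K * dist s s' * R ^ D ∧ (dist s s' ≤ R →
        |u s (s + w) - u s' (s + w) - (Q s w - Q s' w)| ≤ K * dist s s' ^ 2 * R ^ (D - 1)) := by
  obtain ⟨C₀, hC₀, hcoeff⟩ := exists_coeff_le D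
  refine ⟨(D + 1) * (C₀ * |C|), by positivity, fun s hs s' hs' hr R hR w hw => ?_⟩
  rcases eq_or_ne s s' with rfl | hne
  · simp
  set d := dist s s' with hd
  have hd0 : 0 < d := dist_pos.2 hne
  obtain ⟨P, hP, hPc, hPe⟩ := hu s s w
  obtain ⟨P', hP', hPc', hPe'⟩ := hu s' s w
  have hdeg : (P - P').natDegree ≤ D := (Polynomial.natDegree_sub_le _ _).trans (max_le hP hP')
  have key : ∀ i ≤ D, |(P - P').coeff i| ≤ C₀ * |C| * (d ^ (D + 1 - i) * R ^ i) := by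
    intro i hi
    have h1 := hcoeff (P - P') hdeg (d / R) (|C| * d ^ (D + 1)) (fun l hl => ?_) i
    · rw [abs_mul, abs_of_pos (pow_pos (div_pos hd0 hR) i), ← le_div_iff₀ (by positivity)] at h1
      refine h1.trans_eq ?_
      obtain ⟨j, hj⟩ := Nat.exists_eq_add_of_le (Nat.le_succ_of_le hi)
      rw [show D + 1 - i = j by omega, show D + 1 = i + j from hj, pow_add, div_pow]
      field_simp
    · rw [Polynomial.eval_sub, ← hPe, ← hPe']
      refine (h s hs s' hs' hr _ ?_).trans (by gcongr; exact le_abs_self C)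
      have hl' : (l : ℝ) ≤ D + 1 := by exact_mod_cast (Finset.mem_Icc.1 hl).2
      rw [add_sub_cancel_left, norm_smul, Real.norm_of_nonneg (by positivity)]
      calc (l : ℝ) * (d / R) * ‖w‖ ≤ (D + 1) * (d / R) * R := by gcongr
        _ = (D + 1) * d := by field_simp
  have hL : 0 ≤ C₀ * |C| := by positivity
  generalize C₀ * |C| = L at key hL ⊢
  have hK : L ≤ (D + 1) * L :=
    le_mul_of_one_le_left hL (by linarith [Nat.cast_nonneg (α := ℝ) D])
  constructor
  · have h1 := key D le_rfl
    rw [Polynomial.coeff_sub, hPc, hPc', Nat.add_sub_cancel_left, pow_one] at h1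
    refine h1.trans ?_
    rw [mul_assoc _ d]
    exact mul_le_mul_of_nonneg_right hK (by positivity)
  · intro hdR
    have h1 : u s (s + w) - u s' (s + w) - (Q s w - Q s' w) =
        ∑ i ∈ Finset.range D, (P - P').coeff i := by
      have h2 := hPe 1
      have h3 := hPe' 1
      rw [one_smul] at h2 h3
      rw [h2, h3, ← Polynomial.eval_sub, Polynomial.eval_eq_sum_range' (Nat.lt_succ_of_le hdeg),
        Finset.sum_range_succ, ← hPc, ← hPc', ← Polynomial.coeff_sub]
      simp
    rw [h1]
    refine (Finset.abs_sum_le_sum_abs _ _).trans ?_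
    have h2 : ∀ i ∈ Finset.range D, |(P - P').coeff i| ≤ L * (d ^ 2 * R ^ (D - 1)) := by
      intro i hi
      have hi' := Finset.mem_range.1 hi
      refine (key i hi'.le).trans ?_
      obtain ⟨j, hj⟩ := Nat.exists_eq_add_of_le (Nat.succ_le_of_lt hi')
      rw [show D + 1 - i = 2 + j by omega, show D - 1 = j + i by omega, pow_add, pow_add]
      calc L * (d ^ 2 * d ^ j * R ^ i) = L * d ^ 2 * R ^ i * d ^ j := by ring
        _ ≤ L * d ^ 2 * R ^ i * R ^ j := by gcongr
        _ = _ := by ring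
    refine (Finset.sum_le_sum h2).trans ?_
    rw [Finset.sum_const, Finset.card_range, nsmul_eq_mul]
    have h3 : 0 ≤ L * (d ^ 2 * R ^ (D - 1)) := by positivity
    calc D * (L * (d ^ 2 * R ^ (D - 1))) ≤ (D + 1) * (L * (d ^ 2 * R ^ (D - 1))) := by linarith
      _ = _ := by ring

/-- Integrating the derivative of the leading part along chains of points of `S`. -/
lemma exists_chain_estimate {x : E} (hx : x ∈ S) {H : E → E → ℝ} {K C r : ℝ} (hr : 0 < r)
    (hD : D ≠ 0) (hK : 0 ≤ K) (hC : 0 ≤ C)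
    (hu : ∀ s ∈ S, ∀ s' ∈ S, dist s s' < r → ∀ R > 0, ∀ w, ‖w‖ ≤ R → dist s s' ≤ R →
      |u s (s + w) - u s' (s + w) - (Q s w - Q s' w)| ≤ K * dist s s' ^ 2 * R ^ (D - 1))
    (hQ : ∀ ε > 0, ∃ δ > 0, ∀ s ∈ S, ‖s - x‖ < δ → ∀ w,
      |Q s w - Q x w - H (s - x) w| ≤ ε * ‖s - x‖ * ‖w‖ ^ D)
    (hH : ∀ R, ∀ v v' w w', ‖v‖ ≤ R → ‖v'‖ ≤ R → ‖w‖ ≤ R → ‖w'‖ ≤ R →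
      |H v w - H v' w'| ≤ C * R ^ D * (‖v - v'‖ + ‖w - w'‖))
    (hHsub : ∀ v v' w, H (v - v') w = H v w - H v' w)
    (hHsmul : ∀ (t t' : ℝ) v w, H (t • v) (t' • w) = t * t' ^ D * H v w)
    (hS : ∀ τ > 0, ∃ δ > 0, ∀ z, ‖z - x‖ < δ → ∃ s ∈ S, ‖s - z‖ ≤ τ * ‖z - x‖) :
    ∀ ε > 0, ∃ δ > 0, ∀ y ∈ S, ‖y - x‖ < δ →
      |u y y - u x y - 1 / (D + 1) * H (y - x) (y - x)| ≤ ε * ‖y - x‖ ^ (D + 1) := by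
  intro ε hε
  set A : ℝ := (K + 2 + C) * 3 ^ (D + 1) + 2 * C with hA
  have hA0 : 0 < A := by positivity
  obtain ⟨N, hN⟩ := exists_nat_gt (max 1 (A / ε))
  rw [max_lt_iff] at hN
  have hN0 : (0 : ℝ) < N := one_pos.trans hN.1
  set t : ℝ := 1 / N with ht
  have ht0 : 0 < t := by positivity
  have ht1 : t ≤ 1 := by
    rw [ht, div_le_one hN0]
    exact hN.1.le
  have hNt : N * t = 1 := by
    rw [ht]
    field_simp
  have htA : t * A ≤ ε := by
    rw [ht, one_div_mul_eq_div, div_le_iff₀ hN0]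
    rw [div_lt_iff₀ hε] at hN
    linarith [hN.2]
  obtain ⟨δ₁, hδ₁, hQ⟩ := hQ (t ^ 2) (by positivity)
  obtain ⟨δ₂, hδ₂, hS⟩ := hS (t ^ 2) (by positivity)
  refine ⟨min (min (δ₁ / 2) δ₂) (r / 4), by positivity, fun y hy hyx => ?_⟩
  simp only [lt_min_iff] at hyx
  obtain ⟨⟨hy1, hy2⟩, hy3⟩ := hyx
  set v := y - x with hv
  set d := ‖v‖ with hd
  have hd0 : 0 ≤ d := norm_nonneg v
  rcases hd0.eq_or_lt with hd0' | hdpos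
  · have : y = x := by rwa [← sub_eq_zero, ← hv, ← norm_eq_zero, eq_comm]
    have h0 := hHsmul 0 0 v v
    rw [← hd0', this, sub_self]
    have : v = 0 := by rw [hv, this, sub_self]
    simp only [this, smul_zero, zero_mul] at h0 ⊢
    rw [h0]
    simp
  have hpt : ∀ l : ℕ, ∃ s ∈ S, l ≤ N → ‖s - (x + (l * t) • v)‖ ≤ t ^ 2 * d ∧
      (l = 0 → s = x) ∧ (l = N → s = y) := by
    intro l
    by_cases hl0 : l = 0
    · refine ⟨x, hx, fun _ => ⟨?_, fun _ => rfl, fun h => ?_⟩⟩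
      · simp only [hl0, Nat.cast_zero, zero_mul, zero_smul, add_zero, sub_self, norm_zero]
        positivity
      · rw [← h, hl0] at hN0
        simp at hN0
    by_cases hlN : l = N
    · refine ⟨y, hy, fun _ => ⟨?_, fun h => absurd h hl0, fun _ => rfl⟩⟩
      rw [hlN, hNt, one_smul, hv, add_sub_cancel, sub_self, norm_zero]
      positivity
    by_cases hl : l ≤ N
    · have hlt : (l : ℝ) * t ≤ 1 := by
        rw [← hNt]
        gcongr
      have hz : ‖x + (l * t) • v - x‖ ≤ d := by
        rw [add_sub_cancel_left, norm_smul, Real.norm_of_nonneg (by positivity)]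
        exact mul_le_of_le_one_left hd0 hlt
      obtain ⟨s, hs, hsz⟩ := hS _ (hz.trans_lt hy2)
      exact ⟨s, hs, fun _ => ⟨hsz.trans (by gcongr), fun h => absurd h hl0, fun h => absurd h hlN⟩⟩
    · exact ⟨x, hx, fun h => absurd h hl⟩
  choose s hsS hs using hpt
  have hs0 : s 0 = x := (hs 0 (Nat.zero_le _)).2.1 rfl
  have hsN : s N = y := (hs N le_rfl).2.2 rfl
  have htd : t ^ 2 * d ≤ t * d := by
    gcongr
    nlinarith
  have htd' : t * d ≤ d := mul_le_of_le_one_left hd0 ht1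
  have hstep : ∀ l < N, |u (s (l + 1)) y - u (s l) y - t * (1 - l * t) ^ D * H v v| ≤
      (K + 2 + C) * t ^ 2 * (3 * d) ^ (D + 1) := by
    intro l hl
    have hlt : (l : ℝ) * t ≤ 1 := by
      rw [← hNt]
      gcongr
    have hlt0 : 0 ≤ (l : ℝ) * t := by positivity
    have e1 := (hs l hl.le).1
    have e2 := (hs (l + 1) hl).1
    set w := y - s l with hw
    set w' := y - s (l + 1) with hw'
    have hdist : ‖s (l + 1) - s l - t • v‖ ≤ 2 * (t ^ 2 * d) := by
      calc _ = ‖(s (l + 1) - (x + ((l + 1 : ℕ) * t) • v)) - (s l - (x + (l * t) • v))‖ := by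
            congr 1
            push_cast
            module
        _ ≤ _ := (norm_sub_le _ _).trans (by linarith)
    have htv : ‖t • v‖ = t * d := by rw [norm_smul, Real.norm_of_nonneg ht0.le]
    have hss : ‖s (l + 1) - s l‖ ≤ 3 * (t * d) := by
      calc _ = ‖(s (l + 1) - s l - t • v) + t • v‖ := by rw [sub_add_cancel]
        _ ≤ 2 * (t ^ 2 * d) + t * d := (norm_add_le _ _).trans (add_le_add hdist htv.le)
        _ ≤ _ := by linarith
    have hsx : ∀ j ≤ N, ‖s j - x‖ ≤ 2 * d := by
      intro j hj
      have hjt : (j : ℝ) * t ≤ 1 := by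
        rw [← hNt]
        gcongr
      calc _ = ‖(s j - (x + (j * t) • v)) + (j * t) • v‖ := by
            congr 1
            abel
        _ ≤ t ^ 2 * d + d := by
            refine (norm_add_le _ _).trans (add_le_add (hs j hj).1 ?_)
            rw [norm_smul, Real.norm_of_nonneg (by positivity)]
            exact mul_le_of_le_one_left hd0 hjt
        _ ≤ _ := by linarith
    have hwl : ‖w - (1 - l * t) • v‖ ≤ t ^ 2 * d := by
      calc _ = ‖s l - (x + (l * t) • v)‖ := by
            rw [← norm_neg, hw]
            congr 1
            rw [hv]
            module
        _ ≤ _ := e1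
    have hlv : ‖(1 - l * t) • v‖ ≤ d := by
      rw [norm_smul, Real.norm_of_nonneg (by linarith)]
      exact mul_le_of_le_one_left hd0 (by linarith)
    have hwn : ‖w‖ ≤ 2 * d := by
      calc _ = ‖(w - (1 - l * t) • v) + (1 - l * t) • v‖ := by rw [sub_add_cancel]
        _ ≤ t ^ 2 * d + d := (norm_add_le _ _).trans (add_le_add hwl hlv)
        _ ≤ _ := by linarith
    have hdss : dist (s l) (s (l + 1)) ≤ 3 * (t * d) := by
      rw [dist_comm, dist_eq_norm]
      exact hss
    have h1 : |u (s l) y - u (s (l + 1)) y - (Q (s l) w - Q (s (l + 1)) w)| ≤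
        K * t ^ 2 * (3 * d) ^ (D + 1) := by
      have h2 := hu (s l) (hsS l) (s (l + 1)) (hsS (l + 1)) (by linarith) (3 * d) (by positivity) w
        (by linarith) (by linarith)
      rw [hw, add_sub_cancel] at h2
      refine h2.trans ?_
      calc K * dist (s l) (s (l + 1)) ^ 2 * (3 * d) ^ (D - 1)
          ≤ K * (3 * (t * d)) ^ 2 * (3 * d) ^ (D - 1) := by gcongr
        _ = K * t ^ 2 * (3 * d) ^ (D - 1 + 2) := by ring
        _ = _ := by rw [show D - 1 + 2 = D + 1 by omega]
    have hQl : ∀ j ≤ N, |Q (s j) w - Q x w - H (s j - x) w| ≤ t ^ 2 * (3 * d) ^ (D + 1) := by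
      intro j hj
      refine (hQ (s j) (hsS j) ((hsx j hj).trans_lt (by linarith)) w).trans ?_
      calc t ^ 2 * ‖s j - x‖ * ‖w‖ ^ D ≤ t ^ 2 * (3 * d) * (3 * d) ^ D := by
            gcongr
            · exact (hsx j hj).trans (by linarith)
            · linarith
        _ = _ := by ring
    have h3 : |H (s (l + 1) - s l) w - H (t • v) ((1 - l * t) • v)| ≤
        C * t ^ 2 * (3 * d) ^ (D + 1) := by
      refine (hH (3 * d) _ _ _ _ (by linarith) (by linarith) (by linarith) (by linarith)).trans ?_
      calc C * (3 * d) ^ D * (‖s (l + 1) - s l - t • v‖ + ‖w - (1 - l * t) • v‖)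
          ≤ C * (3 * d) ^ D * (2 * (t ^ 2 * d) + t ^ 2 * d) := by gcongr
        _ = _ := by ring
    rw [hHsmul] at h3
    have h4 : H (s (l + 1) - s l) w = H (s (l + 1) - x) w - H (s l - x) w := by
      rw [← hHsub, sub_sub_sub_cancel_right]
    have h5 := hQl l hl.le
    have h6 := hQl (l + 1) hl
    rw [h4] at h3
    rw [show (K + 2 + C) * t ^ 2 * (3 * d) ^ (D + 1) = K * t ^ 2 * (3 * d) ^ (D + 1) +
      2 * (t ^ 2 * (3 * d) ^ (D + 1)) + C * t ^ 2 * (3 * d) ^ (D + 1) by ring]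
    generalize K * t ^ 2 * (3 * d) ^ (D + 1) = z₁ at h1 ⊢
    generalize C * t ^ 2 * (3 * d) ^ (D + 1) = z₂ at h3 ⊢
    generalize t ^ 2 * (3 * d) ^ (D + 1) = z₃ at h5 h6 ⊢
    generalize t * (1 - l * t) ^ D * H v v = z₄ at h3 ⊢
    rw [abs_le] at h1 h3 h5 h6 ⊢
    constructor <;> linarith [h1.1, h1.2, h3.1, h3.2, h5.1, h5.2, h6.1, h6.2]
  have hHv : |H v v| ≤ 2 * C * d ^ (D + 1) := by
    have h1 := hH d v 0 v 0 le_rfl (by simpa using hd0) le_rfl (by simpa using hd0)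
    have h2 := hHsmul 0 0 v v
    rw [zero_smul, zero_mul, zero_mul] at h2
    rw [h2, sub_zero, sub_zero] at h1
    exact h1.trans_eq (by ring)
  have hsum : u y y - u x y - ∑ l ∈ Finset.range N, t * (1 - l * t) ^ D * H v v =
      ∑ l ∈ Finset.range N, (u (s (l + 1)) y - u (s l) y - t * (1 - l * t) ^ D * H v v) := by
    rw [Finset.sum_sub_distrib, Finset.sum_range_sub (fun l => u (s l) y), hs0, hsN]
  have h1 : |u y y - u x y - ∑ l ∈ Finset.range N, t * (1 - l * t) ^ D * H v v| ≤
      (K + 2 + C) * t * (3 * d) ^ (D + 1) := by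
    rw [hsum]
    refine (Finset.abs_sum_le_sum_abs _ _).trans
      ((Finset.sum_le_sum fun l hl => hstep l (Finset.mem_range.1 hl)).trans_eq ?_)
    rw [Finset.sum_const, Finset.card_range, nsmul_eq_mul]
    calc _ = N * t * ((K + 2 + C) * t * (3 * d) ^ (D + 1)) := by ring
      _ = _ := by rw [hNt, one_mul]
  have h2 : |(∑ l ∈ Finset.range N, t * (1 - l * t) ^ D - 1 / (D + 1)) * H v v| ≤
      t * (2 * C * d ^ (D + 1)) := by
    rw [abs_mul]
    exact mul_le_mul (abs_riemann_sum_sub_le hD ht0.le hNt) hHv (abs_nonneg _) ht0.le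
  rw [sub_mul, Finset.sum_mul] at h2
  have h3 : (K + 2 + C) * t * (3 * d) ^ (D + 1) + t * (2 * C * d ^ (D + 1)) ≤
      ε * d ^ (D + 1) := by
    calc _ = t * A * d ^ (D + 1) := by
          rw [hA, mul_pow]
          ring
      _ ≤ _ := by gcongr
  refine le_trans ?_ h3
  refine le_trans ?_ (add_le_add h1 h2)
  refine le_trans (le_of_eq ?_) (abs_add_le _ _)
  congr 1
  ring

end Chain

/-! ### Density points -/

section Density

variable {n : ℕ} {S : Set (Ec n)} {x : Ec n}

/-- `x` is a Lebesgue density point of `S`. -/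
def DensityPt (S : Set (Ec n)) (x : Ec n) : Prop :=
  Tendsto (fun r => volume (S ∩ closedBall x r) / volume (closedBall x r)) (𝓝[>] 0) (𝓝 1)

lemma volume_closedBall_eq_volume_ball (x : Ec n) {r : ℝ} (hr : 0 < r) :
    volume (closedBall x r) = volume (ball x r) := by
  rw [Measure.addHaar_closedBall _ _ hr.le, Measure.addHaar_ball_of_pos _ _ hr]

lemma ae_densityPt (S : Set (Ec n)) : ∀ᵐ x, x ∈ S → DensityPt S x :=
  ae_imp_of_ae_restrict (Besicovitch.ae_tendsto_measure_inter_div volume S)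

lemma DensityPt.exists_norm_sub_le (h : DensityPt S x) (hx : x ∈ S) {τ : ℝ} (hτ : 0 < τ) :
    ∃ δ > 0, ∀ z, ‖z - x‖ < δ → ∃ s ∈ S, ‖s - z‖ ≤ τ * ‖z - x‖ := by
  set κ : ENNReal := ENNReal.ofReal ((τ / (1 + τ)) ^ n) with hκ
  have hκ0 : κ ≠ 0 := (ENNReal.ofReal_pos.2 (by positivity)).ne'
  have h1 : ∀ᶠ r in 𝓝[>] (0 : ℝ), 1 - κ < volume (S ∩ closedBall x r) / volume (closedBall x r) :=
    (tendsto_order.1 h).1 _ (ENNReal.sub_lt_self ENNReal.one_ne_top one_ne_zero hκ0)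
  rw [eventually_nhdsWithin_iff, Metric.eventually_nhds_iff] at h1
  obtain ⟨δ, hδ, h1⟩ := h1
  refine ⟨δ / (1 + τ), by positivity, fun z hz => ?_⟩
  rcases eq_or_ne z x with rfl | hne
  · exact ⟨z, hx, by simp⟩
  by_contra! hcon
  set d := ‖z - x‖ with hd
  have hd0 : 0 < d := norm_pos_iff.2 (sub_ne_zero.2 hne)
  rw [lt_div_iff₀ (by positivity)] at hz
  have hr0 : 0 < d * (1 + τ) := by positivity
  have h2 := h1 (y := d * (1 + τ)) (by rwa [Real.dist_eq, sub_zero, abs_of_pos hr0]) hr0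
  refine h2.not_ge (ENNReal.le_sub_of_add_le_right ENNReal.ofReal_ne_top ?_)
  have hpos : volume (closedBall x (d * (1 + τ))) ≠ 0 := (measure_closedBall_pos volume x hr0).ne'
  have hfin : volume (closedBall x (d * (1 + τ))) ≠ ⊤ := measure_closedBall_lt_top.ne
  have hball : volume (ball z (τ * d)) = κ * volume (closedBall x (d * (1 + τ))) := by
    rw [volume_closedBall_eq_volume_ball x hr0]
    have h3 := volume_ball_eq z hr0 (R := τ / (1 + τ)) (by positivity)
    have h4 := volume_ball_eq x hr0 (R := 1) one_pos
    rw [one_mul, one_pow, ENNReal.ofReal_one, one_mul] at h4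
    rw [h4, ← h3]
    congr 2
    field_simp
  have hkey : volume (S ∩ closedBall x (d * (1 + τ))) + volume (ball z (τ * d)) ≤
      volume (closedBall x (d * (1 + τ))) := by
    rw [← measure_union _ measurableSet_ball]
    · refine measure_mono (union_subset inter_subset_right fun y hy => ?_)
      rw [mem_ball_iff_norm] at hy
      rw [mem_closedBall_iff_norm]
      calc ‖y - x‖ = ‖(y - z) + (z - x)‖ := by rw [sub_add_sub_cancel]
        _ ≤ τ * d + d := (norm_add_le _ _).trans (by linarith)
        _ = _ := by ring
    · rw [Set.disjoint_left]
      intro y hy hy'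
      rw [mem_ball_iff_norm] at hy'
      exact (hcon y hy.1).not_gt hy'
  rw [hball] at hkey
  rw [← ENNReal.div_self hpos hfin]
  refine le_trans (le_of_eq ?_) (ENNReal.div_le_div_right hkey _)
  rw [ENNReal.add_div, mul_div_assoc, ENNReal.div_self hpos hfin, mul_one]

lemma DensityPt.apSmall (h : DensityPt S x) {A : Set (Ec n)} (hA : MeasurableSet A)
    (hAS : ∃ δ > 0, ∀ y ∈ S, ‖y - x‖ < δ → y ∉ A) : _root_.apSmall x A := by
  obtain ⟨δ, hδ, hAS⟩ := hAS
  have h1 : Tendsto (fun r => 1 - volume (S ∩ closedBall x r) / volume (closedBall x r))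
      (𝓝[>] 0) (𝓝 0) := by
    simpa using ENNReal.Tendsto.sub (tendsto_const_nhds (x := (1 : ENNReal))) h
      (Or.inl ENNReal.one_ne_top)
  refine tendsto_of_tendsto_of_tendsto_of_le_of_le' tendsto_const_nhds h1
    (Eventually.of_forall fun _ => zero_le) ?_
  filter_upwards [Ioo_mem_nhdsGT hδ] with r hr
  have hpos : volume (closedBall x r) ≠ 0 := (measure_closedBall_pos volume x hr.1).ne'
  have hfin : volume (closedBall x r) ≠ ⊤ := measure_closedBall_lt_top.ne
  have hkey : volume (A ∩ ball x r) + volume (S ∩ closedBall x r) ≤ volume (closedBall x r) := by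
    rw [← measure_union' _ (hA.inter measurableSet_ball)]
    · exact measure_mono (union_subset (inter_subset_right.trans ball_subset_closedBall)
        inter_subset_right)
    · rw [Set.disjoint_left]
      intro y hy hy'
      refine hAS y hy'.1 ?_ hy.1
      rw [← mem_ball_iff_norm]
      exact ball_subset_ball hr.2.le hy.2
  have h3 : volume (S ∩ closedBall x r) / volume (closedBall x r) ≠ ⊤ :=
    (ENNReal.div_lt_top ((measure_mono inter_subset_right).trans_lt
      measure_closedBall_lt_top).ne hpos).ne
  refine ENNReal.le_sub_of_add_le_right h3 ?_
  rw [← volume_closedBall_eq_volume_ball x hr.1, ← ENNReal.add_div, ← ENNReal.div_self hpos hfin]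
  exact ENNReal.div_le_div_right hkey _

end Density

/-! ### Interpolation of homogeneous polynomials -/

section Interpolation

variable {E : Type} [NormedAddCommGroup E] [NormedSpace ℝ E]

/-- Homogeneous polynomials of degree `j` are determined by finitely many values. -/
lemma exists_interpolation [FiniteDimensional ℝ E] (j : ℕ) :
    ∃ (ι : Type) (_ : Fintype ι) (w : ι → E)
      (b : ι → ContinuousMultilinearMap ℝ (fun _ : Fin j => E) ℝ),
      ∀ (q : ContinuousMultilinearMap ℝ (fun _ : Fin j => E) ℝ) (v : E),
        q (fun _ => v) = ∑ i, q (fun _ => w i) * b i fun _ => v := by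
  classical
  set V := ContinuousMultilinearMap ℝ (fun _ : Fin j => E) ℝ with hV
  have : FiniteDimensional ℝ V := FiniteDimensional.of_injective
    (ContinuousMultilinearMap.toMultilinearMapLinear :
      V →ₗ[ℝ] MultilinearMap ℝ (fun _ : Fin j => E) ℝ) ContinuousMultilinearMap.toMultilinearMap_injective
  set ev : E → Module.Dual ℝ V := fun v =>
    { toFun := fun q => q fun _ => v
      map_add' := fun _ _ => rfl
      map_smul' := fun _ _ => rfl } with hev
  obtain ⟨s, hs, hspan⟩ := (Submodule.fg_span_iff_fg_span_finset_subset (range ev)).1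
    (IsNoetherian.noetherian (Submodule.span ℝ (range ev)))
  choose w hw using fun i : s => hs i.2
  set A : V →ₗ[ℝ] (s → ℝ) := LinearMap.pi fun i => ev (w i) with hA
  obtain ⟨g, hg⟩ := LinearMap.exists_rightInverse_of_surjective A.rangeRestrict
    A.range_rangeRestrict
  obtain ⟨B, hB⟩ := LinearMap.exists_extend g
  refine ⟨s, inferInstance, w, fun i => B (Pi.single i 1), fun q v => ?_⟩
  have h1 : A (B (A q)) = A q := by
    have h2 : B (A q) = g (A.rangeRestrict q) := by
      rw [← hB]
      rfl
    rw [h2]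
    exact congrArg Subtype.val (LinearMap.congr_fun hg (A.rangeRestrict q))
  have h2 : ∀ φ ∈ Submodule.span ℝ (range ev), φ (B (A q)) = φ q := by
    rw [hspan]
    intro φ hφ
    induction hφ using Submodule.span_induction with
    | mem φ hφ =>
      have := congrFun h1 ⟨φ, hφ⟩
      exact (LinearMap.congr_fun (hw ⟨φ, hφ⟩) _).symm.trans
        (this.trans (LinearMap.congr_fun (hw ⟨φ, hφ⟩) _))
    | zero => rfl
    | add φ ψ _ _ h h' => rw [LinearMap.add_apply, LinearMap.add_apply, h, h']
    | smul a φ _ h => rw [LinearMap.smul_apply, LinearMap.smul_apply, h]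
  have h3 : A q = ∑ i, A q i • Pi.single (M := fun _ => ℝ) i 1 := by
    ext i
    simp [Finset.sum_apply, Pi.single_apply]
  have h4 := h2 (ev v) (Submodule.subset_span ⟨v, rfl⟩)
  rw [h3, map_sum, map_sum] at h4
  refine Eq.trans h4.symm (Finset.sum_congr rfl fun i _ => ?_)
  rw [map_smul, map_smul]
  rfl

end Interpolation

/-! ### Approximate Taylor polynomials of one order higher -/

section HigherOrder

section Family

variable {E : Type} [NormedAddCommGroup E] [NormedSpace ℝ E] {D : ℕ}

lemma abs_diag_le (b : ContinuousMultilinearMap ℝ (fun _ : Fin D => E) ℝ) {R : ℝ} {w : E}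
    (hw : ‖w‖ ≤ R) : |b fun _ => w| ≤ ‖b‖ * R ^ D := by
  exact b.le_opNorm_mul_pow_of_le (m := fun _ => w) ((pi_norm_const_le w).trans hw)

lemma abs_diag_sub_le (b : ContinuousMultilinearMap ℝ (fun _ : Fin D => E) ℝ) {R : ℝ} {w w' : E}
    (hw : ‖w‖ ≤ R) (hw' : ‖w'‖ ≤ R) :
    |b (fun _ => w) - b fun _ => w'| ≤ ‖b‖ * D * R ^ (D - 1) * ‖w - w'‖ := by
  have h := b.norm_image_sub_le (fun _ => w) fun _ => w'
  rw [Fintype.card_fin] at h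
  refine h.trans ?_
  have h1 : ‖(fun _ : Fin D => w) - fun _ => w'‖ ≤ ‖w - w'‖ := pi_norm_const_le (w - w')
  have h2 : max ‖fun _ : Fin D => w‖ ‖fun _ : Fin D => w'‖ ≤ R :=
    max_le ((pi_norm_const_le w).trans hw) ((pi_norm_const_le w').trans hw')
  have hR : 0 ≤ R := (norm_nonneg _).trans hw
  gcongr

lemma abs_mul_diag_sub_le (hD : D ≠ 0) (L : E →L[ℝ] ℝ)
    (b : ContinuousMultilinearMap ℝ (fun _ : Fin D => E) ℝ) {R : ℝ} {v v' w w' : E}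
    (hv' : ‖v'‖ ≤ R) (hw : ‖w‖ ≤ R) (hw' : ‖w'‖ ≤ R) :
    |L v * b (fun _ => w) - L v' * b fun _ => w'| ≤
      ‖L‖ * ‖b‖ * D * R ^ D * (‖v - v'‖ + ‖w - w'‖) := by
  have hR : 0 ≤ R := (norm_nonneg _).trans hw
  have hD1 : (1 : ℝ) ≤ D := by exact_mod_cast Nat.one_le_iff_ne_zero.2 hD
  have h1 : |L (v - v') * b fun _ => w| ≤ ‖L‖ * ‖v - v'‖ * (‖b‖ * R ^ D) := by
    rw [abs_mul]
    exact mul_le_mul (L.le_opNorm _) (abs_diag_le b hw) (abs_nonneg _) (by positivity)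
  have h2 : |L v' * (b (fun _ => w) - b fun _ => w')| ≤
      ‖L‖ * R * (‖b‖ * D * R ^ (D - 1) * ‖w - w'‖) := by
    rw [abs_mul]
    exact mul_le_mul (L.le_opNorm_of_le hv') (abs_diag_sub_le b hw hw') (abs_nonneg _)
      (by positivity)
  calc |L v * b (fun _ => w) - L v' * b fun _ => w'|
      = |L (v - v') * b (fun _ => w) + L v' * (b (fun _ => w) - b fun _ => w')| := by
        rw [map_sub]
        congr 1
        ring
    _ ≤ ‖L‖ * ‖v - v'‖ * (‖b‖ * R ^ D) + ‖L‖ * R * (‖b‖ * D * R ^ (D - 1) * ‖w - w'‖) :=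
        (abs_add_le _ _).trans (add_le_add h1 h2)
    _ = ‖L‖ * ‖b‖ * R ^ D * ‖v - v'‖ * 1 + ‖L‖ * ‖b‖ * D * (R ^ (D - 1) * R) * ‖w - w'‖ := by
        ring
    _ ≤ ‖L‖ * ‖b‖ * R ^ D * ‖v - v'‖ * D + ‖L‖ * ‖b‖ * D * R ^ D * ‖w - w'‖ := by
        rw [← pow_succ, Nat.sub_add_cancel (Nat.one_le_iff_ne_zero.2 hD)]
        gcongr
    _ = _ := by ring

/-- The product of a linear form and a homogeneous polynomial. -/
def mulDiag (L : E →L[ℝ] ℝ) (b : ContinuousMultilinearMap ℝ (fun _ : Fin D => E) ℝ) :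
    ContinuousMultilinearMap ℝ (fun _ : Fin (D + 1) => E) ℝ :=
  ContinuousLinearMap.uncurryLeft (Ei := fun _ : Fin (D + 1) => E) (L.smulRight b)

lemma mulDiag_apply (L : E →L[ℝ] ℝ) (b : ContinuousMultilinearMap ℝ (fun _ : Fin D => E) ℝ)
    (v : E) : mulDiag L b (fun _ => v) = L v * b fun _ => v := by
  simp [mulDiag, Fin.tail_def]

/-- If the leading parts of a regular family of polynomials are differentiable along `S` at a
point where `S` is dense enough, then the family is approximated to one order more. -/
lemma exists_correction {S : Set E} {x : E} (hx : x ∈ S) {u : E → E → ℝ}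
    {q : E → ContinuousMultilinearMap ℝ (fun _ : Fin D => E) ℝ} {K r : ℝ} (hr : 0 < r)
    (hD : D ≠ 0) (hK : 0 ≤ K)
    (hu : ∀ s ∈ S, ∀ s' ∈ S, dist s s' < r → ∀ R > 0, ∀ w, ‖w‖ ≤ R → dist s s' ≤ R →
      |u s (s + w) - u s' (s + w) - (q s (fun _ => w) - q s' fun _ => w)| ≤
        K * dist s s' ^ 2 * R ^ (D - 1))
    {ι : Type} [Fintype ι] {w : ι → E}
    {b : ι → ContinuousMultilinearMap ℝ (fun _ : Fin D => E) ℝ}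
    (hb : ∀ (q : ContinuousMultilinearMap ℝ (fun _ : Fin D => E) ℝ) (v : E),
      q (fun _ => v) = ∑ i, q (fun _ => w i) * b i fun _ => v)
    (hq : ∀ i, DifferentiableWithinAt ℝ (fun s => q s fun _ => w i) S x)
    (hS : ∀ τ > 0, ∃ δ > 0, ∀ z, ‖z - x‖ < δ → ∃ s ∈ S, ‖s - z‖ ≤ τ * ‖z - x‖) :
    ∃ h : ContinuousMultilinearMap ℝ (fun _ : Fin (D + 1) => E) ℝ,
      ∀ ε > 0, ∃ δ > 0, ∀ y ∈ S, ‖y - x‖ < δ →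
        |u y y - u x y - h fun _ => y - x| ≤ ε * ‖y - x‖ ^ (D + 1) := by
  choose L hL using hq
  set H : E → E → ℝ := fun v w => ∑ i, L i v * b i fun _ => w with hH
  have key := exists_chain_estimate (H := H) (Q := fun s v => q s fun _ => v) hx hr hD hK
    (C := ∑ i, ‖L i‖ * ‖b i‖ * D) (by positivity) hu ?_ ?_ ?_ ?_ hS
  · refine ⟨(1 / ((D : ℝ) + 1)) • ∑ i, mulDiag (L i) (b i), fun ε hε => ?_⟩
    obtain ⟨δ, hδ, h⟩ := key ε hε
    refine ⟨δ, hδ, fun y hy hyx => ?_⟩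
    simpa [mulDiag_apply, hH] using h y hy hyx
  · intro ε hε
    set B : ℝ := ∑ i, ‖b i‖ with hB
    have hB0 : 0 ≤ B := by positivity
    have h1 : ∀ i, ∃ δ > 0, ∀ s ∈ S, ‖s - x‖ < δ →
        |q s (fun _ => w i) - q x (fun _ => w i) - L i (s - x)| ≤ ε / (B + 1) * ‖s - x‖ := by
      intro i
      have h2 := (hasFDerivWithinAt_iff_isLittleO.1 (hL i)).def (c := ε / (B + 1)) (by positivity)
      rw [eventually_nhdsWithin_iff, Metric.eventually_nhds_iff] at h2
      obtain ⟨δ, hδ, h2⟩ := h2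
      exact ⟨δ, hδ, fun s hs hsx => h2 (by rwa [dist_eq_norm]) hs⟩
    choose δ hδ hδL using h1
    obtain ⟨δ', hδ', hδ'i⟩ : ∃ δ' > 0, ∀ i, δ' ≤ δ i := by
      rcases isEmpty_or_nonempty ι with hι | hι
      · exact ⟨1, one_pos, fun i => hι.elim i⟩
      · obtain ⟨i, hi⟩ := Finite.exists_min δ
        exact ⟨δ i, hδ i, hi⟩
    refine ⟨δ', hδ', fun s hs hsx v => ?_⟩
    have h2 : q s (fun _ => v) - q x (fun _ => v) - H (s - x) v =
        ∑ i, (q s (fun _ => w i) - q x (fun _ => w i) - L i (s - x)) * b i fun _ => v := by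
      rw [hb (q s), hb (q x)]
      simp only [hH, sub_mul, Finset.sum_sub_distrib]
    rw [h2]
    calc _ ≤ ∑ i, ε / (B + 1) * ‖s - x‖ * (‖b i‖ * ‖v‖ ^ D) := by
          refine (Finset.abs_sum_le_sum_abs _ _).trans (Finset.sum_le_sum fun i _ => ?_)
          rw [abs_mul]
          exact mul_le_mul (hδL i s hs (hsx.trans_le (hδ'i i))) (abs_diag_le (b i) le_rfl)
            (abs_nonneg _) (by positivity)
      _ = B / (B + 1) * (ε * ‖s - x‖ * ‖v‖ ^ D) := by
          rw [← Finset.mul_sum, ← Finset.sum_mul]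
          ring
      _ ≤ 1 * (ε * ‖s - x‖ * ‖v‖ ^ D) := by
          gcongr
          rw [div_le_one (by positivity)]
          linarith
      _ = _ := one_mul _
  · intro R v v' w w' _ hv' hw hw'
    simp only [hH]
    rw [← Finset.sum_sub_distrib, Finset.sum_mul, Finset.sum_mul]
    exact (Finset.abs_sum_le_sum_abs _ _).trans
      (Finset.sum_le_sum fun i _ => abs_mul_diag_sub_le hD (L i) (b i) hv' hw hw')
  · intro v v' w
    simp only [hH, map_sub, sub_mul, Finset.sum_sub_distrib]
  · intro t t' v w
    simp only [hH, Finset.mul_sum, diag_smul, map_smul, smul_eq_mul]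
    exact Finset.sum_congr rfl fun i _ => by ring

end Family

variable {n m : ℕ}

lemma ae_exists_correction {S : Set (Ec n)} {u : Ec n → Ec n → ℝ} {D : ℕ} (hD : D ≠ 0)
    {q : Ec n → ContinuousMultilinearMap ℝ (fun _ : Fin D => Ec n) ℝ} {C r : ℝ} (hr : 0 < r)
    (hSr : ∀ s ∈ S, ∀ s' ∈ S, dist s s' < r)
    (hu : ∀ x z w, ∃ P : Polynomial ℝ, P.natDegree ≤ D ∧ P.coeff D = q x (fun _ => w) ∧
      ∀ t : ℝ, u x (z + t • w) = P.eval t)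
    (h : ∀ s ∈ S, ∀ s' ∈ S, dist s s' < r → ∀ z, ‖z - s‖ ≤ (D + 1) * dist s s' →
      |u s z - u s' z| ≤ C * dist s s' ^ (D + 1)) :
    ∀ᵐ x, x ∈ S → ∃ h : ContinuousMultilinearMap ℝ (fun _ : Fin (D + 1) => Ec n) ℝ,
      ∀ ε > 0, ∃ δ > 0, ∀ y ∈ S, ‖y - x‖ < δ →
        |u y y - u x y - h fun _ => y - x| ≤ ε * ‖y - x‖ ^ (D + 1) := by
  obtain ⟨K, hK, hlead⟩ := exists_leading_bound hD hu h
  obtain ⟨ι, _, w, b, hb⟩ := exists_interpolation (E := Ec n) D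
  have hlip : ∀ i, LipschitzOnWith (K * (‖w i‖ + 1) ^ D).toNNReal (fun s => q s fun _ => w i) S := by
    refine fun i => LipschitzOnWith.of_dist_le_mul fun s hs s' hs' => ?_
    rw [Real.coe_toNNReal _ (by positivity), Real.dist_eq]
    refine (hlead s hs s' hs' (hSr s hs s' hs') (‖w i‖ + 1) (by positivity) (w i)
      (by linarith)).1.trans_eq ?_
    ring
  filter_upwards [ae_densityPt S, ae_all_iff.2 fun i =>
    (hlip i).ae_differentiableWithinAt_of_mem_of_real (μ := volume)] with x hx1 hx2 hx
  exact exists_correction hx hr hD hK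
    (fun s hs s' hs' hss R hR w hw hR' => (hlead s hs s' hs' hss R hR w hw).2 hR') hb
    (fun i => hx2 i hx) fun τ hτ => (hx1 hx).exists_norm_sub_le hx hτ

variable {f : Ec n → Ec m} {p : Ec n → FormalMultilinearSeries ℝ (Ec n) (Ec m)}

/-- Add a homogeneous term of degree `D + 1` to a Taylor series of order `D`. -/
def addTerm (p : Ec n → FormalMultilinearSeries ℝ (Ec n) (Ec m)) (D : ℕ)
    (h : Ec n → Fin m → ContinuousMultilinearMap ℝ (fun _ : Fin (D + 1) => Ec n) ℝ) :
    Ec n → FormalMultilinearSeries ℝ (Ec n) (Ec m) := fun x =>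
  Function.update (p x) (D + 1) (∑ c, (h x c).smulRight (PiLp.single 2 c (1 : ℝ)))

lemma addTerm_of_ne {D j : ℕ} (hj : j ≠ D + 1)
    (h : Ec n → Fin m → ContinuousMultilinearMap ℝ (fun _ : Fin (D + 1) => Ec n) ℝ) (x : Ec n) :
    addTerm p D h x j = p x j :=
  Function.update_of_ne hj _ _

lemma addTerm_succ (D : ℕ)
    (h : Ec n → Fin m → ContinuousMultilinearMap ℝ (fun _ : Fin (D + 1) => Ec n) ℝ) (x : Ec n) :
    addTerm p D h x (D + 1) = ∑ c, (h x c).smulRight (PiLp.single 2 c (1 : ℝ)) :=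
  Function.update_self _ _ _

lemma taylorPoly_addTerm_apply (D : ℕ)
    (h : Ec n → Fin m → ContinuousMultilinearMap ℝ (fun _ : Fin (D + 1) => Ec n) ℝ) (x y : Ec n)
    (c : Fin m) : taylorPoly f (addTerm p D h) (D + 1) x y c =
      taylorPoly f p D x y c + h x c fun _ => y - x := by
  have h1 : ∀ j ∈ Finset.Icc 1 D, (addTerm p D h x j fun _ => y - x) = p x j fun _ => y - x := by
    intro j hj
    rw [addTerm_of_ne (Nat.lt_succ_of_le (Finset.mem_Icc.1 hj).2).ne]
  rw [taylorPoly, Finset.sum_Icc_succ_top (by omega), Finset.sum_congr rfl h1, ← add_assoc,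
    PiLp.add_apply, addTerm_succ]
  congr 1
  simp [Pi.single_apply]

lemma continuous_taylorPoly (i : ℕ) (x : Ec n) : Continuous (taylorPoly f p i x) := by
  unfold taylorPoly
  fun_prop

lemma measurableSet_badSet (hf : Measurable f) {G : Ec n → Ec m} (hG : Continuous G) (k : ℕ)
    (x : Ec n) (ε : ℝ) : MeasurableSet (badSet f G k x ε) := by
  have h1 : MeasurableSet {y | ε * ‖y - x‖ ^ k ≤ ‖f y - G y‖} :=
    measurableSet_le (by fun_prop) (hf.sub hG.measurable).norm
  exact (measurableSet_singleton x).compl.inter h1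

/-- Almost every point where `f` is approximated to order `O(|y - x| ^ (D + 1))` by its Taylor
polynomial has an approximate Taylor polynomial of order `D + 1`. -/
lemma ae_exists_addTerm (hn : 0 < n) (hf : Measurable f) {D : ℕ} (hD : D ≠ 0) {X : Set (Ec n)}
    (hX : ∀ x ∈ X, ∃ ε > 0, apSmall x (badSet f (taylorPoly f p D x) (D + 1) x ε)) :
    ∃ h : Ec n → Fin m → ContinuousMultilinearMap ℝ (fun _ : Fin (D + 1) => Ec n) ℝ,
      ∀ᵐ x, x ∈ X → ∀ ε > 0,
        apSmall x (badSet f (taylorPoly f (addTerm p D h) (D + 1) x) (D + 1) x ε) := by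
  set u : Fin m → Ec n → Ec n → ℝ := fun c x z => taylorPoly f p D x z c with hu
  have hcov : Cov X fun S => ∃ r > 0, (∀ s ∈ S, ∀ s' ∈ S, dist s s' < r) ∧ ∃ C : ℝ, ∀ c,
      ∀ s ∈ S, ∀ s' ∈ S, dist s s' < r → ∀ z, ‖z - s‖ ≤ (D + 1) * dist s s' →
        |u c s z - u c s' z| ≤ C * dist s s' ^ (D + 1) := by
    refine (cov_cls_of_apSmall hn f (linePoly_taylorPoly D) (D + 1) (b := false)
      fun x hx => by simpa [Quant] using hX x hx).bind fun S hS h => ?_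
    choose C hC using fun c => (h c (D + 1)).isBigO.bound
    have h1 := eventually_nearBall.1 (eventually_all.2 hC)
    refine (Cov.of_eventually_near h1).bind fun S' hS' ⟨r, hr, h2⟩ => ?_
    have h3 : ∀ x ∈ S', ∃ i : ℕ, dist x (TopologicalSpace.denseSeq (Ec n) i) < r / 2 :=
      fun x _ => (TopologicalSpace.denseRange_denseSeq (Ec n)).exists_dist_lt x (by positivity)
    refine (Cov.of_pointwise h3).mono fun S'' hS'' ⟨i, hi⟩ => ⟨r, hr, fun s hs s' hs' => ?_,
      ∑ c, |C c|, fun c s hs s' hs' hss z hz => ?_⟩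
    · linarith [dist_triangle_right s s' (TopologicalSpace.denseSeq (Ec n) i), hi s hs, hi s' hs']
    · have h4 := h2 s (hS'' hs) s' (hS'' hs') hss z hz c
      simp only [Real.norm_eq_abs, abs_pow, abs_of_nonneg dist_nonneg] at h4
      refine h4.trans ?_
      gcongr
      exact (le_abs_self _).trans
        (Finset.single_le_sum (f := fun c => |C c|) (fun _ _ => abs_nonneg _) (Finset.mem_univ c))
  obtain ⟨κ, _, S, hXS, hS⟩ := hcov
  have hae : ∀ᵐ x, ∀ i, x ∈ S i → DensityPt (S i) x ∧ ∀ c,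
      ∃ h : ContinuousMultilinearMap ℝ (fun _ : Fin (D + 1) => Ec n) ℝ,
        ∀ ε > 0, ∃ δ > 0, ∀ y ∈ S i, ‖y - x‖ < δ →
          |u c y y - u c x y - h fun _ => y - x| ≤ ε * ‖y - x‖ ^ (D + 1) := by
    refine ae_all_iff.2 fun i => ?_
    obtain ⟨r, hr, hSr, C, hC⟩ := (hS i).2
    have h1 := ae_all_iff.2 fun c => ae_exists_correction (q := fun x => coord p c x D) hD hr hSr
      (fun x z w => (exists_poly_taylorPoly (f := f) (p := p) D x z w c).imp
        fun P hP => ⟨hP.1, hP.2.1 hD, hP.2.2⟩) (hC c)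
    filter_upwards [ae_densityPt (S i), h1] with x hx1 hx2 hx
    exact ⟨hx1 hx, fun c => hx2 c hx⟩
  have hex : ∀ x, ∃ h : Fin m → ContinuousMultilinearMap ℝ (fun _ : Fin (D + 1) => Ec n) ℝ,
      (∀ i, x ∈ S i → DensityPt (S i) x ∧ ∀ c,
        ∃ h : ContinuousMultilinearMap ℝ (fun _ : Fin (D + 1) => Ec n) ℝ,
        ∀ ε > 0, ∃ δ > 0, ∀ y ∈ S i, ‖y - x‖ < δ →
          |u c y y - u c x y - h fun _ => y - x| ≤ ε * ‖y - x‖ ^ (D + 1)) → x ∈ X →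
      ∃ i, DensityPt (S i) x ∧ ∀ c, ∀ ε > 0, ∃ δ > 0, ∀ y ∈ S i, ‖y - x‖ < δ →
          |u c y y - u c x y - h c fun _ => y - x| ≤ ε * ‖y - x‖ ^ (D + 1) := by
    intro x
    by_cases hx : x ∈ X
    swap
    · exact ⟨0, fun _ h => absurd h hx⟩
    obtain ⟨i, hi⟩ := mem_iUnion.1 (hXS hx)
    by_cases hP : ∀ c, ∃ h : ContinuousMultilinearMap ℝ (fun _ : Fin (D + 1) => Ec n) ℝ,
        ∀ ε > 0, ∃ δ > 0, ∀ y ∈ S i, ‖y - x‖ < δ →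
          |u c y y - u c x y - h fun _ => y - x| ≤ ε * ‖y - x‖ ^ (D + 1)
    · choose h hh using hP
      exact ⟨h, fun hall _ => ⟨i, (hall i hi).1, hh⟩⟩
    · exact ⟨0, fun hall _ => absurd (hall i hi).2 hP⟩
  choose h hh using hex
  refine ⟨h, hae.mono fun x hx hxX ε hε => ?_⟩
  obtain ⟨i, hdens, hest⟩ := hh x hx hxX
  refine hdens.apSmall (measurableSet_badSet hf (continuous_taylorPoly _ _) _ _ _) ?_
  choose δ hδ hδe using fun c => hest c (ε / (m + 1)) (by positivity)
  obtain ⟨δ', hδ', hδ'c⟩ : ∃ δ' > 0, ∀ c, δ' ≤ δ c := by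
    rcases isEmpty_or_nonempty (Fin m) with hι | hι
    · exact ⟨1, one_pos, fun i => hι.elim i⟩
    · obtain ⟨c, hc⟩ := Finite.exists_min δ
      exact ⟨δ c, hδ c, hc⟩
  refine ⟨δ', hδ', fun y hy hyx hbad => hbad.2.not_gt ?_⟩
  have hpos : 0 < ‖y - x‖ ^ (D + 1) := pow_pos (norm_pos_iff.2 (sub_ne_zero.2 hbad.1)) _
  set v := f y - taylorPoly f (addTerm p D h) (D + 1) x y with hv
  have h1 : ∀ c, |v c| ≤ ε / (m + 1) * ‖y - x‖ ^ (D + 1) := by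
    intro c
    refine le_trans (le_of_eq ?_) (hδe c y hy (hyx.trans_le (hδ'c c)))
    simp only [hv, hu, PiLp.sub_apply, taylorPoly_addTerm_apply, taylorPoly_self, sub_sub]
  calc ‖v‖ = ‖∑ c, PiLp.single 2 c (v c)‖ := by
        congr 1
        ext c
        simp
    _ ≤ ∑ _c : Fin m, ε / (m + 1) * ‖y - x‖ ^ (D + 1) := by
        refine (norm_sum_le _ _).trans (Finset.sum_le_sum fun c _ => ?_)
        rw [PiLp.norm_single]
        exact h1 c
    _ = m / (m + 1) * (ε * ‖y - x‖ ^ (D + 1)) := by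
        rw [Finset.sum_const, Finset.card_univ, Fintype.card_fin, nsmul_eq_mul]
        ring
    _ < 1 * (ε * ‖y - x‖ ^ (D + 1)) := by
        gcongr
        rw [div_lt_one (by positivity)]
        linarith
    _ = _ := one_mul _

end HigherOrder

/-! ### Images of critical sets -/

section Critical

variable {n m : ℕ} {f : Ec n → Ec m} {p q : Ec n → FormalMultilinearSeries ℝ (Ec n) (Ec m)}
  {X B : Set (Ec n)} {i k : ℕ}

lemma volume_image_eq_zero_of_coord
    (h : volume ((fun x (c : Fin m) => f x c) '' X) = 0) : volume (f '' X) = 0 := by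
  refine measure_mono_null ?_
    ((PiLp.volume_preserving_ofLp (Fin m)).quasiMeasurePreserving.preimage_null h)
  rintro _ ⟨x, hx, rfl⟩
  exact ⟨x, hx, rfl⟩

lemma good_of_subset_approxCrit (hn : 0 < n) (hi : i ≠ 0) (hk : k ≠ 0) {b : Bool}
    (hpq : ∀ x, q x 1 = p x 1) (hXC : X ⊆ approxCrit f p)
    (hX : ∀ x ∈ X, Quant b fun ε => apSmall x (badSet f (taylorPoly f q i x) k x ε)) :
    Good b (fun x c => f x c) (k + m - 1) X :=
  good_of_apSmall hn hk (linePoly_taylorPoly i) (contDiff_taylorPoly i) hX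
    (fun x _ => taylorPoly_self i x) fun x hx => not_surjective_dirD (hXC hx) fun v c => by
      rw [dirD_taylorPoly hi, hpq]

lemma volume_image_eq_zero_of_volume_eq_zero (hn : 0 < n) (hm : 0 < m) (hi : i ≠ 0) (hk : k ≠ 0)
    (hkn : k + m - 1 = n) (hXC : X ⊆ approxCrit f p)
    (hX : ∀ x ∈ X, ∃ ε > 0, apSmall x (badSet f (taylorPoly f p i x) k x ε))
    (hX0 : volume X = 0) : volume (f '' X) = 0 := by
  have : Nonempty (Fin m) := ⟨⟨0, hm⟩⟩
  have h := good_of_subset_approxCrit (b := false) hn hi hk (fun _ => rfl) hXC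
    fun x hx => by simpa [Quant] using hX x hx
  rw [hkn] at h
  refine volume_image_eq_zero_of_coord (h.volume_eq_zero_of_null ?_)
  have h1 : Measure.IsAddHaarMeasure (μH[(n : ℝ)] : Measure (Ec n)) := by
    simpa using isAddHaarMeasure_hausdorffMeasure (E := Ec n)
  exact Measure.absolutelyContinuous_isAddHaarMeasure _ volume hX0

lemma volume_image_eq_zero_of_sigmaFinH (hn : 0 < n) (hm : 0 < m) (hi : i ≠ 0) (hk : k ≠ 0)
    (hpq : ∀ x, q x 1 = p x 1) (hXC : X ⊆ approxCrit f p)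
    (hX : ∀ x ∈ X, ∀ ε > 0, apSmall x (badSet f (taylorPoly f q i x) k x ε)) (hXB : X ⊆ B)
    (hB : SigmaFinH ((k : ℝ) + m - 1) B) : volume (f '' X) = 0 := by
  have : Nonempty (Fin m) := ⟨⟨0, hm⟩⟩
  have h := good_of_subset_approxCrit (b := true) hn hi hk hpq hXC
    fun x hx => by simpa [Quant] using hX x hx
  obtain ⟨T, rfl, hT⟩ := hB
  refine volume_image_eq_zero_of_coord (h.volume_eq_zero_of_sigmaFinite hXB fun j => ?_)
  rw [Nat.cast_sub (by omega)]
  push_cast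
  exact hT j

lemma sigmaFinH_univ (n : ℕ) : SigmaFinH (n : ℝ) (univ : Set (Ec n)) := by
  have h1 : Measure.IsAddHaarMeasure (μH[(n : ℝ)] : Measure (Ec n)) := by
    simpa using isAddHaarMeasure_hausdorffMeasure (E := Ec n)
  exact ⟨fun j => closedBall 0 j, (iUnion_closedBall_nat 0).symm, fun j =>
    measure_closedBall_lt_top⟩

lemma apSmall_badSet_one {x : Ec n} (h : ApproxDiff1At f p x) :
    ∀ ε > 0, apSmall x (badSet f (taylorPoly f p 1 x) 1 x ε) := fun ε hε => by
  simpa [badSet] using h ε hε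

lemma volume_image_eq_zero_of_exceptional (hn : 0 < n) (hm : 0 < m) {D : ℕ} {Ni : ℕ → Set (Ec n)}
    (hNi : ∀ i : ℕ, 2 ≤ i → i ≤ D → SigmaFinH ((i : ℝ) + m - 2) (Ni i))
    (hc : ∀ i : ℕ, 2 ≤ i → i ≤ D → ∀ x ∉ Ni i, ∀ ε > (0 : ℝ),
      apSmall x (badSet f (taylorPoly f p i x) i x ε)) (hi : i ≠ 0) (hiD : i ≤ D)
    (hXC : X ⊆ approxCrit f p) (hXB : X ⊆ B) (hB : SigmaFinH ((i : ℝ) + m - 1) B) :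
    volume (f '' X) = 0 := by
  induction i generalizing X B with
  | zero => exact absurd rfl hi
  | succ i ih =>
    rcases eq_or_ne i 0 with rfl | hi0
    · exact volume_image_eq_zero_of_sigmaFinH hn hm one_ne_zero one_ne_zero (fun _ => rfl) hXC
        (fun x hx => apSmall_badSet_one (hXC hx).1) hXB (by simpa using hB)
    rw [← sdiff_union_inter X (Ni (i + 1)), image_union, measure_union_null_iff]
    constructor
    · exact volume_image_eq_zero_of_sigmaFinH hn hm hi hi (fun _ => rfl)
        (sdiff_subset.trans hXC) (fun x hx => hc (i + 1) (by omega) hiD x hx.2)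
        (sdiff_subset.trans hXB) hB
    · refine ih hi0 (by omega) (inter_subset_left.trans hXC) inter_subset_right ?_
      have := hNi (i + 1) (by omega) hiD
      rwa [show ((i + 1 : ℕ) : ℝ) + m - 2 = i + m - 1 by push_cast; ring] at this

lemma volume_image_eq_zero_of_order_succ (hn : 0 < n) (hm : 0 < m) (hf : Measurable f) {D : ℕ}
    (hD : D ≠ 0) (hDn : D + m = n) (hXC : X ⊆ approxCrit f p)
    (hX : ∀ x ∈ X, ∃ ε > 0, apSmall x (badSet f (taylorPoly f p D x) (D + 1) x ε)) :
    volume (f '' X) = 0 := by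
  obtain ⟨h, hh⟩ := ae_exists_addTerm hn hf hD hX
  set Z : Set (Ec n) := {x | ¬ (x ∈ X → ∀ ε > 0,
    apSmall x (badSet f (taylorPoly f (addTerm p D h) (D + 1) x) (D + 1) x ε))} with hZ
  rw [← sdiff_union_inter X Z, image_union, measure_union_null_iff]
  constructor
  · refine volume_image_eq_zero_of_sigmaFinH (q := addTerm p D h) hn hm D.succ_ne_zero
      D.succ_ne_zero (fun x => addTerm_of_ne (by omega) h x) (sdiff_subset.trans hXC)
      (fun x hx => not_not.1 hx.2 hx.1) (subset_univ _) ?_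
    have := sigmaFinH_univ n
    rwa [show ((D + 1 : ℕ) : ℝ) + m - 1 = n by rw [← hDn]; push_cast; ring]
  · exact volume_image_eq_zero_of_volume_eq_zero hn hm hD D.succ_ne_zero (by omega)
      (inter_subset_left.trans hXC) (fun x hx => hX x hx.1)
      (measure_mono_null inter_subset_right hh)

end Critical

end MorseSard

/-- Morse–Sard theorem for Borel functions that are approximately
differentiable outside sigmafinite exceptional sets. -/
theorem morse_sard_sigmafinite {n m : ℕ} (hm : 0 < m) (hmn : m ≤ n)
    (f : Ec n → Ec m) (hf : Measurable f)
    (p : Ec n → FormalMultilinearSeries ℝ (Ec n) (Ec m))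
    (hpBorel : ∀ i ≤ n - m, StronglyMeasurable fun x => p x i)
    -- (a)
    (N₀ : Set (Ec n)) (hN₀ : N₀.Countable)
    (ha : ∀ x ∉ N₀, ∃ lam : ℝ,
      apSmall x {y | y ≠ x ∧ lam * ‖y - x‖ ≤ ‖f y - f x‖})
    -- (b)
    (N₁ : Set (Ec n)) (hN₁ : μH[(m : ℝ)] N₁ = 0)
    (hb : ∀ x ∉ N₁, ApproxDiff1At f p x)
    -- (c)
    (Ni : ℕ → Set (Ec n))
    (hNi : ∀ i : ℕ, 2 ≤ i → i ≤ n - m → SigmaFinH ((i : ℝ) + m - 2) (Ni i))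
    (hc : ∀ i : ℕ, 2 ≤ i → i ≤ n - m → ∀ x ∉ Ni i, ∀ ε > (0 : ℝ),
      apSmall x {y | y ≠ x ∧ ε * ‖y - x‖ ^ i ≤ ‖f y - taylorPoly f p i x y‖})
    -- (d)
    (N' : Set (Ec n)) (hN' : SigmaFinH ((n : ℝ) - 1) N')
    (hd : ∀ x ∉ N', ∃ lam : ℝ,
      apSmall x {y | y ≠ x ∧
        lam * ‖y - x‖ ^ (n - m + 1) ≤ ‖f y - taylorPoly f p (n - m) x y‖}) :
    volume (f '' approxCrit f p) = 0 := by
  have hn : 0 < n := hm.trans_le hmn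
  have hDn : n - m + m = n := Nat.sub_add_cancel hmn
  rcases eq_or_ne (n - m) 0 with hD | hD
  · refine MorseSard.volume_image_eq_zero_of_sigmaFinH (k := 1) hn hm one_ne_zero one_ne_zero
      (fun _ => rfl) subset_rfl (fun x hx => MorseSard.apSmall_badSet_one hx.1) (subset_univ _) ?_
    have := MorseSard.sigmaFinH_univ n
    rwa [show ((1 : ℕ) : ℝ) + m - 1 = n by rw [← hDn, hD]; push_cast; ring]
  rw [← sdiff_union_inter (approxCrit f p) N', image_union, measure_union_null_iff]
  constructor
  · refine MorseSard.volume_image_eq_zero_of_order_succ hn hm hf hD hDn sdiff_subset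
      fun x hx => ?_
    obtain ⟨lam, hlam⟩ := hd x hx.2
    exact ⟨max lam 1, by positivity,
      MorseSard.apSmall_mono hlam (MorseSard.badSet_anti (le_max_left _ _))⟩
  · refine MorseSard.volume_image_eq_zero_of_exceptional hn hm hNi hc hD le_rfl
      inter_subset_left inter_subset_right ?_
    rwa [show ((n - m : ℕ) : ℝ) + m - 1 = (n : ℝ) - 1 by rw [Nat.cast_sub hmn]; ring]

end
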